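/- arXiv:1208.2538 — 2 statements merged into one kernel-verified Lean document; each statement's English description precedes it below -/
import Mathlib

section
/- Let w be a nontrivial element of a free group of finite rank d. There exists a positive integer N depending only on w such that the following holds: for all integers n ≥ 2 and prime powers q, let L = PSL(n,q) and let w(L) ⊆ L be the image of the word map L^d → L induced by w; if |L| > N and W is any subset of w(L) with |W| ≥ |w(L)|/q^{(n-1)/13}, then W³ = L. -/
open scoped MatrixGroups Pointwise commutatorElement

set_option linter.unusedSectionVars false

section GramOperator

variable {E H : Type*} [NormedAddCommGroup E] [InnerProductSpace ℂ E] [NormedAddCommGroup H]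
  [InnerProductSpace ℂ H]

lemma norm_sq_of_gram_eigenvector {T : E →ₗ[ℂ] H} {S : E →ₗ[ℂ] E}
    (hS : ∀ u w, inner ℂ (S u) w = inner ℂ (T u) (T w)) {u : E} (hu : ‖u‖ = 1) {l : ℝ}
    (hl : S u = (l : ℂ) • u) : ‖T u‖ ^ 2 = l := by
  have h1 := hS u u
  rw [hl, inner_smul_left, inner_self_eq_norm_sq_to_K, inner_self_eq_norm_sq_to_K, hu] at h1
  apply Complex.ofReal_injective
  simpa using h1.symm

variable [FiniteDimensional ℂ E]

lemma exists_gram_operator [FiniteDimensional ℂ H] (T : E →ₗ[ℂ] H) :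
    ∃ S : E →ₗ[ℂ] E, ∀ u w, inner ℂ (S u) w = inner ℂ (T u) (T w) :=
  ⟨(LinearMap.adjoint T).comp T, fun u w => LinearMap.adjoint_inner_left T w (T u)⟩

lemma norm_sq_le_of_gram_eigenvalue_le {T : E →ₗ[ℂ] H} {S : E →ₗ[ℂ] E}
    (hS : ∀ u w, inner ℂ (S u) w = inner ℂ (T u) (T w)) {c : ℝ}
    (hc : ∀ l : ℝ, 0 ≤ l → (∃ u, u ≠ 0 ∧ S u = (l : ℂ) • u) → l ≤ c) (u : E) :
    ‖T u‖ ^ 2 ≤ c * ‖u‖ ^ 2 := by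
  have hsymm : S.IsSymmetric := fun u w => by
    rw [hS, ← inner_conj_symm, ← hS, inner_conj_symm]
  let b := hsymm.eigenvectorBasis rfl
  have hb : ∀ i, S (b i) = (hsymm.eigenvalues rfl i : ℂ) • b i :=
    fun i => hsymm.apply_eigenvectorBasis rfl i
  have hle : ∀ i, hsymm.eigenvalues rfl i ≤ c := by
    intro i
    refine hc _ ?_ ⟨b i, b.orthonormal.ne_zero i, hb i⟩
    have h2 := norm_sq_of_gram_eigenvector hS (b.orthonormal.1 i) (hb i)
    rw [← h2]; positivity
  have h1 : (‖T u‖ ^ 2 : ℝ) = ∑ i, hsymm.eigenvalues rfl i * ‖inner ℂ (b i) u‖ ^ 2 := by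
    have h2 : inner ℂ (S u) u =
        ∑ i, (hsymm.eigenvalues rfl i : ℂ) * (‖inner ℂ (b i) u‖ : ℂ) ^ 2 := by
      rw [← b.sum_inner_mul_inner]
      refine Finset.sum_congr rfl fun i _ => ?_
      rw [hsymm u (b i), hb, inner_smul_right, mul_assoc]
      congr 1
      rw [← inner_conj_symm, ← Complex.normSq_eq_conj_mul_self, Complex.normSq_eq_norm_sq]
      push_cast; rfl
    rw [hS, inner_self_eq_norm_sq_to_K] at h2
    apply Complex.ofReal_injective
    simpa using h2
  have h3 : ‖u‖ ^ 2 = ∑ i, ‖inner ℂ (b i) u‖ ^ 2 := (b.sum_sq_norm_inner_right u).symm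
  rw [h1, h3, Finset.mul_sum]
  exact Finset.sum_le_sum fun i _ => mul_le_mul_of_nonneg_right (hle i) (by positivity)

lemma exists_orthonormal_mem (W : Submodule ℂ E) :
    ∃ b : Fin (Module.finrank ℂ W) → E, Orthonormal ℂ b ∧ ∀ j, b j ∈ W :=
  ⟨fun j => stdOrthonormalBasis ℂ W j,
    (stdOrthonormalBasis ℂ W).orthonormal.comp_linearIsometry W.subtypeₗᵢ, fun _ => Subtype.prop _⟩

end GramOperator

section Mixing

variable {G : Type}

/-- The subspace of functions with zero sum. -/
noncomputable def zeroSum (G : Type) [Fintype G] : Submodule ℂ (EuclideanSpace ℂ G) where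
  carrier := {v | ∑ x, v x = 0}
  add_mem' {u v} hu hv := by
    simp only [Set.mem_ofPred_eq] at *; simp [Finset.sum_add_distrib, hu, hv]
  zero_mem' := by simp
  smul_mem' c v hv := by
    simp only [Set.mem_ofPred_eq] at *; simp [← Finset.mul_sum, hv]

lemma mem_zeroSum [Fintype G] {v : EuclideanSpace ℂ G} : v ∈ zeroSum G ↔ ∑ x, v x = 0 := Iff.rfl

variable [Group G]

/-- Right translation on the Hilbert space of functions on a finite group. -/
noncomputable def rightTranslation (g : G) :
    EuclideanSpace ℂ G →ₗ[ℂ] EuclideanSpace ℂ G where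
  toFun v := WithLp.toLp 2 fun x => v (x * g)
  map_add' _ _ := rfl
  map_smul' _ _ := rfl

/-- Left convolution with the indicator function of a finite subset of the group. -/
noncomputable def leftConvolution (B : Finset G) :
    EuclideanSpace ℂ G →ₗ[ℂ] EuclideanSpace ℂ G where
  toFun v := WithLp.toLp 2 fun x => ∑ b ∈ B, v (b⁻¹ * x)
  map_add' u v := by ext x; simp [Finset.sum_add_distrib]
  map_smul' c v := by ext x; simp [Finset.mul_sum]

@[simp] lemma rightTranslation_apply (g : G) (v : EuclideanSpace ℂ G) (x : G) :
    rightTranslation g v x = v (x * g) := rfl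

@[simp] lemma leftConvolution_apply (B : Finset G) (v : EuclideanSpace ℂ G) (x : G) :
    leftConvolution B v x = ∑ b ∈ B, v (b⁻¹ * x) := rfl

lemma leftConvolution_rightTranslation (B : Finset G) (g : G) (v : EuclideanSpace ℂ G) :
    leftConvolution B (rightTranslation g v) = rightTranslation g (leftConvolution B v) := by
  ext x; simp [mul_assoc]

lemma rightTranslation_inv_rightTranslation (g : G) (v : EuclideanSpace ℂ G) :
    rightTranslation g⁻¹ (rightTranslation g v) = v := by
  ext x; simp [mul_assoc]

variable [Fintype G]

lemma inner_rightTranslation (g : G) (u v : EuclideanSpace ℂ G) :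
    inner ℂ (rightTranslation g u) (rightTranslation g v) = inner ℂ u v := by
  simp only [PiLp.inner_apply, rightTranslation_apply]
  exact Equiv.sum_comp (Equiv.mulRight g) fun x => inner ℂ (u x) (v x)

lemma rightTranslation_mem_zeroSum (g : G) {v : EuclideanSpace ℂ G} (hv : v ∈ zeroSum G) :
    rightTranslation g v ∈ zeroSum G := by
  rw [mem_zeroSum] at *
  simp only [rightTranslation_apply]
  rw [← hv]
  exact Equiv.sum_comp (Equiv.mulRight g) fun x => v x

/-- Hilbert–Schmidt bound for convolution operators. -/
lemma sum_norm_sq_leftConvolution_le (B : Finset G) {ι : Type*} [Fintype ι]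
    {u : ι → EuclideanSpace ℂ G} (hu : Orthonormal ℂ u) :
    ∑ i, ‖leftConvolution B (u i)‖ ^ 2 ≤ (B.card * Fintype.card G : ℝ) := by
  classical
  let row : G → EuclideanSpace ℂ G := fun x =>
    WithLp.toLp 2 fun y => if x * y⁻¹ ∈ B then 1 else 0
  have hrow : ∀ x v, leftConvolution B v x = inner ℂ (row x) v := by
    intro x v
    rw [leftConvolution_apply]
    simp only [PiLp.inner_apply, row]
    have : ∀ y, inner ℂ (if x * y⁻¹ ∈ B then (1 : ℂ) else 0) (v y)
        = if x * y⁻¹ ∈ B then v y else 0 := by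
      intro y; split_ifs <;> simp
    simp only [this]
    rw [← Finset.sum_filter]
    refine Finset.sum_bij' (fun b _ => b⁻¹ * x) (fun y _ => x * y⁻¹) ?_ ?_ ?_ ?_ ?_ <;> simp
  have hnorm : ∀ x, ‖row x‖ ^ 2 = B.card := by
    intro x
    rw [EuclideanSpace.norm_sq_eq]
    have : ∀ y, ‖(row x) y‖ ^ 2 = if x * y⁻¹ ∈ B then (1 : ℝ) else 0 := by
      intro y; simp only [row]; split_ifs <;> simp
    simp only [this]
    rw [← Finset.sum_filter, Finset.sum_const, nsmul_eq_mul, mul_one]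
    congr 1
    refine Finset.card_bij' (fun y _ => x * y⁻¹) (fun b _ => b⁻¹ * x) ?_ ?_ ?_ ?_ <;> simp
  simp only [EuclideanSpace.norm_sq_eq]
  rw [Finset.sum_comm]
  calc ∑ x, ∑ i, ‖(leftConvolution B (u i)) x‖ ^ 2 ≤ ∑ x : G, (B.card : ℝ) := by
        refine Finset.sum_le_sum fun x _ => ?_
        rw [← hnorm x]
        refine le_trans (le_of_eq ?_) (hu.sum_inner_products_le (row x) (s := Finset.univ))
        refine Finset.sum_congr rfl fun i _ => ?_
        rw [hrow, norm_inner_symm]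
    _ = _ := by simp [mul_comm]

/-- Right translation on the functions of zero sum. -/
noncomputable def zeroSumTranslation (g : G) : zeroSum G →ₗ[ℂ] zeroSum G :=
  (rightTranslation g).restrict fun _ hv => rightTranslation_mem_zeroSum g hv

lemma coe_zeroSumTranslation (g : G) (u : zeroSum G) :
    (zeroSumTranslation g u : EuclideanSpace ℂ G) = rightTranslation g u := rfl

lemma le_finrank_eigenspace {D : ℝ}
    (hD : ∀ (V : Type) [AddCommGroup V] [Module ℂ V] [FiniteDimensional ℂ V]
      (ρ : Representation ℂ G V), (∀ v, (∀ g, ρ g v = v) → v = 0) → Nontrivial V →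
      D ≤ Module.finrank ℂ V)
    {S : zeroSum G →ₗ[ℂ] zeroSum G}
    (hS : ∀ g u, S (zeroSumTranslation g u) = zeroSumTranslation g (S u))
    {l : ℂ} {u₀ : zeroSum G} (hu₀ : u₀ ≠ 0) (hSu₀ : S u₀ = l • u₀) :
    D ≤ Module.finrank ℂ (Module.End.eigenspace S l) := by
  have hWR : ∀ g, ∀ u ∈ Module.End.eigenspace S l,
      zeroSumTranslation g u ∈ Module.End.eigenspace S l := by
    intro g u hu
    rw [Module.End.mem_eigenspace_iff] at *
    rw [hS, hu, map_smul]
  let ρ : Representation ℂ G (Module.End.eigenspace S l) :=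
    { toFun := fun g => (zeroSumTranslation g).restrict (hWR g)
      map_one' := by
        ext u x
        change (u : EuclideanSpace ℂ G) (x * 1) = (u : EuclideanSpace ℂ G) x
        rw [mul_one]
      map_mul' := fun g h => by
        ext u x
        change (u : EuclideanSpace ℂ G) (x * (g * h)) = (u : EuclideanSpace ℂ G) (x * g * h)
        rw [mul_assoc] }
  have hρ : ∀ g u x, (ρ g u : EuclideanSpace ℂ G) x = (u : EuclideanSpace ℂ G) (x * g) :=
    fun _ _ _ => rfl
  refine hD _ ρ ?_ ⟨⟨u₀, Module.End.mem_eigenspace_iff.2 hSu₀⟩, 0,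
    fun h => hu₀ (congrArg Subtype.val h)⟩
  intro u hu
  have hconst : ∀ x, (u : EuclideanSpace ℂ G) x = (u : EuclideanSpace ℂ G) 1 := by
    intro x
    have := hρ x u 1
    rwa [hu x, one_mul, eq_comm] at this
  have hsum := mem_zeroSum.1 u.1.2
  simp only [hconst, Finset.sum_const, Finset.card_univ, nsmul_eq_mul] at hsum
  have h0 : (u : EuclideanSpace ℂ G) 1 = 0 := by
    rcases mul_eq_zero.1 hsum with h | h
    · simp at h
    · exact h
  refine Subtype.ext (Subtype.ext (PiLp.ext fun x => ?_))
  rw [hconst, h0]; rfl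

/-- If all nontrivial representations have dimension at least `D`, convolution operators are
contractive on functions of zero sum. -/
lemma norm_sq_leftConvolution_le {D : ℝ} (hD0 : 0 < D)
    (hD : ∀ (V : Type) [AddCommGroup V] [Module ℂ V] [FiniteDimensional ℂ V]
      (ρ : Representation ℂ G V), (∀ v, (∀ g, ρ g v = v) → v = 0) → Nontrivial V →
      D ≤ Module.finrank ℂ V)
    (B : Finset G) {v : EuclideanSpace ℂ G} (hv : v ∈ zeroSum G) :
    ‖leftConvolution B v‖ ^ 2 ≤ (B.card * Fintype.card G : ℝ) / D * ‖v‖ ^ 2 := by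
  obtain ⟨T, hT⟩ : ∃ T : zeroSum G →ₗ[ℂ] EuclideanSpace ℂ G, ∀ u, T u = leftConvolution B u :=
    ⟨(leftConvolution B).comp (zeroSum G).subtype, fun _ => rfl⟩
  obtain ⟨S, hinner⟩ := exists_gram_operator (E := zeroSum G) (H := EuclideanSpace ℂ G) T
  have hRinner : ∀ g (u w : zeroSum G),
      inner ℂ (zeroSumTranslation g u) (zeroSumTranslation g w) = inner ℂ u w := fun g u w =>
    inner_rightTranslation g u w
  have hTR : ∀ g u, T (zeroSumTranslation g u) = rightTranslation g (T u) := fun g u => by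
    rw [hT, hT, coe_zeroSumTranslation, leftConvolution_rightTranslation]
  have hRR : ∀ g (u : zeroSum G), zeroSumTranslation g (zeroSumTranslation g⁻¹ u) = u :=
    fun g u => by
      have := rightTranslation_inv_rightTranslation g⁻¹ (u : EuclideanSpace ℂ G)
      rw [inv_inv] at this
      exact Subtype.ext this
  have hSR : ∀ g u, S (zeroSumTranslation g u) = zeroSumTranslation g (S u) := by
    intro g u
    refine ext_inner_right ℂ fun w => ?_
    rw [← hRR g w, hRinner, hinner, hinner, hTR, hTR, inner_rightTranslation]
  have hTv := norm_sq_le_of_gram_eigenvalue_le (E := zeroSum G) (H := EuclideanSpace ℂ G) hinner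
    (c := (B.card * Fintype.card G : ℝ) / D) ?_ ⟨v, hv⟩
  · rw [hT] at hTv
    exact hTv
  rintro l hl0 ⟨u₀, hu₀, hSu₀⟩
  have hdim := le_finrank_eigenspace hD hSR hu₀ hSu₀
  obtain ⟨b, hb, hbW⟩ := exists_orthonormal_mem (E := zeroSum G) (Module.End.eigenspace S (l : ℂ))
  have hHS := sum_norm_sq_leftConvolution_le B (u := fun j => (b j : EuclideanSpace ℂ G))
    (hb.comp_linearIsometry (zeroSum G).subtypeₗᵢ)
  have hl' : ∀ j, ‖leftConvolution B (b j : EuclideanSpace ℂ G)‖ ^ 2 = l := fun j => by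
    rw [← hT]
    exact norm_sq_of_gram_eigenvector (E := zeroSum G) (H := EuclideanSpace ℂ G) hinner (hb.1 j)
      (Module.End.mem_eigenspace_iff.1 (hbW j))
  simp only [hl', Finset.sum_const, Finset.card_univ, Fintype.card_fin, nsmul_eq_mul] at hHS
  rw [le_div_iff₀ hD0]
  nlinarith

/-- Gowers' trick: in a group all of whose nontrivial representations have dimension at least `D`,
the product of three large subsets is the whole group. -/
theorem exists_mul_mul_eq_of_quasirandom {D : ℝ} (hD0 : 0 < D)
    (hD : ∀ (V : Type) [AddCommGroup V] [Module ℂ V] [FiniteDimensional ℂ V]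
      (ρ : Representation ℂ G V), (∀ v, (∀ g, ρ g v = v) → v = 0) → Nontrivial V →
      D ≤ Module.finrank ℂ V)
    (A B C : Finset G)
    (h : (Fintype.card G : ℝ) ^ 3 < D * (A.card * B.card * C.card)) (x : G) :
    ∃ a ∈ A, ∃ b ∈ B, ∃ c ∈ C, a * b * c = x := by
  classical
  by_contra! hno
  set N : ℝ := (Fintype.card G : ℝ) with hN
  have hNpos : 0 < N := by simp [hN, Fintype.card_pos]
  let ind : Finset G → EuclideanSpace ℂ G := fun S => WithLp.toLp 2 fun y => if y ∈ S then 1 else 0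
  let v : EuclideanSpace ℂ G := WithLp.toLp 2 fun y => (if y ∈ C then 1 else 0) - (C.card / N : ℂ)
  have hv : v ∈ zeroSum G := by
    rw [mem_zeroSum]
    have hN0 : (Fintype.card G : ℂ) ≠ 0 := by simp
    simp only [v, Finset.sum_sub_distrib, Finset.sum_ite_mem, Finset.univ_inter, Finset.sum_const,
      Finset.card_univ, nsmul_eq_mul, hN]
    push_cast
    field_simp
    simp
  have hvn : ‖v‖ ^ 2 ≤ C.card := by
    have h1 : ‖v‖ ^ 2 = C.card - C.card ^ 2 / N := by
      rw [EuclideanSpace.norm_sq_eq]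
      have : ∀ y, ‖v y‖ ^ 2 = (if y ∈ C then 1 - 2 * (C.card / N) else 0) + (C.card / N) ^ 2 := by
        intro y
        have : v y = (((if y ∈ C then 1 else 0) - C.card / N : ℝ) : ℂ) := by
          simp only [v]; split_ifs <;> simp
        rw [this, Complex.norm_real, Real.norm_eq_abs, sq_abs]
        split_ifs <;> ring
      simp only [this, Finset.sum_add_distrib, Finset.sum_ite_mem, Finset.univ_inter,
        Finset.sum_const, Finset.card_univ, nsmul_eq_mul, ← hN]
      field_simp
      ring
    rw [h1]
    have : 0 ≤ (C.card : ℝ) ^ 2 / N := by positivity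
    linarith
  let A' : Finset G := A.image fun a => a⁻¹ * x
  have hA' : A'.card = A.card :=
    Finset.card_image_of_injective _ fun a b hab => by simpa using hab
  have hA'n : ‖ind A'‖ ^ 2 = A.card := by
    rw [EuclideanSpace.norm_sq_eq]
    have : ∀ y, ‖(ind A') y‖ ^ 2 = if y ∈ A' then (1 : ℝ) else 0 := by
      intro y; simp only [ind]; split_ifs <;> simp
    simp only [this]
    simp [hA']
  have hin : inner ℂ (ind A') (leftConvolution B v) = -((A.card * B.card * C.card / N : ℝ) : ℂ) := by
    simp only [PiLp.inner_apply, leftConvolution_apply, ind]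
    have h1 : ∀ y, inner ℂ (if y ∈ A' then (1 : ℂ) else 0) (∑ b ∈ B, v (b⁻¹ * y))
        = if y ∈ A' then -((B.card * C.card / N : ℝ) : ℂ) else 0 := by
      intro y
      split_ifs with hy
      · simp only [A', Finset.mem_image] at hy
        obtain ⟨a, ha, rfl⟩ := hy
        have h2 : ∀ b ∈ B, v (b⁻¹ * (a⁻¹ * x)) = -((C.card / N : ℝ) : ℂ) := by
          intro b hb
          have : b⁻¹ * (a⁻¹ * x) ∉ C := fun hc => hno a ha b hb _ hc (by group)
          simp [v, this]
        rw [Finset.sum_congr rfl h2]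
        simp [mul_div_assoc]
      · simp
    simp only [h1]
    simp [hA']
    ring
  have hcs := norm_inner_le_norm (𝕜 := ℂ) (ind A') (leftConvolution B v)
  rw [hin, norm_neg, Complex.norm_real, Real.norm_of_nonneg (by positivity)] at hcs
  have hop := norm_sq_leftConvolution_le hD0 hD B hv
  rw [← hN] at hop
  have h4 : (A.card * B.card * C.card / N : ℝ) ^ 2 ≤ A.card * (B.card * N / D * C.card) := by
    calc (A.card * B.card * C.card / N : ℝ) ^ 2
        ≤ (‖ind A'‖ * ‖leftConvolution B v‖) ^ 2 := by gcongr
      _ = ‖ind A'‖ ^ 2 * ‖leftConvolution B v‖ ^ 2 := by ring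
      _ ≤ A.card * (B.card * N / D * C.card) := by
        rw [hA'n]
        refine mul_le_mul_of_nonneg_left (hop.trans ?_) (by positivity)
        gcongr
  set P : ℝ := A.card * B.card * C.card with hP
  have hPpos : 0 < P := by
    by_contra hneg
    have : P ≤ 0 := not_lt.1 hneg
    nlinarith [pow_pos hNpos 3]
  have h5 : (A.card * (B.card * N / D * C.card) : ℝ) = P * N / D := by rw [hP]; ring
  rw [h5, div_pow, div_le_div_iff₀ (by positivity) hD0] at h4
  have : P * (D * P) ≤ P * N ^ 3 := by nlinarith
  have := le_of_mul_le_mul_left this hPpos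
  linarith

end Mixing

section Generation

variable {ι F : Type*} [DecidableEq ι] [Fintype ι] [Field F]

open Matrix

lemma Matrix.weyl_eq_transvection_prod {i j : ι} (hij : i ≠ j) {a : F} (ha : a ≠ 0) :
    transvection i j a * transvection j i (-a⁻¹) * transvection i j a =
      1 - single i i 1 - single j j 1 + single i j a - single j i a⁻¹ := by
  have hji := hij.symm
  have hneg : ∀ (k l : ι) (x : F), single k l (-x) = -single k l x := fun k l x => by
    ext; simp only [single_apply, neg_apply]; split_ifs <;> simp
  simp only [transvection, mul_add, add_mul, one_mul, mul_one, single_mul_single_same, hji,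
    single_mul_single_of_ne, ne_eq, not_false_eq_true, add_zero]
  have e1 : a * -a⁻¹ = -1 := by field_simp
  have e2 : -a⁻¹ * a = -1 := by field_simp
  simp only [e1, e2, hneg, neg_mul, one_mul]
  abel

lemma Matrix.torus_eq_transvection_prod {i j : ι} (hij : i ≠ j) {a : F} (ha : a ≠ 0) :
    (transvection i j a * transvection j i (-a⁻¹) * transvection i j a) *
      (transvection i j (-1) * transvection j i (-(-1)⁻¹) * transvection i j (-1)) =
      diagonal (Function.update (Function.update 1 i a) j a⁻¹) := by
  rw [weyl_eq_transvection_prod hij ha, weyl_eq_transvection_prod hij (by simp : (-1 : F) ≠ 0)]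
  have hji := hij.symm
  have hneg : ∀ (k l : ι) (x : F), single k l (-x) = -single k l x := fun k l x => by
    ext; simp only [single_apply, neg_apply]; split_ifs <;> simp
  have h : diagonal (Function.update (Function.update (1 : ι → F) i a) j a⁻¹) =
      1 - single i i 1 - single j j 1 + single i i a + single j j a⁻¹ := by
    ext k l
    simp only [diagonal_apply, sub_apply, add_apply, one_apply, single_apply,
      Function.update_apply, Pi.one_apply]
    by_cases hkl : k = l
    · subst hkl
      by_cases hki : k = i
      · subst hki; simp [hij, hij.symm]
      · by_cases hkj : k = j
        · subst hkj; simp [hij]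
        · simp [hki, hkj, Ne.symm hki, Ne.symm hkj]
    · have h1 : ∀ m, ¬ (m = k ∧ m = l) := fun m h => hkl (h.1.symm.trans h.2)
      simp [hkl, h1]
  rw [h]
  simp only [mul_add, add_mul, mul_sub, sub_mul, one_mul, mul_one, single_mul_single_same, hij, hji,
    single_mul_single_of_ne, ne_eq, not_false_eq_true, add_zero, inv_neg, inv_one,
    hneg, mul_neg]
  simp only [sub_zero, sub_neg_eq_add]
  abel

open scoped Classical in
lemma Matrix.SpecialLinearGroup.diagonal_mem_of_transvection_mem
    (K : Subgroup (SpecialLinearGroup ι F))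
    (hK : ∀ (i j : ι) (hij : i ≠ j) (c : F), SpecialLinearGroup.transvection hij c ∈ K)
    (m : ℕ) : ∀ (g : SpecialLinearGroup ι F) (D : ι → F), g.1 = diagonal D →
      (Finset.univ.filter fun i => D i ≠ 1).card = m → g ∈ K := by
  have htr : ∀ (i j : ι) (hij : i ≠ j) (c : F),
      (SpecialLinearGroup.transvection hij c).1 = Matrix.transvection i j c := fun _ _ _ _ => rfl
  induction m using Nat.strong_induction_on with
  | _ m ih =>
    intro g D hg hm
    have hD : (diagonal D).det = 1 := by rw [← hg]; exact g.2
    by_cases h1 : ∀ i, D i = 1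
    · have : g = 1 := by
        apply Subtype.ext
        rw [hg, show D = fun _ => 1 from funext h1]
        simp
      rw [this]; exact K.one_mem
    push Not at h1
    obtain ⟨i, hi⟩ := h1
    have hprod : ∏ k, D k = 1 := by rwa [det_diagonal] at hD
    have hne : ∀ k, D k ≠ 0 := fun k hk => by
      rw [Finset.prod_eq_zero (Finset.mem_univ k) hk] at hprod; exact zero_ne_one hprod
    obtain ⟨j, hji, hj⟩ : ∃ j, j ≠ i ∧ D j ≠ 1 := by
      by_contra! h
      rw [Fintype.prod_eq_single i h] at hprod
      exact hi hprod
    have hij := hji.symm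
    set D' : ι → F := Function.update (Function.update D i 1) j (D i * D j) with hD'
    have hdiag : diagonal D =
        diagonal (Function.update (Function.update 1 i (D i)) j (D i)⁻¹) * diagonal D' := by
      rw [diagonal_mul_diagonal]
      congr 1; funext k
      simp only [hD', Function.update_apply, Pi.one_apply]
      by_cases hkj : k = j
      · subst hkj; simp [hne i]
      · by_cases hki : k = i
        · subst hki; simp [hkj]
        · simp [hkj, hki]
    have hdet : (diagonal (Function.update (Function.update (1 : ι → F) i (D i)) j (D i)⁻¹)).det
        = 1 := by
      rw [← torus_eq_transvection_prod hij (hne i)]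
      simp [det_transvection_of_ne, hij, hij.symm]
    have hD'1 : (diagonal D').det = 1 := by
      rw [hdiag, det_mul, hdet, one_mul] at hD; exact hD
    have hlt : (Finset.univ.filter fun i => D' i ≠ 1).card < m := by
      rw [← hm]
      refine Finset.card_lt_card ⟨?_, fun h => ?_⟩
      · intro k
        simp only [Finset.mem_filter, Finset.mem_univ, true_and, hD', Function.update_apply]
        by_cases hkj : k = j
        · subst hkj; exact fun _ => hj
        · by_cases hki : k = i
          · subst hki; simp [hkj]
          · simp [hkj, hki]
      · have := h (by simpa using hi : i ∈ _)
        simp [hD', Function.update_apply, hij] at this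
    have h2 := ih _ hlt ⟨diagonal D', hD'1⟩ D' rfl rfl
    have h3 : g =
        (transvection hij (D i) * transvection hij.symm (-(D i)⁻¹) * transvection hij (D i)) *
        (transvection hij (-1) * transvection hij.symm (-(-1)⁻¹) * transvection hij (-1)) *
        ⟨diagonal D', hD'1⟩ := by
      apply Subtype.ext
      change g.1 = ((_ * _ * _) * (_ * _ * _) * _ : Matrix ι ι F)
      simp only [htr]
      rw [hg, hdiag, ← torus_eq_transvection_prod hij (hne i)]
    rw [h3]
    exact K.mul_mem (K.mul_mem (K.mul_mem (K.mul_mem (hK _ _ _ _) (hK _ _ _ _)) (hK _ _ _ _))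
      (K.mul_mem (K.mul_mem (hK _ _ _ _) (hK _ _ _ _)) (hK _ _ _ _))) h2

/-- The special linear group over a field is generated by elementary transvections. -/
lemma Matrix.SpecialLinearGroup.eq_top_of_transvection_mem
    (K : Subgroup (SpecialLinearGroup ι F))
    (hK : ∀ (i j : ι) (hij : i ≠ j) (c : F), SpecialLinearGroup.transvection hij c ∈ K) :
    K = ⊤ := by
  rw [eq_top_iff]
  rintro g -
  obtain ⟨L, L', D, h⟩ := Pivot.exists_list_transvec_mul_diagonal_mul_list_transvec g.1
  have hlist : ∀ L : List (TransvectionStruct ι F),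
      ∃ k ∈ K, (k : Matrix ι ι F) = (L.map TransvectionStruct.toMatrix).prod := by
    intro L
    induction L with
    | nil => exact ⟨1, K.one_mem, by simp⟩
    | cons t L ih =>
      obtain ⟨k, hk, hkL⟩ := ih
      refine ⟨transvection t.hij t.c * k, K.mul_mem (hK _ _ _ _) hk, ?_⟩
      rw [List.map_cons, List.prod_cons, ← hkL]; rfl
  obtain ⟨k, hk, hkL⟩ := hlist L
  obtain ⟨k', hk', hkL'⟩ := hlist L'
  rw [← hkL, ← hkL'] at h
  have hD : (diagonal D).det = 1 := by
    have := congrArg Matrix.det h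
    rw [det_mul, det_mul, g.2, k.2, k'.2, one_mul, mul_one] at this
    exact this.symm
  have hg : g = k * ⟨diagonal D, hD⟩ * k' := Subtype.ext h
  rw [hg]
  exact K.mul_mem (K.mul_mem hk (diagonal_mem_of_transvection_mem K hK _ ⟨_, hD⟩ D rfl rfl)) hk'

end Generation

section Weights

variable {A V : Type*} [AddCommGroup A] [Finite A] [AddCommGroup V] [Module ℂ V]

lemma apply_eq_self_of_weight_eq_zero (τ : A → V →ₗ[ℂ] V)
    (hτ : ∀ a b v, τ (a + b) v = τ a (τ b v)) (h0 : ∀ v, τ 0 v = v)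
    (h : ∀ ψ : AddChar A ℂ, ψ ≠ 0 → ∀ v, (∀ a, τ a v = ψ a • v) → v = 0) (a : A) (v : V) :
    τ a v = v := by
  classical
  have := Fintype.ofFinite A
  let P : AddChar A ℂ → V := fun ψ => ∑ b, ψ (-b) • τ b v
  have hP : ∀ ψ a, τ a (P ψ) = ψ a • P ψ := by
    intro ψ a
    simp only [P, map_sum, map_smul, Finset.smul_sum, ← hτ, smul_smul]
    refine Fintype.sum_equiv (Equiv.addLeft a) _ _ fun b => ?_
    rw [Equiv.coe_addLeft, ← AddChar.map_add_eq_mul]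
    congr 2
    simp
  have hsum : ∑ ψ, P ψ = (Fintype.card A : ℂ) • v := by
    simp only [P]
    rw [Finset.sum_comm]
    simp only [← Finset.sum_smul, AddChar.sum_apply_eq_ite, neg_eq_zero, ite_smul, zero_smul]
    simp [h0]
  rw [Fintype.sum_eq_single (0 : AddChar A ℂ) fun ψ hψ => h ψ hψ _ (hP ψ)] at hsum
  have h1 := hP 0 a
  rw [hsum] at h1
  have hc : (Fintype.card A : ℂ) ≠ 0 := by simp
  rw [map_smul] at h1
  have h2 : (Fintype.card A : ℂ) • τ a v = (Fintype.card A : ℂ) • v := by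
    rw [h1]; simp
  exact smul_right_injective V hc h2

lemma card_le_finrank_of_injective_weight [FiniteDimensional ℂ V] (τ : A → V →ₗ[ℂ] V)
    {Z : Type*} [Fintype Z] {ψ : Z → AddChar A ℂ} (hψ : Function.Injective ψ) {v : Z → V}
    (hv : ∀ z, v z ≠ 0) (hτ : ∀ z a, τ a (v z) = ψ z a • v z) :
    Fintype.card Z ≤ Module.finrank ℂ V := by
  refine LinearIndependent.fintype_card_le_finrank (b := v) ?_
  rw [Fintype.linearIndependent_iff]
  intro c hc z
  have hind := (AddChar.linearIndependent A ℂ).comp ψ hψ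
  rw [Fintype.linearIndependent_iff] at hind
  by_contra hcz
  apply hv z
  rw [← Module.forall_dual_apply_eq_zero_iff ℂ]
  intro f
  have := hind (fun z => c z * f (v z)) ?_ z
  · exact (mul_eq_zero.1 this).resolve_left hcz
  · funext a
    have h1 := congrArg (fun x => f (τ a x)) hc
    simp only [map_sum, map_smul, hτ, map_zero, smul_eq_mul] at h1
    simp only [Finset.sum_apply, Pi.smul_apply, Function.comp_apply, Pi.zero_apply, smul_eq_mul]
    rw [← h1]
    exact Finset.sum_congr rfl fun z _ => by ring

end Weights
lemma AddChar.apply_ne_zero {A R : Type*} [AddCommGroup A] [CommRing R] [Nontrivial R]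
    (ψ : AddChar A R) (x : A) : ψ x ≠ 0 := fun h => by
  have := AddChar.map_add_eq_mul ψ x (-x)
  rw [h, add_neg_cancel, AddChar.map_zero_eq_one, zero_mul] at this
  exact one_ne_zero this

section RowGroup

variable {n : ℕ} {F : Type} [Field F]

open Matrix

lemma det_one_add_vecMulVec_of_dotProduct_eq_zero {a u : Fin n → F} (h : u ⬝ᵥ a = 0) :
    (1 + vecMulVec a u).det = 1 := by
  rw [vecMulVec_eq Unit, det_one_add_replicateCol_mul_replicateRow, h, add_zero]

/-- The element `1 + a ⊗ u` of the special linear group, for `u ⬝ᵥ a = 0`. -/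
def transvectionOf (a u : Fin n → F) (h : u ⬝ᵥ a = 0) : SpecialLinearGroup (Fin n) F :=
  ⟨1 + vecMulVec a u, det_one_add_vecMulVec_of_dotProduct_eq_zero h⟩

/-- The unipotent group of transvections in the direction of the `i`-th basis vector. -/
def rowTransvection (i : Fin n) (u : Fin n → F) : SpecialLinearGroup (Fin n) F :=
  transvectionOf (Pi.single i 1) (Function.update u i 0) (by simp)

lemma coe_rowTransvection (i : Fin n) (u : Fin n → F) :
    (rowTransvection i u).1 = 1 + vecMulVec (Pi.single i 1) (Function.update u i 0) := rfl

lemma rowTransvection_zero (i : Fin n) : rowTransvection i (0 : Fin n → F) = 1 := by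
  apply Subtype.ext
  rw [coe_rowTransvection]
  have : Function.update (0 : Fin n → F) i 0 = 0 := by simp
  rw [this]
  simp

lemma rowTransvection_add (i : Fin n) (u v : Fin n → F) :
    rowTransvection i (u + v) = rowTransvection i u * rowTransvection i v := by
  apply Subtype.ext
  change _ = (rowTransvection i u).1 * (rowTransvection i v).1
  simp only [coe_rowTransvection]
  have h1 : Function.update (u + v) i 0 = Function.update u i 0 + Function.update v i 0 := by
    ext k; by_cases hk : k = i
    · subst hk; simp
    · simp [hk]
  have h2 : vecMulVec (Pi.single i 1) (Function.update u i 0) *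
      vecMulVec (Pi.single i 1) (Function.update v i 0) = 0 := by
    rw [vecMulVec_mul_vecMulVec]; simp
  rw [add_mul, mul_add, mul_add, h2, h1, vecMulVec_add]
  simp [add_comm, add_left_comm]

lemma transvection_eq_rowTransvection {i j : Fin n} (hij : i ≠ j) (c : F) :
    SpecialLinearGroup.transvection hij c = rowTransvection i (Pi.single j c) := by
  apply Subtype.ext
  rw [coe_rowTransvection]
  change transvection i j c = _
  have : Function.update (Pi.single j c : Fin n → F) i 0 = Pi.single j c := by
    rw [Function.update_eq_self_iff]; simp [hij]
  rw [this]
  ext k l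
  simp only [transvection, Matrix.add_apply, vecMulVec_apply, single_apply, Pi.single_apply, ite_and,
    @eq_comm _ k, @eq_comm _ l]
  split_ifs <;> simp

variable {V : Type*} [AddCommGroup V] [Module ℂ V]
  (ρ : Representation ℂ (SpecialLinearGroup (Fin n) F) V)

lemma exists_rowTransvection_weight [Finite F] [Nontrivial V] (hρ : ∀ v, (∀ g, ρ g v = v) → v = 0) :
    ∃ (i : Fin n) (ψ : AddChar (Fin n → F) ℂ), ψ ≠ 0 ∧ ∃ v ≠ 0,
      ∀ u, ρ (rowTransvection i u) v = ψ u • v := by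
  by_contra! hno
  have htriv : ∀ (i : Fin n) (u : Fin n → F) (v : V), ρ (rowTransvection i u) v = v := by
    intro i
    refine apply_eq_self_of_weight_eq_zero _ (fun a b v => ?_) (fun v => ?_) fun ψ hψ v hv => ?_
    · rw [rowTransvection_add, map_mul]; rfl
    · rw [rowTransvection_zero, map_one]; rfl
    · by_contra hv0
      obtain ⟨u, hu⟩ := hno i ψ hψ v hv0
      exact hu (hv u)
  have htop : ρ.ker = ⊤ := by
    refine SpecialLinearGroup.eq_top_of_transvection_mem _ fun i j hij c => ?_
    rw [MonoidHom.mem_ker, transvection_eq_rowTransvection]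
    ext v
    exact htriv _ _ _
  obtain ⟨v, hv⟩ := exists_ne (0 : V)
  refine hv (hρ v fun g => ?_)
  have : g ∈ ρ.ker := htop ▸ Subgroup.mem_top g
  rw [MonoidHom.mem_ker.1 this]; rfl

lemma card_le_finrank_of_conjugates [Finite F] [FiniteDimensional ℂ V] {Z : Type*} [Fintype Z] (i : Fin n)
    {ψ : AddChar (Fin n → F) ℂ} {v : V} (hv0 : v ≠ 0)
    (hv : ∀ u, ρ (rowTransvection i u) v = ψ u • v)
    (g : Z → SpecialLinearGroup (Fin n) F) (φ : Z → (Fin n → F) →+ (Fin n → F))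
    (hg : ∀ z u, rowTransvection i u * g z = g z * rowTransvection i (φ z u))
    (hinj : ∀ z z', (∀ u, ψ (φ z u) = ψ (φ z' u)) → z = z') :
    Fintype.card Z ≤ Module.finrank ℂ V := by
  refine card_le_finrank_of_injective_weight (fun u => ρ (rowTransvection i u))
    (ψ := fun z => ψ.compAddMonoidHom (φ z)) (fun z z' h => hinj z z' fun u => ?_)
    (v := fun z => ρ (g z) v) (fun z h => hv0 ?_) fun z u => ?_
  · exact congrArg (fun χ : AddChar (Fin n → F) ℂ => χ u) h
  · have : ρ ((g z)⁻¹ * g z) v = 0 := by rw [map_mul, Module.End.mul_apply, h, map_zero]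
    simpa using this
  · rw [← Module.End.mul_apply, ← map_mul, hg, map_mul, Module.End.mul_apply, hv, map_smul]
    rfl

lemma exists_apply_single_ne_one {i : Fin n} {ψ : AddChar (Fin n → F) ℂ} (hψ : ψ ≠ 0) {v : V}
    (hv0 : v ≠ 0) (hv : ∀ u, ρ (rowTransvection i u) v = ψ u • v) :
    ∃ j ≠ i, ∃ c, ψ (Pi.single j c) ≠ 1 := by
  by_contra! h
  have hi : ∀ c, ψ (Pi.single i c) = 1 := by
    intro c
    have h1 := hv (Pi.single i c)
    have h2 : rowTransvection i (Pi.single i c) = 1 := by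
      apply Subtype.ext
      rw [coe_rowTransvection]
      simp [Pi.single, Function.update_idem]
    rw [h2, map_one, Module.End.one_apply] at h1
    have h3 : (ψ (Pi.single i c) - 1) • v = 0 := by rw [sub_smul, ← h1, one_smul, sub_self]
    exact sub_eq_zero.1 ((smul_eq_zero.1 h3).resolve_right hv0)
  apply hψ
  ext u
  change ψ u = 1
  rw [← Finset.univ_sum_single u]
  refine Finset.sum_induction _ (fun x => ψ x = 1) (fun a b ha hb => ?_) (AddChar.map_zero_eq_one ψ)
    fun j _ => ?_
  · rw [AddChar.map_add_eq_mul, ha, hb, one_mul]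
  · by_cases hj : j = i
    · rw [hj]; exact hi _
    · exact h j hj _

variable [FiniteDimensional ℂ V]

lemma eq_of_forall_single_eq {j : Fin n} {ψ : AddChar (Fin n → F) ℂ} {c : F}
    (hc : ψ (Pi.single j c) ≠ 1) {a b : F}
    (h : ∀ x, ψ (Pi.single j (a * x)) = ψ (Pi.single j (b * x))) : a = b := by
  by_contra hab
  apply hc
  have h1 := h (c / (a - b))
  have hab' : a - b ≠ 0 := sub_ne_zero.2 hab
  have h2 : (Pi.single j (a * (c / (a - b))) : Fin n → F) =
      Pi.single j c + Pi.single j (b * (c / (a - b))) := by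
    rw [← Pi.single_add]
    congr 1
    field_simp
    ring
  rw [h2, AddChar.map_add_eq_mul] at h1
  have h3 := ψ.apply_ne_zero (Pi.single j (b * (c / (a - b))))
  exact mul_right_cancel₀ h3 (by rw [h1, one_mul])

/-- Nontrivial representations of the special linear group of degree `n ≥ 3` over the field with
`q` elements have dimension at least `q ^ (n - 2)`. -/
theorem pow_card_le_finrank_of_specialLinearGroup [Fintype F] [Nontrivial V]
    (hρ : ∀ v, (∀ g, ρ g v = v) → v = 0) :
    Fintype.card F ^ (n - 2) ≤ Module.finrank ℂ V := by
  classical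
  obtain ⟨i, ψ, hψ, v, hv0, hv⟩ := exists_rowTransvection_weight ρ hρ
  obtain ⟨j, hji, c, hc⟩ := exists_apply_single_ne_one ρ hψ hv0 hv
  let S := {k : Fin n // k ≠ i ∧ k ≠ j}
  let e : (S → F) → (Fin n → F) := fun z k => if h : k ≠ i ∧ k ≠ j then z ⟨k, h⟩ else 0
  have hei : ∀ z, e z i = 0 := fun z => by simp [e]
  have hej : ∀ z, e z j = 0 := fun z => by simp [e]
  have hcard : Fintype.card (S → F) = Fintype.card F ^ (n - 2) := by
    rw [Fintype.card_fun]
    congr 1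
    rw [Fintype.card_subtype]
    have : (Finset.univ.filter fun k : Fin n => k ≠ i ∧ k ≠ j) = ({i, j} : Finset (Fin n))ᶜ := by
      ext k; simp
    rw [this, Finset.card_compl, Finset.card_pair hji.symm, Fintype.card_fin]
  rw [← hcard]
  refine card_le_finrank_of_conjugates ρ i hv0 hv
    (fun z => transvectionOf (e z) (Pi.single j 1) (by simp [hej]))
    (fun z => AddMonoidHom.mk' (fun u => u + Pi.single j (u ⬝ᵥ e z)) fun u u' => ?_)
    (fun z u => ?_) (fun z z' h => ?_)
  · rw [add_dotProduct, Pi.single_add]; abel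
  · apply Subtype.ext
    change (1 + vecMulVec (Pi.single i 1) (Function.update u i 0)) *
        (1 + vecMulVec (e z) (Pi.single j 1)) = (1 + vecMulVec (e z) (Pi.single j 1)) *
        (1 + vecMulVec (Pi.single i 1) (Function.update (u + Pi.single j (u ⬝ᵥ e z)) i 0))
    have h1 : Function.update (u + Pi.single j (u ⬝ᵥ e z)) i 0 =
        Function.update u i 0 + (u ⬝ᵥ e z) • Pi.single j 1 := by
      ext k
      by_cases hk : k = i
      · subst hk; simp [hji.symm]
      · simp [hk, Pi.single_apply]
    have h2 : Function.update u i 0 ⬝ᵥ e z = u ⬝ᵥ e z := by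
      refine Finset.sum_congr rfl fun k _ => ?_
      by_cases hk : k = i
      · subst hk; simp [hei]
      · simp [hk]
    have h3 : vecMulVec (e z) (Pi.single j (1 : F)) *
        vecMulVec (Pi.single i 1) (Function.update (u + Pi.single j (u ⬝ᵥ e z)) i 0) = 0 := by
      rw [vecMulVec_mul_vecMulVec]; simp [hji.symm]
    rw [mul_add, mul_add, add_mul, add_mul, add_mul, add_mul, h3, vecMulVec_mul_vecMulVec, h2, h1,
      vecMulVec_add]
    simp only [one_mul, mul_one, add_zero, vecMulVec_smul]
    abel
  · funext k
    refine eq_of_forall_single_eq hc fun x => ?_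
    have h1 := h (Pi.single k.1 x)
    simp only [AddMonoidHom.mk'_apply, AddChar.map_add_eq_mul] at h1
    have h3 := ψ.apply_ne_zero (Pi.single k.1 x)
    have h2 := mul_left_cancel₀ h3 h1
    have hek : ∀ z, e z k.1 = z k := fun z => dif_pos k.2
    simpa [single_dotProduct, hek, mul_comm] using h2

/-- Nontrivial representations of the special linear group over the field with `q` elements have
dimension at least `(q - 1) / 2`. -/
theorem card_le_two_mul_finrank_of_specialLinearGroup [Fintype F] [Nontrivial V]
    (hρ : ∀ v, (∀ g, ρ g v = v) → v = 0) :
    Fintype.card F - 1 ≤ 2 * Module.finrank ℂ V := by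
  classical
  obtain ⟨i, ψ, hψ, v, hv0, hv⟩ := exists_rowTransvection_weight ρ hρ
  obtain ⟨j, hji, c, hc⟩ := exists_apply_single_ne_one ρ hψ hv0 hv
  let Z : Finset Fˣ := Finset.univ.image fun t : Fˣ => t ^ 2
  have hZ : Fintype.card F - 1 ≤ 2 * Z.card := by
    rw [← Fintype.card_units, ← Finset.card_univ]
    refine Finset.card_le_mul_card_image _ _ fun b hb => ?_
    obtain ⟨t, -, rfl⟩ := Finset.mem_image.1 hb
    refine (Finset.card_le_card (t := {t, -t}) fun s hs => ?_).trans Finset.card_le_two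
    have h1 := (Finset.mem_filter.1 hs).2
    simpa using Units.eq_or_eq_neg_of_sq_eq_sq _ _ h1
  refine hZ.trans (Nat.mul_le_mul_left 2 ?_)
  have hroot : ∀ z : Z, ∃ t : Fˣ, t ^ 2 = z.1 := fun z => by
    obtain ⟨t, -, ht⟩ := Finset.mem_image.1 z.2
    exact ⟨t, ht⟩
  choose t ht using hroot
  let δ : Z → Fin n → F := fun z => Function.update (Function.update 1 i (t z : F)) j ((t z)⁻¹ : Fˣ)
  have hδi : ∀ z, δ z i = t z := fun z => by simp [δ, hji.symm]
  have hδj : ∀ z, δ z j = (t z : F)⁻¹ := fun z => by simp [δ]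
  rw [← Fintype.card_coe Z]
  refine card_le_finrank_of_conjugates ρ i hv0 hv
    (fun z => ⟨diagonal (δ z), ?_⟩)
    (fun z => AddMonoidHom.mk' (fun u => fun k => (t z : F)⁻¹ * (u k * δ z k)) fun u u' => ?_)
    (fun z u => ?_) (fun z z' h => ?_)
  · have := congrArg Matrix.det (torus_eq_transvection_prod hji.symm (t z).ne_zero)
    simp only [δ, Units.val_inv_eq_inv_val]
    rw [← this]
    simp [det_transvection_of_ne, hji, hji.symm]
  · ext k; simp only [Pi.add_apply]; ring
  · apply Subtype.ext
    change (1 + vecMulVec (Pi.single i 1) (Function.update u i 0)) * diagonal (δ z) =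
      diagonal (δ z) * (1 + vecMulVec (Pi.single i 1)
        (Function.update (fun k => (t z : F)⁻¹ * (u k * δ z k)) i 0))
    rw [add_mul, mul_add, one_mul, mul_one]
    congr 1
    ext k l
    rw [mul_diagonal, diagonal_mul, vecMulVec_apply, vecMulVec_apply]
    by_cases hk : k = i
    · subst hk
      by_cases hl : l = k
      · subst hl; simp
      · have := (t z).ne_zero
        simp [hl, hδi]
    · simp [hk]
  · have hsq : ((t z : F)⁻¹) ^ 2 = ((t z' : F)⁻¹) ^ 2 := by
      refine eq_of_forall_single_eq hc fun x => ?_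
      have h1 := h (Pi.single j x)
      have h2 : ∀ z, (fun k => (t z : F)⁻¹ * ((Pi.single j x : Fin n → F) k * δ z k)) =
          Pi.single j ((t z : F)⁻¹ ^ 2 * x) := by
        intro z
        ext k
        by_cases hk : k = j
        · subst hk; simp [hδj]; ring
        · simp [hk]
      simpa only [AddMonoidHom.mk'_apply, h2] using h1
    apply Subtype.ext
    rw [← ht, ← ht]
    ext
    rw [inv_pow, inv_pow, _root_.inv_inj] at hsq
    simpa using hsq

end RowGroup

section CommutatorWord

variable {d : ℕ} (w : FreeGroup (Fin d))

/-- The value of a word at the commutators of a tuple of pairs. -/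
def commWord {G : Type*} [Group G] (A : Fin d × Bool → G) : G :=
  FreeGroup.lift (fun i => ⁅A (i, true), A (i, false)⁆) w

lemma map_commWord {G H : Type*} [Group G] [Group H] (φ : G →* H) (A : Fin d × Bool → G) :
    φ (commWord w A) = commWord w fun l => φ (A l) := by
  have : φ.comp (FreeGroup.lift (fun i => ⁅A (i, true), A (i, false)⁆ : Fin d → G)) =
      FreeGroup.lift (fun i => ⁅φ (A (i, true)), φ (A (i, false))⁆ : Fin d → H) := by
    ext i; simp [map_commutatorElement]
  exact DFunLike.congr_fun this w

lemma commWord_mem {G : Type*} [Group G] (K : Subgroup G) {A : Fin d × Bool → G}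
    (hA : ∀ l, A l ∈ K) : commWord w A ∈ K := by
  have := map_commWord w K.subtype fun l => ⟨A l, hA l⟩
  have h2 : commWord w A = K.subtype (commWord w fun l => ⟨A l, hA l⟩) := this.symm
  rw [h2]
  exact Subtype.prop _

end CommutatorWord

section Block

variable {m p n R : Type*} [Fintype m] [DecidableEq m] [Fintype p] [DecidableEq p] [Fintype n]
  [DecidableEq n] [CommRing R]

open Matrix

/-- The block embedding `M ↦ M ⊕ 1` of matrix monoids. -/
def matrixBlock (e : m ⊕ p ≃ n) : Matrix m m R →* Matrix n n R where
  toFun M := reindexAlgEquiv R R e (fromBlocks M 0 0 1)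
  map_one' := by rw [fromBlocks_one, map_one]
  map_mul' M N := by rw [← map_mul, fromBlocks_multiply]; simp

/-- The block embedding `g ↦ g ⊕ 1` of general linear groups. -/
def glBlock (e : m ⊕ p ≃ n) : GL m R →* GL n R := Units.map (matrixBlock e)

lemma coe_glBlock (e : m ⊕ p ≃ n) (g : GL m R) :
    (glBlock e g).1 = reindexAlgEquiv R R e (fromBlocks g.1 0 0 1) := rfl

lemma glBlock_injective (e : m ⊕ p ≃ n) : Function.Injective (glBlock (R := R) e) := by
  intro g h hgh
  have h1 : reindexAlgEquiv R R e (fromBlocks g.1 0 0 1) =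
      reindexAlgEquiv R R e (fromBlocks h.1 0 0 1) := congrArg Units.val hgh
  have h2 := (reindexAlgEquiv R R e).injective h1
  rw [fromBlocks_inj] at h2
  exact Units.ext h2.1

lemma charpoly_glBlock_sub_one (e : m ⊕ p ≃ n) (g : GL m R) :
    ((glBlock e g).1 - 1).charpoly = (g.1 - 1).charpoly * Polynomial.X ^ Fintype.card p := by
  have h : (glBlock e g).1 - 1 = reindex e e (fromBlocks (g.1 - 1) 0 0 0) := by
    have h1 : (fromBlocks (g.1 - 1) 0 0 0 : Matrix (m ⊕ p) (m ⊕ p) R) = fromBlocks g.1 0 0 1 - 1 := by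
      ext i j; cases i <;> cases j <;> simp [← fromBlocks_one]
    rw [coe_glBlock, ← coe_reindexAlgEquiv R R, h1, map_sub, map_one]
  rw [h, charpoly_reindex, charpoly_fromBlocks_zero₁₂]
  simp

end Block

section NotLaw

open Matrix

variable {F : Type} [Field F]

/-- The matrix with columns `(1, x)` and `(1, y)`. -/
def columnMatrix {K : Type} [Field K] (x y : K) (h : x ≠ y) : GL (Fin 2) K :=
  GeneralLinearGroup.mkOfDetNeZero !![1, 1; x, y] (by
    rw [det_fin_two_of]; simpa [sub_eq_zero] using h.symm)

lemma commutator_columnMatrix {K : Type} [Field K] (x y : K) (h : x ≠ y) {t : K} (ht : t ≠ 0) :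
    ∃ A B : GL (Fin 2) K,
      t • (⁅A, B⁆ : GL (Fin 2) K).1 * !![1, 1; x, y] = !![1, 1; x, y] * !![t ^ 2, 0; 0, 1] ∧
      t • (⁅A, B⁆⁻¹ : GL (Fin 2) K).1 * !![1, 1; x, y] =
        !![1, 1; x, y] * !![1, 0; 0, t ^ 2] := by
  let P := columnMatrix x y h
  let D : GL (Fin 2) K := ⟨!![t, 0; 0, 1], !![t⁻¹, 0; 0, 1],
    by ext i j; fin_cases i <;> fin_cases j <;> simp [ht],
    by ext i j; fin_cases i <;> fin_cases j <;> simp [ht]⟩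
  let S : GL (Fin 2) K := ⟨!![0, 1; 1, 0], !![0, 1; 1, 0],
    by ext i j; fin_cases i <;> fin_cases j <;> simp,
    by ext i j; fin_cases i <;> fin_cases j <;> simp⟩
  have hc : ⁅P * D * P⁻¹, P * S * P⁻¹⁆ = P * ⁅D, S⁆ * P⁻¹ := by
    simp only [commutatorElement_def]; group
  have h1 : ⁅D, S⁆.1 = !![t, 0; 0, t⁻¹] := by
    change (!![t, 0; 0, 1] * !![0, 1; 1, 0] * !![t⁻¹, 0; 0, 1] * !![0, 1; 1, 0] :
      Matrix (Fin 2) (Fin 2) K) = _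
    ext i j; fin_cases i <;> fin_cases j <;> simp [Matrix.mul_apply, Fin.sum_univ_two]
  have h2 : (⁅D, S⁆⁻¹).1 = !![t⁻¹, 0; 0, t] := by
    rw [commutatorElement_inv]
    change (!![0, 1; 1, 0] * !![t, 0; 0, 1] * !![0, 1; 1, 0] * !![t⁻¹, 0; 0, 1] :
      Matrix (Fin 2) (Fin 2) K) = _
    ext i j; fin_cases i <;> fin_cases j <;> simp [Matrix.mul_apply, Fin.sum_univ_two]
  have hP : P.1 = !![1, 1; x, y] := rfl
  have hPP : P⁻¹.1 * P.1 = 1 := by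
    rw [← Units.val_mul, inv_mul_cancel]; rfl
  refine ⟨P * D * P⁻¹, P * S * P⁻¹, ?_, ?_⟩
  · rw [hc, Units.val_mul, Units.val_mul, h1, ← hP, smul_mul_assoc, mul_assoc, hPP, mul_one,
      ← mul_smul_comm]
    congr 1
    ext i j; fin_cases i <;> fin_cases j <;> simp [ht, sq]
  · rw [hc, _root_.mul_inv_rev, _root_.mul_inv_rev, _root_.inv_inv, ← mul_assoc, Units.val_mul, Units.val_mul, h2, ← hP,
      smul_mul_assoc, mul_assoc, hPP, mul_one, ← mul_smul_comm]
    congr 1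
    ext i j; fin_cases i <;> fin_cases j <;> simp [ht, sq]

end NotLaw

section NotLaw

open Matrix Polynomial

lemma exists_polynomial_mulVec {E K : Type} [Field E] [Field K] (ι : E[X] →+* K) {α : Type}
    (x : Option (α × Bool) → E) (hx : Function.Injective x)
    (M : α × Bool → Matrix (Fin 2) (Fin 2) K)
    (h1 : ∀ i b, (ι X • M (i, b)) *ᵥ ![1, ι (C (x (some (i, b))))] =
      ι X ^ 2 • ![1, ι (C (x (some (i, b))))])
    (h2 : ∀ i b, (ι X • M (i, b)) *ᵥ ![1, ι (C (x (some (i, !b))))] =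
      ![1, ι (C (x (some (i, !b))))])
    (L : List (α × Bool)) (hL : FreeGroup.IsReduced L) :
    ∃ (p q : E[X]) (c : E), c ≠ 0 ∧ p.natDegree ≤ 2 * L.length ∧ q.natDegree ≤ 2 * L.length ∧
      p.coeff (2 * L.length) = c ∧ q.coeff (2 * L.length) = c * x L.head? ∧
      (ι X ^ L.length • (L.map M).prod) *ᵥ ![1, ι (C (x none))] = ![ι p, ι q] := by
  induction L with
  | nil => exact ⟨1, C (x none), 1, one_ne_zero, by simp, by simp, by simp, by simp, by simp⟩
  | cons l L ih =>
    obtain ⟨p, q, c, hc, hp, hq, hpc, hqc, h⟩ := ih (List.IsChain.tail hL)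
    obtain ⟨i, b⟩ := l
    have hne : L.head? ≠ some (i, !b) := by
      cases L with
      | nil => simp
      | cons l L =>
        intro hl
        simp only [List.head?_cons, Option.some.injEq] at hl
        have := (FreeGroup.isReduced_cons_cons.1 hL).1
        rw [hl] at this
        simp at this
    have hb : x (some (i, b)) - x (some (i, !b)) ≠ 0 := by
      rw [sub_ne_zero]
      intro hb
      have := hx hb
      simp at this
    set y := x (some (i, b)) with hy
    set z := x (some (i, !b)) with hz
    have hyz : (C y - C z : E[X]) * C (y - z)⁻¹ = 1 := by
      rw [← C_sub, ← C_mul, mul_inv_cancel₀ hb, C_1]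
    have hh : x L.head? - z ≠ 0 := by
      rw [sub_ne_zero]
      intro hb
      exact hne (hx hb)
    let u : E[X] := C (y - z)⁻¹ * (q - C z * p)
    let v : E[X] := C (y - z)⁻¹ * (C y * p - q)
    have hp1 : p = u + v := by linear_combination (-p) * hyz
    have hq1 : q = C y * u + C z * v := by linear_combination (-q) * hyz
    have hu : u.natDegree ≤ 2 * L.length := by
      refine (natDegree_C_mul_le _ _).trans ((natDegree_sub_le _ _).trans (max_le hq ?_))
      exact (natDegree_C_mul_le _ _).trans hp
    have hv : v.natDegree ≤ 2 * L.length := by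
      refine (natDegree_C_mul_le _ _).trans ((natDegree_sub_le _ _).trans (max_le ?_ hq))
      exact (natDegree_C_mul_le _ _).trans hp
    have hu0 : u.coeff (2 * L.length) = (y - z)⁻¹ * (c * (x L.head? - z)) := by
      simp only [u, coeff_C_mul, coeff_sub, hpc, hqc]
      ring
    have hlen : 2 * ((i, b) :: L).length = 2 * L.length + 2 := by simp; ring
    have hv0 : v.coeff (2 * L.length + 2) = 0 := coeff_eq_zero_of_natDegree_lt (by omega)
    refine ⟨X ^ 2 * u + v, C y * (X ^ 2 * u) + C z * v, (y - z)⁻¹ * (c * (x L.head? - z)),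
      mul_ne_zero (inv_ne_zero hb) (mul_ne_zero hc hh), ?_, ?_, ?_, ?_, ?_⟩
    · refine (natDegree_add_le _ _).trans (max_le (natDegree_mul_le.trans ?_) ?_)
      · rw [natDegree_X_pow]; omega
      · omega
    · refine (natDegree_add_le _ _).trans (max_le ((natDegree_C_mul_le _ _).trans
        (natDegree_mul_le.trans ?_)) ((natDegree_C_mul_le _ _).trans ?_))
      · rw [natDegree_X_pow]; omega
      · omega
    · rw [hlen, coeff_add, hv0, coeff_X_pow_mul, hu0, add_zero]
    · rw [hlen, coeff_add, coeff_C_mul, coeff_C_mul, hv0, coeff_X_pow_mul, hu0]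
      simp [hy]; ring
    · have hs : (ι X ^ ((i, b) :: L).length • (((i, b) :: L).map M).prod) =
          (ι X • M (i, b)) * (ι X ^ L.length • (L.map M).prod) := by
        rw [List.length_cons, List.map_cons, List.prod_cons, smul_mul_smul_comm, pow_succ']
      rw [hs, ← mulVec_mulVec, h]
      have hdec : ![ι p, ι q] = ι u • ![1, ι (C y)] + ι v • ![1, ι (C z)] := by
        rw [hp1, hq1]
        ext j; fin_cases j
        · simp
        · simp; ring
      rw [hdec, mulVec_add, mulVec_smul, mulVec_smul, h1, h2]
      ext j; fin_cases j
      · simp; ring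
      · simp; ring

/-- A nontrivial word takes a nontrivial value at commutators of `2 × 2` matrices. -/
lemma exists_commWord_ne_one {d : ℕ} {w : FreeGroup (Fin d)} (hw : w ≠ 1) (F : Type) [Field F] :
    ∃ (K : Type) (_ : Field K) (_ : F →+* K) (A : Fin d × Bool → GL (Fin 2) K),
      Infinite K ∧ commWord w A ≠ 1 := by
  let E := FractionRing F[X]
  have : Infinite E := Infinite.of_injective _ (IsFractionRing.injective F[X] E)
  let K := FractionRing E[X]
  let ι : E[X] →+* K := algebraMap _ _
  have hι : Function.Injective ι := IsFractionRing.injective E[X] K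
  have hX : ι X ≠ 0 := by
    rw [Ne, map_eq_zero_iff _ hι]; exact X_ne_zero
  let x : Option (Fin d × Bool) → E := Infinite.natEmbedding E ∘ (Encodable.encode)
  have hx : Function.Injective x := (Infinite.natEmbedding E).injective.comp
    Encodable.encode_injective
  have hxi (i : Fin d) : ι (C (x (some (i, true)))) ≠ ι (C (x (some (i, false)))) := by
    intro h
    have := hx (C_injective (hι h))
    simp at this
  choose A B h1 h2 using fun i : Fin d => commutator_columnMatrix _ _ (hxi i) hX
  refine ⟨K, inferInstance, (algebraMap E K).comp (algebraMap F E),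
    fun l => if l.2 then A l.1 else B l.1,
    Infinite.of_injective _ hι, fun hone => ?_⟩
  let M : Fin d × Bool → GL (Fin 2) K := fun l => if l.2 then ⁅A l.1, B l.1⁆ else ⁅A l.1, B l.1⁆⁻¹
  have hM : (w.toWord.map fun l => (M l).1).prod = 1 := by
    have : (w.toWord.map M).prod = 1 := by
      rw [← hone, commWord, ← FreeGroup.mk_toWord (x := w), FreeGroup.lift_mk]
      simp only [FreeGroup.mk_toWord, M, if_true, Bool.false_eq_true, if_false]
      congr 1
      refine List.map_congr_left fun l _ => ?_
      cases l.2 <;> rfl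
    have h := congrArg (Units.coeHom _) this
    rw [map_list_prod, List.map_map] at h
    exact h
  have hcol (N : Matrix (Fin 2) (Fin 2) K) (y z a b : K)
      (h : N * !![1, 1; y, z] = !![1, 1; y, z] * !![a, 0; 0, b]) :
      N *ᵥ ![1, y] = a • ![1, y] ∧ N *ᵥ ![1, z] = b • ![1, z] := by
    have h' (i j : Fin 2) := congrFun (congrFun h i) j
    simp only [Matrix.mul_apply, Fin.sum_univ_two] at h'
    constructor
    · ext i
      have := h' i 0
      fin_cases i <;> simpa [mulVec, dotProduct, Fin.sum_univ_two, mul_comm] using this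
    · ext i
      have := h' i 1
      fin_cases i <;> simpa [mulVec, dotProduct, Fin.sum_univ_two, mul_comm] using this
  obtain ⟨p, q, c, hc, hp, -, hpc, -, h⟩ := exists_polynomial_mulVec ι x hx (fun l => (M l).1)
    (by
      intro i b
      cases b
      · exact (hcol _ _ _ _ _ (h2 i)).2
      · exact (hcol _ _ _ _ _ (h1 i)).1)
    (by
      intro i b
      cases b
      · exact (hcol _ _ _ _ _ (h2 i)).1.trans (one_smul _ _)
      · exact (hcol _ _ _ _ _ (h1 i)).2.trans (one_smul _ _))
    w.toWord FreeGroup.isReduced_toWord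
  rw [hM] at h
  have h0 := congrFun h 0
  simp only [smul_mulVec, one_mulVec] at h0
  have h3 : p = X ^ w.toWord.length := hι (by simpa using h0.symm)
  have hlen : w.toWord.length ≠ 0 := by simpa using hw
  rw [h3, coeff_X_pow, if_neg (by omega)] at hpc
  exact hc hpc.symm

end NotLaw

section Generic

open Matrix

variable (d : ℕ) (m : Type) [Fintype m] [DecidableEq m] (R : Type) [CommRing R]

/-- The generic matrices, with entries independent variables. -/
noncomputable def genericMatrix (l : Fin d × Bool) : Matrix m m (MvPolynomial ((Fin d × Bool) × m × m) R) :=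
  Matrix.of fun a b => MvPolynomial.X (l, a, b)

/-- The product of the determinants of the generic matrices. -/
noncomputable def genericDet : MvPolynomial ((Fin d × Bool) × m × m) R := ∏ l, (genericMatrix d m R l).det

/-- The universal ring carrying a tuple of invertible matrices. -/
abbrev GenericRing : Type := Localization.Away (genericDet d m R)

/-- The generic invertible matrices. -/
noncomputable def genericGL (l : Fin d × Bool) : GL m (GenericRing d m R) :=
  GeneralLinearGroup.mk'' ((genericMatrix d m R l).map (algebraMap _ _)) (by
    have h : IsUnit (algebraMap _ (GenericRing d m R) (genericDet d m R)) :=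
      IsLocalization.Away.algebraMap_isUnit _
    rw [← RingHom.mapMatrix_apply, ← RingHom.map_det]
    refine isUnit_of_dvd_unit ?_ h
    exact map_dvd _ (Finset.dvd_prod_of_mem _ (Finset.mem_univ l)))

variable {d m R} {K : Type} [CommRing K] [Algebra R K] (A : Fin d × Bool → GL m K)

/-- The entries of a tuple of matrices, as a point of affine space. -/
def entryPoint (M : Fin d × Bool → Matrix m m K) (v : (Fin d × Bool) × m × m) : K :=
  M v.1 v.2.1 v.2.2

variable (R)

lemma map_genericMatrix (l : Fin d × Bool) :
    (genericMatrix d m R l).map (MvPolynomial.aeval (R := R) (entryPoint fun l => (A l).1)) = (A l).1 := by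
  ext a b
  simp [genericMatrix, entryPoint]

lemma aeval_genericDet :
    MvPolynomial.aeval (R := R) (entryPoint fun l => (A l).1) (genericDet d m R) = ∏ l, (A l).1.det := by
  rw [genericDet, map_prod]
  refine Finset.prod_congr rfl fun l _ => ?_
  rw [← map_genericMatrix R A l, AlgHom.map_det]
  rfl

lemma isUnit_aeval_genericDet :
    IsUnit (MvPolynomial.aeval (R := R) (entryPoint fun l => (A l).1) (genericDet d m R)) := by
  rw [aeval_genericDet, IsUnit.prod_univ_iff]
  exact fun l => (isUnit_iff_isUnit_det _).1 (A l).isUnit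

/-- The specialization of the universal ring at a tuple of invertible matrices. -/
noncomputable def specialize : GenericRing d m R →ₐ[R] K :=
  IsLocalization.liftAlgHom (M := Submonoid.powers (genericDet d m R))
    (f := MvPolynomial.aeval (R := R) (entryPoint fun l => (A l).1)) (by
      rintro ⟨y, k, rfl⟩
      simpa using (isUnit_aeval_genericDet R A).pow k)

lemma specialize_algebraMap (P : MvPolynomial ((Fin d × Bool) × m × m) R) :
    specialize R A (algebraMap _ _ P) = MvPolynomial.aeval (entryPoint fun l => (A l).1) P := by
  simp [specialize]

lemma map_specialize_genericGL (l : Fin d × Bool) :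
    GeneralLinearGroup.map (specialize R A).toRingHom (genericGL d m R l) = A l := by
  apply Units.ext
  rw [← map_genericMatrix R A l]
  ext a b
  exact specialize_algebraMap R A _

lemma map_specialize_commWord (w : FreeGroup (Fin d)) :
    (commWord w (genericGL d m R)).1.map (specialize R A) = (commWord w A).1 := by
  have h := map_commWord w (GeneralLinearGroup.map (specialize R A).toRingHom) (genericGL d m R)
  simp only [map_specialize_genericGL] at h
  exact congrArg Units.val h

lemma exists_numerators {J : Type} [Finite J] (s : J → GenericRing d m R) :
    ∃ (e : ℕ) (f : J → MvPolynomial ((Fin d × Bool) × m × m) R), ∀ j,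
      algebraMap _ (GenericRing d m R) (f j) = algebraMap _ _ (genericDet d m R) ^ e * s j := by
  obtain ⟨⟨b, e, rfl⟩, hb⟩ := IsLocalization.exist_integer_multiples_of_finite
    (Submonoid.powers (genericDet d m R)) s
  choose f hf using hb
  refine ⟨e, f, fun j => ?_⟩
  rw [hf j, Algebra.smul_def]
  simp

lemma commWord_entry_of_numerators {w : FreeGroup (Fin d)} {e : ℕ}
    {f : m × m → MvPolynomial ((Fin d × Bool) × m × m) R}
    (hf : ∀ j, algebraMap _ (GenericRing d m R) (f j) = algebraMap _ _ (genericDet d m R) ^ e *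
      (commWord w (genericGL d m R)).1 j.1 j.2) (j : m × m) :
    MvPolynomial.aeval (entryPoint fun l => (A l).1) (f j) =
      MvPolynomial.aeval (entryPoint fun l => (A l).1) (genericDet d m R) ^ e *
        (commWord w A).1 j.1 j.2 := by
  rw [← specialize_algebraMap, hf, map_mul, map_pow, specialize_algebraMap,
    ← map_specialize_commWord R A w]
  rfl

/-- If a word is trivial at matrices obtained by an injective extension of scalars, it is trivial at
every specialization. -/
lemma commWord_eq_one_of_map {B P L : Type} [CommRing B] [CommRing P] [CommRing L] (α : B →+* P)
    (hα : Function.Injective α) (β : B →+* L) (w : FreeGroup (Fin d))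
    (M : Fin d × Bool → Matrix m m B) (A : Fin d × Bool → GL m P) (A' : Fin d × Bool → GL m L)
    (hA : ∀ l, (M l).map α = (A l).1) (hA' : ∀ l, (M l).map β = (A' l).1)
    (h : commWord w A = 1) : commWord w A' = 1 := by
  obtain ⟨e, f, hf⟩ := exists_numerators ℤ fun j : m × m => (commWord w (genericGL d m ℤ)).1 j.1 j.2
  have hmap {C : Type} [CommRing C] (γ : B →+* C) (Q : MvPolynomial ((Fin d × Bool) × m × m) ℤ) :
      MvPolynomial.aeval (entryPoint fun l => (M l).map γ) Q =
        γ (MvPolynomial.aeval (entryPoint M) Q) := by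
    have := MvPolynomial.map_aeval (entryPoint M) γ Q
    rw [this, MvPolynomial.aeval_def, MvPolynomial.coe_eval₂Hom]
    congr 1
    exact RingHom.ext_int _ _
  have h1 (a b : m) : MvPolynomial.aeval (entryPoint M) (f (a, b)) =
      MvPolynomial.aeval (entryPoint M) (genericDet d m ℤ) ^ e * (1 : Matrix m m B) a b := by
    apply hα
    have := commWord_entry_of_numerators ℤ A hf (a, b)
    simp only [← hA, hmap, h] at this
    rw [this, map_mul, map_pow]
    congr 1
    simp only [GeneralLinearGroup.coe_one, Matrix.one_apply]
    split_ifs <;> simp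
  apply Units.ext
  ext a b
  have h2 := commWord_entry_of_numerators ℤ A' hf (a, b)
  have hu := (isUnit_aeval_genericDet ℤ A').pow e
  refine hu.mul_left_cancel (h2.symm.trans ?_)
  simp only [← hA', hmap]
  rw [h1, map_mul, map_pow]
  congr 1
  simp only [GeneralLinearGroup.coe_one, Matrix.one_apply]
  split_ifs <;> simp

end Generic

section Twisted

open Matrix

variable {I : Type} [AddCommGroup I] [Fintype I] [DecidableEq I] (g : I) {K : Type} [Field K]

/-- The matrix of entries shifted by a translation of the index group. -/
def shiftHom (I : Type) [AddCommGroup I] [Fintype I] [DecidableEq I] (g : I) (R : Type)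
    [CommRing R] : GL I R →* GL I R :=
  Units.map (reindexAlgEquiv R R (Equiv.addRight (-g))).toRingHom.toMonoidHom

/-- The diagonal matrix of group elements over the group algebra. -/
noncomputable def groupDiagonal (I : Type) [AddCommGroup I] [Fintype I] [DecidableEq I] (K : Type)
    [Field K] : GL I (AddMonoidAlgebra K I) :=
  ⟨diagonal fun i => AddMonoidAlgebra.single (-i) 1, diagonal fun i => AddMonoidAlgebra.single i 1,
    by simp [diagonal_mul_diagonal, AddMonoidAlgebra.single_mul_single,
      ← AddMonoidAlgebra.one_def],
    by simp [diagonal_mul_diagonal, AddMonoidAlgebra.single_mul_single,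
      ← AddMonoidAlgebra.one_def]⟩

open PowerSeries in
/-- Matrices over a power series ring in a cyclic algebra twisted by `σ`. -/
noncomputable def twistedSubgroup (σ : K →+* K) : Subgroup (GL I K⟦X⟧) :=
  (GeneralLinearGroup.map (PowerSeries.map σ)).eqLocus (shiftHom I g K⟦X⟧) ⊓
    (GeneralLinearGroup.map
      ((rescale (AddMonoidAlgebra.single g 1 : AddMonoidAlgebra K I)).comp
        (PowerSeries.map (AddMonoidAlgebra.singleZeroRingHom)))).eqLocus
      ((MulAut.conj (GeneralLinearGroup.map PowerSeries.C
        (groupDiagonal I K))).toMonoidHom.comp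
          (GeneralLinearGroup.map (PowerSeries.map (AddMonoidAlgebra.singleZeroRingHom))))

open PowerSeries in
lemma mem_twistedSubgroup {σ : K →+* K} {M : GL I K⟦X⟧} :
    M ∈ twistedSubgroup g σ ↔ (∀ l m, M.1 (l + g) (m + g) = PowerSeries.map σ (M.1 l m)) ∧
      ∀ j l m, PowerSeries.coeff j (M.1 l m) ≠ 0 → l + j • g = m := by
  rw [twistedSubgroup, Subgroup.mem_inf]
  refine and_congr ?_ ?_
  · change GeneralLinearGroup.map (PowerSeries.map σ) M = shiftHom I g K⟦X⟧ M ↔ _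
    rw [Units.ext_iff, ← Matrix.ext_iff]
    refine forall_congr' fun l => forall_congr' fun m => ?_
    rw [eq_comm]
    have : (shiftHom I g K⟦X⟧ M).1 l m = M.1 (l + g) (m + g) := by
      change M.1 ((Equiv.addRight (-g)).symm l) ((Equiv.addRight (-g)).symm m) = _
      simp
    rw [this]
    rfl
  · change GeneralLinearGroup.map _ M = GeneralLinearGroup.map PowerSeries.C (groupDiagonal I K) *
      GeneralLinearGroup.map (PowerSeries.map (AddMonoidAlgebra.singleZeroRingHom)) M *
      (GeneralLinearGroup.map PowerSeries.C (groupDiagonal I K))⁻¹ ↔ _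
    have key (j : ℕ) (l m : I) : PowerSeries.coeff j ((GeneralLinearGroup.map
        ((rescale (AddMonoidAlgebra.single g 1 : AddMonoidAlgebra K I)).comp
        (PowerSeries.map (AddMonoidAlgebra.singleZeroRingHom))) M).1 l m) =
        AddMonoidAlgebra.single (j • g) (coeff j (M.1 l m)) := by
      simp [AddMonoidAlgebra.single_pow, AddMonoidAlgebra.single_mul_single,
        AddMonoidAlgebra.singleZeroRingHom]
    have key2 (j : ℕ) (l m : I) : PowerSeries.coeff j
        ((GeneralLinearGroup.map PowerSeries.C (groupDiagonal I K) *
        GeneralLinearGroup.map (PowerSeries.map (AddMonoidAlgebra.singleZeroRingHom)) M *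
        (GeneralLinearGroup.map PowerSeries.C (groupDiagonal I K))⁻¹).1 l m) =
        AddMonoidAlgebra.single (m - l) (coeff j (M.1 l m)) := by
      have e1 : (GeneralLinearGroup.map (PowerSeries.C (R := AddMonoidAlgebra K I))
          (groupDiagonal I K)).1 =
          diagonal fun i => PowerSeries.C (AddMonoidAlgebra.single (-i) 1) := by
        ext l m : 2
        by_cases h : l = m <;> simp [groupDiagonal, h]
      have e2 : ((GeneralLinearGroup.map (PowerSeries.C (R := AddMonoidAlgebra K I))
          (groupDiagonal I K))⁻¹).1 =
          diagonal fun i => PowerSeries.C (AddMonoidAlgebra.single i 1) := by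
        rw [← map_inv]
        ext l m : 2
        by_cases h : l = m <;> simp [groupDiagonal, h]
      rw [Units.val_mul, Units.val_mul, e1, e2, mul_diagonal, diagonal_mul, mul_comm,
        PowerSeries.coeff_C_mul, PowerSeries.coeff_C_mul]
      simp [AddMonoidAlgebra.single_mul_single, AddMonoidAlgebra.singleZeroRingHom, sub_eq_add_neg]
    rw [Units.ext_iff, ← Matrix.ext_iff]
    simp only [PowerSeries.ext_iff, key, key2]
    constructor
    · intro h j l m h0
      have h1 := h l m j
      rw [(AddMonoidAlgebra.single_left_inj h0).1 h1, add_sub_cancel]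
    · intro h l m j
      by_cases h0 : coeff j (M.1 l m) = 0
      · simp [h0]
      · rw [← h j l m h0]; simp

open PowerSeries in
lemma det_ne_zero_of_twisted {σ : K →+* K} (v : I → ℕ) (hv : ∀ i, v i • g = i) {N : Matrix I I K⟦X⟧}
    (hN : N ≠ 0) (h1 : ∀ l m, N (l + g) (m + g) = PowerSeries.map σ (N l m))
    (h2 : ∀ j l m, PowerSeries.coeff j (N l m) ≠ 0 → l + j • g = m) : N.det ≠ 0 := by
  classical
  have hex : ∃ r l m, coeff r (N l m) ≠ 0 := by
    by_contra! h
    exact hN (by ext l m r; simp [h r l m])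
  set r := Nat.find hex with hr
  obtain ⟨l₀, m₀, h0⟩ := Nat.find_spec hex
  have hlt (j : ℕ) (hj : j < r) (l m : I) : coeff j (N l m) = 0 := by
    have := Nat.find_min hex hj
    push Not at this
    exact this l m
  have hdvd (l m : I) : X ^ r ∣ N l m := X_pow_dvd_iff.2 fun j hj => hlt j hj l m
  choose N' hN' using hdvd
  have hNN : N = (X ^ r : K⟦X⟧) • (Matrix.of N') := by
    ext l m : 2
    simp [hN' l m]
  have hc (l m : I) : constantCoeff (N' l m) = coeff r (N l m) := by
    rw [hN' l m, ← coeff_zero_eq_constantCoeff_apply, ← coeff_X_pow_mul (N' l m) r 0, zero_add]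
  set a : I → K := fun l => coeff r (N l (l + r • g)) with ha
  have ha0 : a l₀ ≠ 0 := by
    rw [ha]
    simp only
    rw [h2 _ _ _ h0]
    exact h0
  have ha1 (l : I) : a (l + g) = σ (a l) := by
    simp only [ha]
    rw [add_right_comm, h1, PowerSeries.coeff_map]
  have ha2 (j : ℕ) : a (l₀ + j • g) ≠ 0 := by
    induction j with
    | zero => simpa using ha0
    | succ j ih =>
      rw [succ_nsmul, ← add_assoc, ha1]
      simpa using ih
  have ha3 (l : I) : a l ≠ 0 := by
    have := ha2 (v (l - l₀))
    rwa [hv, add_sub_cancel] at this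
  rw [hNN, det_smul]
  refine mul_ne_zero (pow_ne_zero _ (pow_ne_zero _ X_ne_zero)) fun hd => ?_
  have hd0 : ((Matrix.of N').map constantCoeff).det = 0 := by
    have := RingHom.map_det (constantCoeff (R := K)) (Matrix.of N')
    rw [hd, map_zero] at this
    exact this.symm
  have hd1 : (Matrix.of N').map constantCoeff =
      (diagonal a).submatrix id (Equiv.addRight (-(r • g))) := by
    ext l m
    simp only [Matrix.map_apply, of_apply, submatrix_apply, id, Equiv.coe_addRight, hc]
    rw [diagonal_apply]
    split_ifs with h
    · simp only [ha]
      rw [h]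
      simp
    · by_contra h3
      apply h
      rw [← h2 _ _ _ h3]
      simp
  rw [hd1, det_permute', det_diagonal] at hd0
  rcases mul_eq_zero.1 hd0 with h | h
  · have := Int.isUnit_iff.1 (Equiv.Perm.sign (Equiv.addRight (-(r • g)) : Equiv.Perm I)).isUnit
    rcases this with h' | h' <;> rw [h'] at h <;> simp at h
  · exact Finset.prod_ne_zero_iff.2 (fun i _ => ha3 i) h

end Twisted

section Division

open Matrix

variable {I : Type} [AddCommGroup I] [Fintype I] [DecidableEq I] (g : I) {L : Type} [Field L]

variable (I L) in
/-- The rational function field with variables indexed by `I`. -/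
abbrev RationalField : Type := FractionRing (MvPolynomial I L)

/-- Translation of the variables, on polynomials. -/
noncomputable def shiftPoly : MvPolynomial I L →+* MvPolynomial I L :=
  (MvPolynomial.rename (· + g)).toRingHom

lemma shiftPoly_injective : Function.Injective (shiftPoly (L := L) g) :=
  MvPolynomial.rename_injective _ (add_left_injective g)

/-- Translation of the variables, on rational functions. -/
noncomputable def shiftField : RationalField I L →+* RationalField I L :=
  IsFractionRing.map (shiftPoly_injective (L := L) g)

lemma shiftField_algebraMap (P : MvPolynomial I L) :
    shiftField g (algebraMap _ _ P) = algebraMap _ (RationalField I L) (shiftPoly g P) := by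
  rw [shiftField, IsFractionRing.map, IsLocalization.map_eq]

/-- The matrix over a polynomial ring interpolating a given matrix. -/
noncomputable def interpolationMatrix (v : I → ℕ) (f : I → Polynomial L) :
    Matrix I I (Polynomial (MvPolynomial I L)) :=
  Matrix.of fun l m => Polynomial.X ^ v (m - l) *
    Polynomial.C (Polynomial.aeval (MvPolynomial.X l) (f (m - l)))

variable (I L) in
/-- The embedding of polynomials in power series over the rational function field. -/
noncomputable def toPowerSeriesHom :
    Polynomial (MvPolynomial I L) →+* PowerSeries (RationalField I L) :=
  (Polynomial.coeToPowerSeries.ringHom).comp (Polynomial.mapRingHom (algebraMap _ _))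

lemma toPowerSeriesHom_injective : Function.Injective (toPowerSeriesHom I L) :=
  (Polynomial.coe_injective (RationalField I L)).comp
    (Polynomial.map_injective _ (IsFractionRing.injective (MvPolynomial I L) _))

lemma coeff_toPowerSeriesHom (j : ℕ) (P : Polynomial (MvPolynomial I L)) :
    PowerSeries.coeff j (toPowerSeriesHom I L P) = algebraMap _ _ (P.coeff j) := by
  simp [toPowerSeriesHom]

lemma exists_mem_twistedSubgroup (v : I → ℕ) (hv : ∀ i, v i • g = i) (hv0 : v 0 = 0)
    {f : I → Polynomial L} (hf : f 0 ≠ 0) :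
    ∃ A ∈ twistedSubgroup g (shiftField (L := L) g),
      (interpolationMatrix v f).map (toPowerSeriesHom I L) = A.1 := by
  have hinj (i : I) : Function.Injective
      (Polynomial.aeval (R := L) (MvPolynomial.X i : MvPolynomial I L)) := by
    rw [← transcendental_iff_injective]
    exact MvPolynomial.transcendental_X _ _
  have hv1 (i : I) (hi : i ≠ 0) : v i ≠ 0 := by
    intro h
    apply hi
    rw [← hv i, h, zero_smul]
  have hunit : IsUnit ((interpolationMatrix v f).map (toPowerSeriesHom I L)).det := by
    rw [PowerSeries.isUnit_iff_constantCoeff, isUnit_iff_ne_zero, RingHom.map_det]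
    have : (PowerSeries.constantCoeff (R := RationalField I L)).mapMatrix
        ((interpolationMatrix v f).map (toPowerSeriesHom I L)) =
        diagonal fun l => algebraMap (MvPolynomial I L) (RationalField I L)
          (Polynomial.aeval (MvPolynomial.X l) (f 0)) := by
      ext l m
      rw [RingHom.mapMatrix_apply, Matrix.map_apply, Matrix.map_apply,
        ← PowerSeries.coeff_zero_eq_constantCoeff_apply, coeff_toPowerSeriesHom]
      by_cases h : l = m
      · subst h
        simp [interpolationMatrix, hv0]
      · have : v (m - l) ≠ 0 := hv1 _ (by rw [sub_ne_zero]; exact fun h' => h h'.symm)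
        simp [interpolationMatrix, h, this.symm, Polynomial.coeff_X_pow]
    rw [this, det_diagonal, Finset.prod_ne_zero_iff]
    intro l _
    rw [Ne, map_eq_zero_iff _ (IsFractionRing.injective _ _), map_eq_zero_iff _ (hinj l)]
    exact hf
  refine ⟨GeneralLinearGroup.mk'' _ hunit, (mem_twistedSubgroup g).2 ⟨fun l m => ?_,
    fun j l m h => ?_⟩, rfl⟩
  · change toPowerSeriesHom I L (interpolationMatrix v f (l + g) (m + g)) =
      PowerSeries.map _ (toPowerSeriesHom I L (interpolationMatrix v f l m))
    ext j
    rw [PowerSeries.coeff_map, coeff_toPowerSeriesHom, coeff_toPowerSeriesHom, shiftField_algebraMap]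
    congr 1
    simp only [interpolationMatrix, of_apply, add_sub_add_right_eq_sub, Polynomial.coeff_mul_C,
      map_mul, Polynomial.coeff_X_pow]
    congr 1
    · split_ifs <;> simp
    · have := Polynomial.map_aeval_eq_aeval_map (φ := RingHom.id L)
        (ψ := shiftPoly (L := L) g) (by ext x; simp [shiftPoly]) (f (m - l)) (MvPolynomial.X l)
      rw [this]
      simp [shiftPoly]
  · change PowerSeries.coeff j (toPowerSeriesHom I L (interpolationMatrix v f l m)) ≠ 0 at h
    rw [coeff_toPowerSeriesHom] at h
    simp only [interpolationMatrix, of_apply, Polynomial.coeff_mul_C, Polynomial.coeff_X_pow] at h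
    have : j = v (m - l) := by
      by_contra h'
      simp [h'] at h
    rw [this, hv, add_sub_cancel]

lemma exists_interpolation {c : I → L} (hc : Function.Injective c) (A : Matrix I I L) :
    ∃ f : I → Polynomial L, f 0 ≠ 0 ∧ ∀ l m, (f (m - l)).eval (c l) = A l m := by
  classical
  let f₀ : I → Polynomial L := fun i => Lagrange.interpolate Finset.univ c fun l => A l (l + i)
  have h0 (i l : I) : (f₀ i).eval (c l) = A l (l + i) :=
    Lagrange.eval_interpolate_at_node _ hc.injOn (Finset.mem_univ l)
  let f : I → Polynomial L := fun i => if f₀ i = 0 then Lagrange.nodal Finset.univ c else f₀ i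
  refine ⟨f, ?_, fun l m => ?_⟩
  · simp only [f]
    split_ifs with h
    · exact Lagrange.nodal_ne_zero
    · exact h
  · have : (f (m - l)).eval (c l) = (f₀ (m - l)).eval (c l) := by
      simp only [f]
      split_ifs with h
      · rw [Lagrange.eval_nodal_at_node (Finset.mem_univ l), h, Polynomial.eval_zero]
      · rfl
    rw [this, h0, add_sub_cancel]

/-- Generically, a nontrivial word in commutators does not have the eigenvalue `1`. -/
lemma exists_det_commWord_sub_one_ne_zero {d : ℕ} {w : FreeGroup (Fin d)} (hw : w ≠ 1) (k : ℕ)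
    (F : Type) [Field F] :
    ∃ (K : Type) (_ : Field K) (_ : F →+* K) (A : Fin d × Bool → GL (Fin (k + 2)) K),
      ((commWord w A).1 - 1).det ≠ 0 := by
  obtain ⟨L, _, φ, A₀, _, hA₀⟩ := exists_commWord_ne_one hw F
  let e : Fin 2 ⊕ Fin k ≃ Fin (k + 2) := finSumFinEquiv.trans (finCongr (add_comm 2 k))
  let A : Fin d × Bool → GL (Fin (k + 2)) L := fun l => glBlock e (A₀ l)
  have hA : commWord w A ≠ 1 := by
    rw [← map_commWord, ← map_one (glBlock e)]
    exact fun h => hA₀ (glBlock_injective e h)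
  let c : Fin (k + 2) → L := fun i => Infinite.natEmbedding L i
  have hc : Function.Injective c := (Infinite.natEmbedding L).injective.comp Fin.val_injective
  choose f hf0 hf using fun l => exists_interpolation hc (A l).1
  have hv (i : Fin (k + 2)) : i.val • (1 : Fin (k + 2)) = i := by
    induction i using Fin.induction with
    | zero => simp
    | succ i ih =>
      rw [Fin.val_succ, succ_nsmul]
      rw [Fin.val_castSucc] at ih
      rw [ih, Fin.coeSucc_eq_succ]
  choose M hM hM' using fun l => exists_mem_twistedSubgroup (L := L) 1 Fin.val hv rfl (hf0 l)
  have hne : commWord w M ≠ 1 := by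
    intro h
    refine hA (commWord_eq_one_of_map (toPowerSeriesHom (Fin (k + 2)) L) toPowerSeriesHom_injective
      ((MvPolynomial.eval c).comp (Polynomial.evalRingHom 1)) w
      (fun l => interpolationMatrix Fin.val (f l)) M A hM' (fun l => ?_) h)
    ext i j
    rw [← hf l i j]
    have := Polynomial.map_aeval_eq_aeval_map (φ := RingHom.id L) (ψ := MvPolynomial.eval c)
      (by ext x; simp) (f l (j - i)) (MvPolynomial.X i)
    simp [interpolationMatrix, this]
  have hmem := (mem_twistedSubgroup _).1 (commWord_mem w _ hM)
  have hdet : ((commWord w M).1 - 1).det ≠ 0 := by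
    refine det_ne_zero_of_twisted (σ := shiftField (L := L) 1) 1 Fin.val hv (fun h => hne (Units.ext (sub_eq_zero.1 h)))
      (fun l m => ?_) fun j l m h => ?_
    · rw [Matrix.sub_apply, Matrix.sub_apply, map_sub, hmem.1]
      simp only [Matrix.one_apply, add_left_inj]
      split_ifs <;> simp
    · rw [Matrix.sub_apply, map_sub] at h
      by_cases h1 : PowerSeries.coeff j ((commWord w M).1 l m) = 0
      · rw [h1, zero_sub, neg_ne_zero, Matrix.one_apply] at h
        split_ifs at h with h2
        · rw [PowerSeries.coeff_one] at h
          split_ifs at h with h3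
          · rw [h2, h3]; simp
          · exact absurd rfl h
        · simp at h
      · exact hmem.2 j l m h1
  let P := PowerSeries (RationalField (Fin (k + 2)) L)
  let K := FractionRing P
  refine ⟨K, inferInstance, (algebraMap P K).comp ((PowerSeries.C (R := RationalField (Fin (k + 2)) L)).comp
    ((algebraMap L (RationalField (Fin (k + 2)) L)).comp φ)),
    fun l => GeneralLinearGroup.map (algebraMap P K) (M l), ?_⟩
  rw [← map_commWord]
  have : ((GeneralLinearGroup.map (algebraMap P K) (commWord w M)).1 - 1) =
      (algebraMap P K).mapMatrix ((commWord w M).1 - 1) := by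
    rw [map_sub, map_one]; rfl
  rw [this, ← RingHom.map_det, Ne, map_eq_zero_iff _ (IsFractionRing.injective P K)]
  exact hdet

end Division

section Coeff

open Matrix

variable {d : ℕ} (w : FreeGroup (Fin d)) {k : ℕ}

/-- The nonleading, non-subleading coefficients of the shifted characteristic polynomial of a word
value. -/
noncomputable def wordCoeff {K : Type} [CommRing K] (A : Fin d × Bool → GL (Fin (k + 1)) K)
    (j : Fin k) : K :=
  ((commWord w A).1 - 1).charpoly.coeff j

lemma specialize_wordCoeff (R : Type) [CommRing R] {K : Type} [CommRing K] [Algebra R K]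
    (A : Fin d × Bool → GL (Fin (k + 1)) K) (j : Fin k) :
    specialize R A (wordCoeff w (genericGL d (Fin (k + 1)) R) j) = wordCoeff w A j := by
  have h : (((commWord w A).1 - 1) : Matrix _ _ K) =
      ((commWord w (genericGL d (Fin (k + 1)) R)).1 - 1).map (specialize R A).toRingHom := by
    rw [← map_specialize_commWord R A w]
    ext i j
    by_cases h : i = j <;> simp [h]
  rw [wordCoeff, wordCoeff, h, Matrix.charpoly_map, Polynomial.coeff_map]
  rfl

lemma specialize_aeval_wordCoeff (R : Type) [CommRing R] {K : Type} [CommRing K] [Algebra R K]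
    (A : Fin d × Bool → GL (Fin (k + 1)) K) (Q : MvPolynomial (Fin k) R) :
    specialize R A (MvPolynomial.aeval (wordCoeff w (genericGL d (Fin (k + 1)) R)) Q) =
      MvPolynomial.aeval (wordCoeff w A) Q := by
  rw [MvPolynomial.comp_aeval_apply]
  simp only [specialize_wordCoeff]

lemma genericDet_ne_zero (m : Type) [Fintype m] [DecidableEq m] (F : Type) [CommRing F]
    [Nontrivial F] : genericDet d m F ≠ 0 := by
  intro h
  have := aeval_genericDet (d := d) (m := m) F (K := F) (fun _ => 1)
  rw [h, map_zero] at this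
  simp at this

instance (m : Type) [Fintype m] [DecidableEq m] (F : Type) [Field F] :
    IsDomain (GenericRing d m F) :=
  IsLocalization.isDomain_localization (powers_le_nonZeroDivisors_of_noZeroDivisors
    (genericDet_ne_zero m F))

lemma aeval_cons_zero {F S : Type} [Field F] [CommRing S] [Algebra F S] (y : Fin k → S)
    (Q : MvPolynomial (Fin (k + 1)) F) :
    MvPolynomial.aeval (Fin.cons 0 y : Fin (k + 1) → S) Q =
      MvPolynomial.aeval y ((MvPolynomial.finSuccEquiv F k Q).coeff 0) := by
  have : (MvPolynomial.aeval (R := F) (Fin.cons 0 y : Fin (k + 1) → S)).toRingHom =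
      ((MvPolynomial.aeval (R := F) y).toRingHom.comp Polynomial.constantCoeff).comp
        (MvPolynomial.finSuccEquiv F k).toAlgHom.toRingHom := by
    apply MvPolynomial.ringHom_ext
    · intro r
      simp [MvPolynomial.finSuccEquiv_apply]
    · intro i
      refine Fin.cases ?_ (fun i => ?_) i
      · simp [MvPolynomial.finSuccEquiv_X_zero]
      · simp [MvPolynomial.finSuccEquiv_X_succ]
  exact DFunLike.congr_fun this Q

lemma wordCoeff_glBlock {K : Type} [CommRing K] (e : Fin (k + 1) ⊕ Fin 1 ≃ Fin (k + 2))
    (A : Fin d × Bool → GL (Fin (k + 1)) K) :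
    wordCoeff w (fun l => glBlock e (A l)) = Fin.cons 0 (wordCoeff w A) := by
  ext j
  rw [wordCoeff, ← map_commWord, charpoly_glBlock_sub_one, Fintype.card_fin, pow_one]
  refine Fin.cases ?_ (fun i => ?_) j
  · simp
  · simp [wordCoeff]

/-- The coefficients of the shifted characteristic polynomial of a word in generic commutators are
algebraically independent. -/
lemma aeval_wordCoeff_ne_zero {w : FreeGroup (Fin d)} (hw : w ≠ 1) (k : ℕ) (F : Type) [Field F]
    {Q : MvPolynomial (Fin k) F} (hQ : Q ≠ 0) :
    MvPolynomial.aeval (wordCoeff w (genericGL d (Fin (k + 1)) F)) Q ≠ 0 := by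
  induction k with
  | zero =>
    rw [MvPolynomial.eq_C_of_isEmpty Q] at hQ ⊢
    rw [MvPolynomial.aeval_C, Ne, FaithfulSMul.algebraMap_eq_zero_iff]
    simpa using hQ
  | succ k ih =>
    induction h : Q.totalDegree using Nat.strong_induction_on generalizing Q with
    | _ D ihD =>
      by_cases h0 : (MvPolynomial.finSuccEquiv F k Q).coeff 0 = 0
      · obtain ⟨P, hP⟩ := Polynomial.X_dvd_iff.2 h0
        have hQP : Q = MvPolynomial.X 0 * (MvPolynomial.finSuccEquiv F k).symm P := by
          apply (MvPolynomial.finSuccEquiv F k).injective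
          rw [map_mul, MvPolynomial.finSuccEquiv_X_zero, AlgEquiv.apply_symm_apply, hP]
        set Q' := (MvPolynomial.finSuccEquiv F k).symm P
        have hQ' : Q' ≠ 0 := by
          rintro h
          rw [h, mul_zero] at hQP
          exact hQ hQP
        have hdeg : Q'.totalDegree < D := by
          rw [← h, hQP, MvPolynomial.totalDegree_mul_of_isDomain (MvPolynomial.X_ne_zero _) hQ',
            MvPolynomial.totalDegree_X]
          omega
        rw [hQP, map_mul, MvPolynomial.aeval_X]
        refine mul_ne_zero ?_ (ihD _ hdeg hQ' rfl)
        obtain ⟨K, _, φ, A, hA⟩ := exists_det_commWord_sub_one_ne_zero hw k F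
        let _ := φ.toAlgebra
        intro hz
        have := specialize_wordCoeff w F A 0
        rw [hz, map_zero, wordCoeff, Fin.val_zero] at this
        rw [Matrix.det_eq_sign_charpoly_coeff, ← this, mul_zero] at hA
        exact hA rfl
      · have h1 := ih h0
        rw [← aeval_cons_zero, ← wordCoeff_glBlock w finSumFinEquiv] at h1
        intro hz
        apply h1
        rw [← specialize_aeval_wordCoeff, hz, map_zero]

end Coeff

section Clearing

open MvPolynomial

lemma totalDegree_map_le_totalDegree {R S τ : Type} [CommSemiring R] [CommSemiring S] (ψ : R →+* S)
    (P : MvPolynomial τ R) : (map ψ P).totalDegree ≤ P.totalDegree :=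
  Finset.sup_mono (support_map_subset ψ P)

lemma exists_homogenization {F τ ι : Type} [Field F] [Fintype ι] (Q : MvPolynomial ι F)
    (f : ι → MvPolynomial τ F) (g : MvPolynomial τ F) {E : ℕ} (hf : ∀ i, (f i).totalDegree ≤ E)
    (hg : g.totalDegree ≤ E) :
    ∃ G : MvPolynomial τ F, G.totalDegree ≤ Q.totalDegree * E ∧
      ∀ (S : Type) [CommRing S] [Algebra F S] (x : τ → S) (y : ι → S),
        (∀ i, aeval x (f i) = aeval x g * y i) →
          aeval x G = aeval x g ^ Q.totalDegree * aeval y Q := by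
  refine ⟨∑ m ∈ Q.support, C (Q.coeff m) * ((∏ i, f i ^ m i) * g ^ (Q.totalDegree - ∑ i, m i)),
    ?_, fun S _ _ x y h => ?_⟩
  · refine totalDegree_finsetSum_le fun m hm => ?_
    have hmD : ∑ i, m i ≤ Q.totalDegree := by
      have := le_totalDegree hm
      rwa [Finsupp.sum_fintype _ _ (fun _ => rfl)] at this
    refine (totalDegree_mul _ _).trans ?_
    rw [totalDegree_C, zero_add]
    refine (totalDegree_mul _ _).trans ?_
    have h1 : (∏ i, f i ^ m i).totalDegree ≤ (∑ i, m i) * E := by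
      refine (totalDegree_finsetProd _ _).trans ?_
      rw [Finset.sum_mul]
      exact Finset.sum_le_sum fun i _ => (totalDegree_pow _ _).trans
        (Nat.mul_le_mul_left _ (hf i))
    have h2 : (g ^ (Q.totalDegree - ∑ i, m i)).totalDegree ≤ (Q.totalDegree - ∑ i, m i) * E :=
      (totalDegree_pow _ _).trans (Nat.mul_le_mul_left _ hg)
    calc _ ≤ (∑ i, m i) * E + (Q.totalDegree - ∑ i, m i) * E := add_le_add h1 h2
      _ = _ := by rw [← add_mul, Nat.add_sub_cancel' hmD]
  · rw [map_sum, aeval_def y, eval₂_eq', Finset.mul_sum]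
    refine Finset.sum_congr rfl fun m hm => ?_
    have hmD : ∑ i, m i ≤ Q.totalDegree := by
      have := le_totalDegree hm
      rwa [Finsupp.sum_fintype _ _ (fun _ => rfl)] at this
    rw [map_mul, map_mul, map_prod, map_pow, aeval_C]
    simp only [map_pow, h, mul_pow, Finset.prod_mul_distrib, Finset.prod_pow_eq_pow_sum]
    conv_rhs => rw [← Nat.add_sub_cancel' hmD, pow_add]
    ring

lemma exists_vanishing_of_card_lt {F : Type} [Field F] {k b : ℕ} (Z : Set (Fin k → F)) [Finite Z]
    (hZ : Nat.card Z < (b + 1) ^ k) :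
    ∃ Q : MvPolynomial (Fin k) F, Q ≠ 0 ∧ Q.totalDegree ≤ k * b ∧ ∀ c ∈ Z, aeval c Q = 0 := by
  let mon (m : Fin k → Fin (b + 1)) : Fin k →₀ ℕ := Finsupp.equivFunOnFinite.symm fun i => (m i).val
  have hmon : Function.Injective mon := fun m m' h => by
    ext i
    exact DFunLike.congr_fun h i
  let poly : ((Fin k → Fin (b + 1)) → F) →ₗ[F] MvPolynomial (Fin k) F :=
    ∑ m, (MvPolynomial.monomial (R := F) (mon m)).comp (LinearMap.proj m)
  have hpoly (a) : poly a = ∑ m, MvPolynomial.monomial (mon m) (a m) := by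
    simp [poly]
  let ev : ((Fin k → Fin (b + 1)) → F) →ₗ[F] (Z → F) :=
    LinearMap.pi fun c => (aeval (R := F) c.1).toLinearMap.comp poly
  have := Fintype.ofFinite Z
  obtain ⟨a, ha, ha0⟩ := Submodule.exists_mem_ne_zero_of_ne_bot
    (LinearMap.ker_ne_bot_of_finrank_lt (f := ev) (by
      rw [Module.finrank_pi, Module.finrank_pi]
      simpa using hZ))
  refine ⟨poly a, fun h => ha0 ?_, ?_, fun c hc => ?_⟩
  · ext m
    have := congrArg (coeff (mon m)) h
    rw [hpoly, coeff_sum, Finset.sum_eq_single m] at this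
    · simpa using this
    · intro m' _ hm'
      rw [coeff_monomial, if_neg]
      exact fun h => hm' (hmon h)
    · simp
  · rw [hpoly]
    refine totalDegree_finsetSum_le fun m _ => (totalDegree_monomial_le _ _).trans ?_
    rw [Finsupp.sum_fintype _ _ (fun _ => rfl)]
    calc ∑ i, mon m i ≤ ∑ _i : Fin k, b := Finset.sum_le_sum fun i _ => Nat.lt_succ_iff.1 (m i).2
      _ = k * b := by simp
  · exact congrFun (LinearMap.mem_ker.1 ha) ⟨c, hc⟩

lemma exists_eval_ne_zero_of_totalDegree_lt {F τ : Type} [Field F] [Fintype F] [Finite τ]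
    {G : MvPolynomial τ F} (hG : G ≠ 0) (hdeg : G.totalDegree < Fintype.card F) :
    ∃ x, eval x G ≠ 0 := by
  classical
  by_contra! h
  exact hG (eq_zero_of_eval_zero_at_prod_finset G (fun _ => Finset.univ)
    (fun i => (degreeOf_le_totalDegree G i).trans_lt (by simpa using hdeg)) fun x _ => h x)

end Clearing

section Counting

open Matrix MvPolynomial

variable {d : ℕ} {w : FreeGroup (Fin d)}

lemma wordCoeff_of_numerators {k : ℕ} {e : ℕ}
    {f : Fin k → MvPolynomial ((Fin d × Bool) × Fin (k + 1) × Fin (k + 1)) ℤ}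
    (hf : ∀ j, algebraMap _ (GenericRing d (Fin (k + 1)) ℤ) (f j) =
      algebraMap _ _ (genericDet d (Fin (k + 1)) ℤ) ^ e *
        wordCoeff w (genericGL d (Fin (k + 1)) ℤ) j)
    {K : Type} [CommRing K] (A : Fin d × Bool → GL (Fin (k + 1)) K) (j : Fin k) :
    aeval (entryPoint fun l => (A l).1) (f j) =
      aeval (entryPoint fun l => (A l).1) (genericDet d (Fin (k + 1)) ℤ ^ e) * wordCoeff w A j := by
  rw [← specialize_algebraMap, hf, map_mul, map_pow, specialize_algebraMap, specialize_wordCoeff,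
    map_pow]

lemma exists_aeval_wordCoeff_ne_zero (hw : w ≠ 1) (k : ℕ) :
    ∃ E : ℕ, ∀ (F : Type) [Field F] [Fintype F] (Q : MvPolynomial (Fin k) F), Q ≠ 0 →
      Q.totalDegree * E + E < Fintype.card F →
        ∃ A : Fin d × Bool → GL (Fin (k + 1)) F, aeval (wordCoeff w A) Q ≠ 0 := by
  obtain ⟨e, f, hf⟩ := exists_numerators ℤ (wordCoeff w (genericGL d (Fin (k + 1)) ℤ))
  let δ := genericDet d (Fin (k + 1)) ℤ
  let E := (∑ j, (f j).totalDegree) + (δ ^ e).totalDegree + δ.totalDegree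
  refine ⟨E, fun F _ _ Q hQ hdeg => ?_⟩
  let ψ : ℤ →+* F := Int.castRingHom F
  obtain ⟨G, hG, hG'⟩ := exists_homogenization Q (fun j => map ψ (f j)) (map ψ (δ ^ e)) (E := E)
    (fun j => (totalDegree_map_le_totalDegree _ _).trans (by
      have := Finset.single_le_sum (f := fun j => (f j).totalDegree) (fun _ _ => Nat.zero_le _)
        (Finset.mem_univ j)
      omega))
    ((totalDegree_map_le_totalDegree _ _).trans (by omega))
  have hmap {S : Type} [CommRing S] [Algebra F S]
      (x : (Fin d × Bool) × Fin (k + 1) × Fin (k + 1) → S) (P) :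
      aeval x (map ψ P) = aeval x P := by
    rw [aeval_def, eval₂_map, aeval_def]
    congr 1
    exact RingHom.ext_int _ _
  have hpt {S : Type} [CommRing S] [Algebra F S] (A : Fin d × Bool → GL (Fin (k + 1)) S) :
      aeval (entryPoint fun l => (A l).1) G =
        aeval (entryPoint fun l => (A l).1) (δ ^ e) ^ Q.totalDegree * aeval (wordCoeff w A) Q := by
    have := hG' S (entryPoint fun l => (A l).1) (wordCoeff w A) fun j => by
      rw [hmap, hmap]
      exact wordCoeff_of_numerators hf A j
    rwa [hmap] at this
  have hunit {S : Type} [CommRing S] (A : Fin d × Bool → GL (Fin (k + 1)) S) :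
      IsUnit (aeval (entryPoint fun l => (A l).1) δ) := isUnit_aeval_genericDet ℤ A
  have hne : G * map ψ δ ≠ 0 := by
    intro h0
    have h1 := congrArg (aeval (entryPoint fun l => (genericGL d (Fin (k + 1)) F l).1)) h0
    rw [map_mul, map_zero, hpt, hmap, map_pow] at h1
    have hu := hunit (genericGL d (Fin (k + 1)) F)
    exact mul_ne_zero (mul_ne_zero (pow_ne_zero _ (pow_ne_zero _ hu.ne_zero))
      (aeval_wordCoeff_ne_zero hw k F hQ)) hu.ne_zero h1
  obtain ⟨x, hx⟩ := exists_eval_ne_zero_of_totalDegree_lt hne (by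
    refine ((totalDegree_mul _ _).trans (add_le_add hG ?_)).trans_lt hdeg
    exact (totalDegree_map_le_totalDegree _ _).trans (by omega))
  rw [map_mul] at hx
  let M : Fin d × Bool → Matrix (Fin (k + 1)) (Fin (k + 1)) F := fun l => Matrix.of fun i j => x (l, i, j)
  have hM : ∏ l, (M l).det ≠ 0 := by
    have h2 := right_ne_zero_of_mul hx
    rw [← coe_aeval_eq_eval] at h2
    change aeval x (map ψ δ) ≠ 0 at h2
    rw [hmap] at h2
    have : aeval x δ = ∏ l, (M l).det := by
      change aeval x (∏ l, (genericMatrix d (Fin (k + 1)) ℤ l).det) = _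
      rw [map_prod]
      refine Finset.prod_congr rfl fun l _ => ?_
      rw [AlgHom.map_det]
      congr 1
      ext i j
      simp [M, genericMatrix]
    rwa [this] at h2
  let A : Fin d × Bool → GL (Fin (k + 1)) F := fun l =>
    GeneralLinearGroup.mkOfDetNeZero (M l) (Finset.prod_ne_zero_iff.1 hM l (Finset.mem_univ l))
  refine ⟨A, ?_⟩
  have h3 := left_ne_zero_of_mul hx
  rw [← coe_aeval_eq_eval] at h3
  change aeval (entryPoint fun l => (A l).1) G ≠ 0 at h3
  rw [hpt] at h3
  exact right_ne_zero_of_mul h3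

/-- The coefficient vectors of word values avoiding a hypersurface are numerous. -/
theorem exists_pow_le_card_wordCoeff (hw : w ≠ 1) (k : ℕ) :
    ∃ E : ℕ, ∀ (F : Type) [Field F] [Fintype F] (H : MvPolynomial (Fin k) F), H ≠ 0 →
      ∀ b : ℕ, (k * b + H.totalDegree) * E + E < Fintype.card F →
        (b + 1) ^ k ≤ Nat.card {c : Fin k → F | aeval c H ≠ 0 ∧
          ∃ A : Fin d × Bool → GL (Fin (k + 1)) F, wordCoeff w A = c} := by
  obtain ⟨E, hE⟩ := exists_aeval_wordCoeff_ne_zero hw k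
  refine ⟨E, fun F _ _ H hH b hb => ?_⟩
  by_contra! hlt
  obtain ⟨Q, hQ, hdeg, hvan⟩ := exists_vanishing_of_card_lt _ hlt
  obtain ⟨A, hA⟩ := hE F (Q * H) (mul_ne_zero hQ hH) (by
    refine lt_of_le_of_lt ?_ hb
    exact Nat.add_le_add_right (Nat.mul_le_mul_right _ ((totalDegree_mul _ _).trans
      (Nat.add_le_add_right hdeg _))) _)
  rw [map_mul] at hA
  exact left_ne_zero_of_mul hA (hvan _ ⟨right_ne_zero_of_mul hA, A, rfl⟩)

end Counting

section WordPoly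

open Polynomial

variable {R : Type*} [CommRing R] {k : ℕ}

/-- The monic polynomial of degree `k + 1` with coefficients `c j` below degree `k` whose value at
`-1` is `(-1) ^ (k + 1)`. -/
noncomputable def wordPoly (c : Fin k → R) : R[X] :=
  X ^ (k + 1) + ∑ j : Fin k, C (c j) * (X ^ (j : ℕ) - C ((-1) ^ ((j : ℕ) + k)) * X ^ k)

lemma wordPoly_map {S : Type*} [CommRing S] (f : R →+* S) (c : Fin k → R) :
    (wordPoly c).map f = wordPoly fun j => f (c j) := by
  simp [wordPoly, Polynomial.map_sum]

lemma degree_sum_wordPoly_lt (c : Fin k → R) :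
    (∑ j : Fin k, C (c j) * (X ^ (j : ℕ) - C ((-1) ^ ((j : ℕ) + k)) * X ^ k)).degree <
      ((k + 1 : ℕ) : WithBot ℕ) := by
  rw [degree_lt_iff_coeff_zero]
  intro n hn
  rw [finsetSum_coeff]
  refine Finset.sum_eq_zero fun j _ => ?_
  have := j.2
  rw [coeff_C_mul, coeff_sub, coeff_C_mul, coeff_X_pow, coeff_X_pow, if_neg (by omega),
    if_neg (by omega)]
  simp

lemma wordPoly_monic (c : Fin k → R) : (wordPoly c).Monic :=
  monic_X_pow_add (n := k + 1) (degree_sum_wordPoly_lt c)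

lemma natDegree_wordPoly [Nontrivial R] (c : Fin k → R) :
    (wordPoly c).natDegree = k + 1 := by
  rw [wordPoly, natDegree_add_eq_left_of_degree_lt, natDegree_X_pow]
  rw [degree_X_pow]
  exact degree_sum_wordPoly_lt c

lemma eval_wordPoly (c : Fin k → R) : (wordPoly c).eval (-1) = (-1) ^ (k + 1) := by
  simp only [wordPoly, eval_add, eval_pow, eval_X, eval_finsetSum, eval_mul, eval_C, eval_sub]
  rw [Finset.sum_eq_zero, add_zero]
  intro j _
  rw [pow_add, mul_assoc, ← pow_add, ← two_mul, pow_mul]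
  simp

lemma coeff_wordPoly (c : Fin k → R) (j : Fin k) : (wordPoly c).coeff j = c j := by
  have := j.2
  rw [wordPoly, coeff_add, coeff_X_pow, if_neg (by omega), zero_add, finsetSum_coeff,
    Finset.sum_eq_single j]
  · rw [coeff_C_mul, coeff_sub, coeff_C_mul, coeff_X_pow, coeff_X_pow, if_pos rfl,
      if_neg (by omega)]
    simp
  · intro i _ hij
    have : (i : ℕ) ≠ j := fun h => hij (Fin.ext h)
    rw [coeff_C_mul, coeff_sub, coeff_C_mul, coeff_X_pow, coeff_X_pow, if_neg (by omega),
      if_neg (by omega)]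
    simp
  · simp

/-- A monic polynomial of degree `k + 1` with the right value at `-1` is a `wordPoly`. -/
lemma eq_wordPoly [Nontrivial R] {p : R[X]} (hp : p.Monic) (hd : p.natDegree = k + 1)
    (he : p.eval (-1) = (-1) ^ (k + 1)) : p = wordPoly fun j : Fin k => p.coeff j := by
  set q := wordPoly fun j : Fin k => p.coeff j with hq
  have hco : ∀ i, i ≠ k → p.coeff i = q.coeff i := by
    intro i hi
    rcases lt_trichotomy i k with h | h | h
    · exact (coeff_wordPoly (fun j : Fin k => p.coeff j) ⟨i, h⟩).symm
    · exact absurd h hi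
    · rcases eq_or_lt_of_le (Nat.succ_le_of_lt h) with h' | h'
      · have h1 := hp.coeff_natDegree
        have h2 := (wordPoly_monic fun j : Fin k => p.coeff j).coeff_natDegree
        rw [natDegree_wordPoly] at h2
        rw [hd] at h1
        subst h'
        exact h1.trans h2.symm
      · rw [coeff_eq_zero_of_natDegree_lt (by omega), coeff_eq_zero_of_natDegree_lt]
        rw [hq, natDegree_wordPoly]
        omega
  have hsub : p = q + C (p.coeff k - q.coeff k) * X ^ k := by
    ext i
    rw [coeff_add, coeff_C_mul, coeff_X_pow]
    split_ifs with h
    · rw [h]; ring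
    · rw [hco i h]; ring
  have hk : p.coeff k - q.coeff k = 0 := by
    have h := congrArg (eval (-1)) hsub
    rw [eval_add, he, hq, eval_wordPoly] at h
    simp only [eval_mul, eval_C, eval_pow, eval_X, left_eq_add] at h
    have h2 := congrArg (· * (-1 : R) ^ k) h
    simp only [mul_assoc, ← pow_add, ← two_mul, pow_mul] at h2
    simpa using h2
  rw [hk, map_zero, zero_mul, add_zero] at hsub
  exact hsub

lemma charpoly_sub_one_eq_wordPoly [Nontrivial R] (g : Matrix (Fin (k + 1)) (Fin (k + 1)) R)
    (hg : g.det = 1) :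
    (g - 1).charpoly = wordPoly fun j : Fin k => (g - 1).charpoly.coeff j := by
  refine eq_wordPoly (Matrix.charpoly_monic _) ?_ ?_
  · rw [Matrix.charpoly_natDegree_eq_dim, Fintype.card_fin]
  · rw [Matrix.eval_charpoly]
    have : Matrix.scalar (Fin (k + 1)) (-1 : R) - (g - 1) = -g := by
      rw [map_neg, map_one]; abel
    rw [this, Matrix.det_neg, hg, Fintype.card_fin, mul_one]

lemma wordPoly_special (hk : 0 < k) (t : R) :
    wordPoly (fun j : Fin k => if (j : ℕ) ≤ 1 then t else 0) = X ^ (k + 1) + C t * (X + 1) := by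
  obtain ⟨k, rfl⟩ : ∃ l, k = l + 1 := ⟨k - 1, by omega⟩
  rw [wordPoly]
  congr 1
  rcases k with _ | k
  · simp; ring
  · rw [Fin.sum_univ_succ, Fin.sum_univ_succ, Finset.sum_eq_zero]
    · simp; ring
    · intro i _
      simp

end WordPoly

section Resultant

open Polynomial

lemma resultant_ne_zero_iff_isCoprime {K : Type*} [Field K] {f g : K[X]} {m n : ℕ}
    (hf : f.Monic) (hm : f.natDegree = m) (hm0 : m ≠ 0) (hg : g.natDegree ≤ n) :
    resultant f g m n ≠ 0 ↔ IsCoprime f g := by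
  constructor
  · intro h
    obtain ⟨p, q, -, -, e⟩ := exists_mul_add_mul_eq_C_resultant f g hm.le hg (Or.inl hm0)
    refine ⟨C (resultant f g m n)⁻¹ * p, C (resultant f g m n)⁻¹ * q, ?_⟩
    rw [mul_assoc, mul_assoc, mul_comm p, mul_comm q, ← mul_add, e, ← C_mul, inv_mul_cancel₀ h,
      C_1]
  · intro h
    obtain ⟨l, rfl⟩ := Nat.exists_eq_add_of_le hg
    subst hm
    rw [resultant_add_right_deg _ _ _ _ _ le_rfl]
    have := resultant_ne_zero f g h
    simpa [hf.coeff_natDegree] using this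

lemma totalDegree_coeff_wordPoly_le {R : Type*} [CommRing R] [Nontrivial R] {k : ℕ}
    {σ : Type*} (e : ℕ) (c : Fin k → MvPolynomial σ R)
    (hc : ∀ j, (c j).totalDegree ≤ e) (i : ℕ) : ((wordPoly c).coeff i).totalDegree ≤ e := by
  rw [wordPoly, coeff_add, finsetSum_coeff]
  refine (MvPolynomial.totalDegree_add _ _).trans (max_le ?_ ?_)
  · rw [coeff_X_pow]; split_ifs <;> simp
  · refine MvPolynomial.totalDegree_finsetSum_le fun j _ => ?_
    rw [coeff_C_mul]
    refine (MvPolynomial.totalDegree_mul _ _).trans ?_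
    have : ((X ^ (j : ℕ) - C ((-1) ^ ((j : ℕ) + k)) * X ^ k :
        (MvPolynomial σ R)[X]).coeff i).totalDegree = 0 := by
      rw [coeff_sub, coeff_C_mul, coeff_X_pow, coeff_X_pow]
      have h1 : ∀ P : Prop, ∀ [Decidable P],
          (if P then 1 else 0 : MvPolynomial σ R) = MvPolynomial.C (if P then 1 else 0) := by
        intro P _; split_ifs <;> simp
      rw [h1, h1, show ((-1 : MvPolynomial σ R) ^ ((j : ℕ) + k)) =
        MvPolynomial.C ((-1) ^ ((j : ℕ) + k)) by simp, ← map_mul, ← map_sub,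
        MvPolynomial.totalDegree_C]
    rw [this, add_zero]
    exact hc j

lemma totalDegree_resultant_le {R σ : Type*} [CommRing R] (f g : (MvPolynomial σ R)[X]) (m n e : ℕ)
    (hf : ∀ i, (f.coeff i).totalDegree ≤ e) (hg : ∀ i, (g.coeff i).totalDegree ≤ e) :
    (resultant f g m n).totalDegree ≤ (m + n) * e := by
  rw [resultant, Matrix.det_apply]
  refine MvPolynomial.totalDegree_finsetSum_le fun s _ => ?_
  have h1 : ∀ (u : ℤˣ) (p : MvPolynomial σ R), (u • p).totalDegree = p.totalDegree := by
    intro u p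
    rcases Int.units_eq_one_or u with rfl | rfl <;> simp
  rw [h1]
  refine (MvPolynomial.totalDegree_finsetProd _ _).trans ?_
  refine (Finset.sum_le_card_nsmul _ _ e ?_).trans (by simp)
  intro i _
  rw [sylvester, Matrix.of_apply]
  induction i using Fin.addCases with
  | left i =>
    rw [Fin.addCases_left]
    split_ifs
    · exact hg _
    · simp
  | right i =>
    rw [Fin.addCases_right]
    split_ifs
    · exact hf _
    · simp

end Resultant

section GenericPolynomial

open Polynomial

variable {k : ℕ}

lemma isCoprime_trinomial {K : Type*} [Field K] {s t : K} (hst : s ≠ t) :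
    IsCoprime (X ^ (k + 1) + C s * (X + 1)) (X ^ (k + 1) + C t * (X + 1)) := by
  rw [isCoprime_iff_aeval_ne_zero_of_isAlgClosed K (AlgebraicClosure K)]
  intro a
  by_contra! h
  obtain ⟨h1, h2⟩ := h
  simp only [map_add, map_mul, map_pow, aeval_X, aeval_C, map_one] at h1 h2
  have h3 : (algebraMap K (AlgebraicClosure K) s - algebraMap K _ t) * (a + 1) = 0 := by
    linear_combination h1 - h2
  rcases mul_eq_zero.1 h3 with h4 | h4
  · exact hst ((algebraMap K (AlgebraicClosure K)).injective (sub_eq_zero.1 h4))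
  · rw [h4, mul_zero, add_zero] at h1
    have := pow_eq_zero_iff (by omega) |>.1 h1
    rw [this, zero_add] at h4
    exact one_ne_zero h4

lemma separable_trinomial {E K : Type*} [Field E] [Field K] [Algebra E[X] K]
    (hinj : Function.Injective (algebraMap E[X] K)) :
    (X ^ (k + 1) + C (algebraMap E[X] K X) * (X + 1)).Separable := by
  rw [separable_def, isCoprime_iff_aeval_ne_zero_of_isAlgClosed K (AlgebraicClosure K)]
  intro a
  by_contra! h
  obtain ⟨h1, h2⟩ := h
  simp only [derivative_X_pow, derivative_mul, derivative_C, derivative_X,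
    derivative_one, map_add, map_mul, map_pow, aeval_X, aeval_C, map_one, map_natCast,
    Nat.add_sub_cancel, zero_mul, zero_add, add_zero, mul_one] at h1 h2
  let φ : E[X] →+* AlgebraicClosure K :=
    (algebraMap K (AlgebraicClosure K)).comp (algebraMap E[X] K)
  have hφ : Function.Injective φ := (algebraMap K (AlgebraicClosure K)).injective.comp hinj
  change a ^ (k + 1) + φ X * (a + 1) = 0 at h1
  change _ + φ X = 0 at h2
  have ht : φ X ≠ 0 := fun h => X_ne_zero (hφ (h.trans (map_zero φ).symm))
  push_cast at h2
  have h3 : φ X * ((k : AlgebraicClosure K) * a + (k + 1)) = 0 := by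
    linear_combination ((k : AlgebraicClosure K) + 1) * h1 - a * h2
  have h4 := (mul_eq_zero.1 h3).resolve_left ht
  have h5 : (k : AlgebraicClosure K) * a = -(k + 1) := by linear_combination h4
  have h6 : φ (C (((k : E) + 1) * (-(k + 1)) ^ k) + C ((k : E) ^ k) * X) = 0 := by
    simp only [map_add, map_mul, map_pow, map_neg, map_one, map_natCast]
    have : (k : AlgebraicClosure K) ^ k * ((k + 1) * a ^ k + φ X) = 0 := by rw [h2, mul_zero]
    rw [← h5, mul_pow]
    linear_combination this
  have h7 := hφ (h6.trans (map_zero φ).symm)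
  have h8 := congrArg (fun p => coeff p 1) h7
  simp only [coeff_add, coeff_C_mul, coeff_X_one, coeff_C, mul_one, coeff_zero] at h8
  have hk : (k : E) = 0 := by
    have : (k : E) ^ k = 0 := by simpa using h8
    exact eq_zero_of_pow_eq_zero this
  have hk' : (k : AlgebraicClosure K) = 0 := by
    have := congrArg (fun e => φ (C e)) hk
    simpa using this
  rw [hk'] at h5
  simp at h5

/-- Outside a hypersurface of small degree, the polynomial `wordPoly c` is separable, has nonzero
constant term and is coprime to its Frobenius twists. -/
theorem exists_generic_wordPoly {E : Type} [Field E] (hk : 0 < k) (q m : ℕ) (hq : 2 ≤ q) :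
    ∃ H : MvPolynomial (Fin k) E, H ≠ 0 ∧
      H.totalDegree ≤ 1 + 2 * (k + 1) + 4 * (k + 1) * q ^ (m / 2) ∧
      ∀ c : Fin k → E, MvPolynomial.aeval c H ≠ 0 → c ⟨0, hk⟩ ≠ 0 ∧ (wordPoly c).Separable ∧
        ∀ i, 0 < i → 2 * i ≤ m → IsCoprime (wordPoly c) (wordPoly fun j => c j ^ q ^ i) := by
  let P : ℕ → (MvPolynomial (Fin k) E)[X] := fun i =>
    wordPoly fun j : Fin k => (MvPolynomial.X j : MvPolynomial (Fin k) E) ^ q ^ i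
  let P₀ : (MvPolynomial (Fin k) E)[X] :=
    wordPoly fun j : Fin k => (MvPolynomial.X j : MvPolynomial (Fin k) E)
  let R : ℕ → MvPolynomial (Fin k) E := fun i => resultant P₀ (P i) (k + 1) (k + 1)
  let D : MvPolynomial (Fin k) E := resultant P₀ (derivative P₀) (k + 1) k
  have hR : ∀ (K : Type) [Field K] [Algebra E K] (c : Fin k → K) (i : ℕ),
      MvPolynomial.aeval c (R i) ≠ 0 ↔
        IsCoprime (wordPoly c) (wordPoly fun j => c j ^ q ^ i) := by
    intro K _ _ c i
    rw [← resultant_ne_zero_iff_isCoprime (wordPoly_monic c) (natDegree_wordPoly c)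
      (Nat.succ_ne_zero k) (natDegree_wordPoly _).le]
    change (MvPolynomial.aeval (R := E) c).toRingHom (resultant _ _ _ _) ≠ 0 ↔ _
    rw [← resultant_map_map, wordPoly_map, wordPoly_map]
    have h1 : (fun j => (MvPolynomial.aeval (R := E) c).toRingHom (MvPolynomial.X j)) = c :=
      funext fun j => MvPolynomial.aeval_X _ _
    have h2 : (fun j => (MvPolynomial.aeval (R := E) c).toRingHom (MvPolynomial.X j ^ q ^ i)) =
        fun j => c j ^ q ^ i :=
      funext fun j => by rw [map_pow]; exact congrArg (· ^ q ^ i) (MvPolynomial.aeval_X _ _)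
    rw [h1, h2]
  have hD : ∀ (K : Type) [Field K] [Algebra E K] (c : Fin k → K),
      MvPolynomial.aeval c D ≠ 0 ↔ (wordPoly c).Separable := by
    intro K _ _ c
    rw [separable_def, ← resultant_ne_zero_iff_isCoprime (n := k) (wordPoly_monic c)
      (natDegree_wordPoly c) (Nat.succ_ne_zero k)
      ((natDegree_derivative_le _).trans (by rw [natDegree_wordPoly]; rfl))]
    change (MvPolynomial.aeval (R := E) c).toRingHom (resultant _ _ _ _) ≠ 0 ↔ _
    rw [← resultant_map_map, ← derivative_map, wordPoly_map]
    have h1 : (fun j => (MvPolynomial.aeval (R := E) c).toRingHom (MvPolynomial.X j)) = c :=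
      funext fun j => MvPolynomial.aeval_X _ _
    rw [h1]
  let K := FractionRing E[X]
  have hinj : Function.Injective (algebraMap E[X] K) := IsFractionRing.injective _ _
  let t : K := algebraMap E[X] K X
  have ht0 : t ≠ 0 := fun h => X_ne_zero (hinj (h.trans (map_zero _).symm))
  have ht : ∀ i, 0 < i → t ≠ t ^ q ^ i := by
    intro i hi h
    have h' : (X : E[X]) = X ^ q ^ i := hinj (by rw [map_pow]; exact h)
    have := congrArg natDegree h'
    rw [natDegree_X, natDegree_X_pow] at this
    exact absurd this (Nat.one_lt_pow hi.ne' hq).ne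
  let c₀ : Fin k → K := fun j => if (j : ℕ) ≤ 1 then t else 0
  have hc₀ : wordPoly c₀ = X ^ (k + 1) + C t * (X + 1) := wordPoly_special hk t
  have hDne : D ≠ 0 := by
    intro h
    refine (hD K c₀).2 ?_ (by rw [h, map_zero])
    rw [hc₀]
    exact separable_trinomial hinj
  have hRne : ∀ i, 0 < i → R i ≠ 0 := by
    intro i hi h
    refine (hR K c₀ i).2 ?_ (by rw [h, map_zero])
    have : (fun j => c₀ j ^ q ^ i) = fun j : Fin k => if (j : ℕ) ≤ 1 then t ^ q ^ i else 0 := by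
      funext j
      simp only [c₀]
      split_ifs
      · rfl
      · exact zero_pow (pow_ne_zero _ (by omega))
    rw [this, wordPoly_special hk (t ^ q ^ i), hc₀]
    exact isCoprime_trinomial (ht i hi)
  have hdeg0 : ∀ i, (P₀.coeff i).totalDegree ≤ 1 :=
    totalDegree_coeff_wordPoly_le 1 _ fun j => by simp
  refine ⟨MvPolynomial.X ⟨0, hk⟩ * D * ∏ i ∈ Finset.Icc 1 (m / 2), R i, ?_, ?_, ?_⟩
  · refine mul_ne_zero (mul_ne_zero (MvPolynomial.X_ne_zero _) hDne)
      (Finset.prod_ne_zero_iff.2 fun i hi => hRne i (Finset.mem_Icc.1 hi).1)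
  · refine (MvPolynomial.totalDegree_mul _ _).trans (Nat.add_le_add
      ((MvPolynomial.totalDegree_mul _ _).trans (Nat.add_le_add ?_ ?_)) ?_)
    · simp
    · refine (totalDegree_resultant_le _ _ _ _ 1 hdeg0 fun i => ?_).trans (by omega)
      rw [coeff_derivative]
      refine (MvPolynomial.totalDegree_mul _ _).trans ?_
      rw [show ((i : MvPolynomial (Fin k) E) + 1) = MvPolynomial.C ((i : E) + 1) by simp,
        MvPolynomial.totalDegree_C, add_zero]
      exact hdeg0 _
    · refine (MvPolynomial.totalDegree_finsetProd _ _).trans ?_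
      have h1 : ∀ i, (R i).totalDegree ≤ 2 * (k + 1) * q ^ i := by
        intro i
        refine (totalDegree_resultant_le _ _ _ _ (q ^ i)
          (fun j => (hdeg0 j).trans (Nat.one_le_pow _ _ (by omega)))
          (totalDegree_coeff_wordPoly_le _ _ fun j => ?_)).trans (by
            rw [two_mul])
        simp
      have h2 : ∀ l, ∑ i ∈ Finset.Icc 1 l, q ^ i ≤ 2 * q ^ l := by
        intro l
        induction l with
        | zero => simp
        | succ l ih =>
          rw [Finset.sum_Icc_succ_top (by omega), pow_succ]
          nlinarith [Nat.one_le_pow l q (by omega)]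
      calc _ ≤ ∑ i ∈ Finset.Icc 1 (m / 2), 2 * (k + 1) * q ^ i :=
            Finset.sum_le_sum fun i _ => h1 i
        _ = 2 * (k + 1) * ∑ i ∈ Finset.Icc 1 (m / 2), q ^ i := by rw [Finset.mul_sum]
        _ ≤ 2 * (k + 1) * (2 * q ^ (m / 2)) := Nat.mul_le_mul_left _ (h2 _)
        _ = _ := by ring
  · intro c hc
    rw [map_mul, map_mul, map_prod, MvPolynomial.aeval_X] at hc
    refine ⟨left_ne_zero_of_mul (left_ne_zero_of_mul hc),
      (hD E c).1 (right_ne_zero_of_mul (left_ne_zero_of_mul hc)), fun i hi him => ?_⟩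
    exact (hR E c i).1 (Finset.prod_ne_zero_iff.1 (right_ne_zero_of_mul hc) i
      (Finset.mem_Icc.2 ⟨hi, by omega⟩))

end GenericPolynomial

section Cyclic

open Polynomial Module
open scoped Matrix

lemma Polynomial.Separable.dvd_of_aeval_eq_zero {K : Type*} [Field K] {p f : K[X]}
    (hp : p.Separable) (h : ∀ a : AlgebraicClosure K, aeval a p = 0 → aeval a f = 0) : p ∣ f := by
  rcases eq_or_ne f 0 with rfl | hf
  · exact dvd_zero _
  rw [← Polynomial.map_dvd_map' (algebraMap K (AlgebraicClosure K)),
    IsAlgClosed.dvd_iff_roots_le_roots (map_ne_zero hp.ne_zero) (map_ne_zero hf),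
    Multiset.le_iff_subset (nodup_roots hp.map)]
  intro a ha
  rw [mem_roots (map_ne_zero hp.ne_zero), IsRoot.def, eval_map_algebraMap] at ha
  rw [mem_roots (map_ne_zero hf), IsRoot.def, eval_map_algebraMap]
  exact h a ha

lemma Matrix.charpoly_dvd_of_separable {K ι : Type*} [Field K] [Fintype ι] [DecidableEq ι]
    (M : Matrix ι ι K) (hs : M.charpoly.Separable) {f : K[X]} (hf : aeval M f = 0) :
    M.charpoly ∣ f := by
  refine hs.dvd_of_aeval_eq_zero fun a ha => ?_
  let φ := algebraMap K (AlgebraicClosure K)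
  have h1 : a ∈ spectrum (AlgebraicClosure K) (M.map φ) := by
    apply Matrix.mem_spectrum_of_isRoot_charpoly
    rw [Matrix.charpoly_map, IsRoot.def, eval_map_algebraMap]
    exact ha
  have h2 := spectrum.subset_polynomial_aeval (M.map φ) (f.map φ) ⟨a, h1, rfl⟩
  have h3 : aeval (M.map φ) (f.map φ) = 0 := by
    have h4 : aeval (M.map φ) (f.map φ) = aeval (M.map φ) f := aeval_map_algebraMap _ _ _
    have h5 : M.map φ = (Algebra.ofId K (AlgebraicClosure K)).mapMatrix M := rfl
    rw [h4, h5, aeval_algHom_apply, hf, map_zero]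
  rw [h3] at h2
  have h4 : Nontrivial (Matrix ι ι (AlgebraicClosure K)) := by
    by_contra hn
    rw [not_nontrivial_iff_subsingleton] at hn
    exact h1 (isUnit_of_subsingleton _)
  rw [spectrum.zero_eq, Set.mem_singleton_iff] at h2
  rw [← eval_map_algebraMap]
  exact h2

lemma Matrix.exists_cyclic_of_separable {K ι : Type*} [Field K] [Fintype ι] [DecidableEq ι]
    (M : Matrix ι ι K) (hs : M.charpoly.Separable) :
    ∃ v : ι → K, ∀ f : K[X], aeval M f *ᵥ v = 0 → M.charpoly ∣ f := by
  obtain ⟨x, hx⟩ := exists_ker_toSpanSingleton_eq_annihilator K[X] (AEval' M.toLin')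
  obtain ⟨x, rfl⟩ := (AEval'.of _).surjective x
  refine ⟨x, fun f hf => ?_⟩
  have h1 : ∀ v, (aeval M.toLin' f) v = aeval M f *ᵥ v := by
    intro v
    have : M.toLin' = Matrix.toLinAlgEquiv' M := rfl
    rw [this, aeval_algHom_apply (Matrix.toLinAlgEquiv' (R := K) (n := ι)) M f]
    rfl
  have h2 : f ∈ annihilator K[X] (AEval' M.toLin') := by
    rw [← hx, LinearMap.mem_ker, LinearMap.toSpanSingleton_apply]
    rw [← AEval.of_aeval_smul]
    have : (aeval M.toLin' f) • x = 0 := (h1 x).trans hf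
    rw [this, map_zero]
  apply M.charpoly_dvd_of_separable hs
  rw [← span_minpoly_eq_annihilator, Ideal.mem_span_singleton] at h2
  obtain ⟨g, rfl⟩ := h2
  apply Matrix.toLinAlgEquiv'.injective
  rw [map_zero]
  rw [← aeval_algHom_apply (Matrix.toLinAlgEquiv' (R := K) (n := ι)) M]
  change aeval M.toLin' _ = 0
  rw [map_mul, minpoly.aeval, zero_mul]

end Cyclic

section Frobenius

open Polynomial

variable {F E : Type*} [Field F] [Field E] [Algebra F E] [Fintype F] [Fintype E]

lemma natDegree_le_of_coprime_frobenius {m : ℕ}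
    (hc : Fintype.card E = Fintype.card F ^ m) {p : E[X]}
    (hp : ∀ i, 0 < i → 2 * i ≤ m →
      IsCoprime p (p.map (FiniteField.frobeniusAlgHom F E ^ i).toRingHom))
    {f : F[X]} (hf : f ≠ 0) (hdvd : p ∣ f.map (algebraMap F E)) :
    m * p.natDegree ≤ f.natDegree := by
  classical
  let σ : ℕ → E →+* E := fun i => (FiniteField.frobeniusAlgHom F E ^ i).toRingHom
  have hσ : ∀ i x, σ i x = x ^ Fintype.card F ^ i := by
    intro i
    induction i with
    | zero => intro x; simp [σ]
    | succ i ih =>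
      intro x
      have : σ (i + 1) x = σ i (x ^ Fintype.card F) := by
        change (FiniteField.frobeniusAlgHom F E ^ (i + 1)) x = _
        rw [pow_succ]
        rfl
      rw [this, ih, ← pow_mul, pow_succ']
  have hσadd : ∀ i j, (σ i).comp (σ j) = σ (j + i) := by
    intro i j
    ext x
    rw [RingHom.comp_apply, hσ, hσ, hσ, ← pow_mul, pow_add]
  have hσm : σ m = RingHom.id E := by
    ext x
    rw [hσ, ← hc, FiniteField.pow_card, RingHom.id_apply]
  have hlt : ∀ l, 0 < l → l < m → IsCoprime p (p.map (σ l)) := by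
    intro l hl hlm
    by_cases h : 2 * l ≤ m
    · exact hp l hl h
    · have h1 := (hp (m - l) (by omega) (by omega)).map (Polynomial.mapRingHom (σ l))
      change IsCoprime (p.map (σ l)) ((p.map (σ (m - l))).map (σ l)) at h1
      rw [Polynomial.map_map, hσadd, Nat.sub_add_cancel hlm.le, hσm, Polynomial.map_id] at h1
      exact h1.symm
  have hij : ∀ i j, i < j → j < m → IsCoprime (p.map (σ i)) (p.map (σ j)) := by
    intro i j hij hj
    have h1 := (hlt (j - i) (by omega) (by omega)).map (Polynomial.mapRingHom (σ i))
    change IsCoprime (p.map (σ i)) ((p.map (σ (j - i))).map (σ i)) at h1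
    rwa [Polynomial.map_map, hσadd, Nat.sub_add_cancel hij.le] at h1
  have hpair : ((Finset.range m : Finset ℕ) : Set ℕ).Pairwise
      (Function.onFun IsCoprime fun i => p.map (σ i)) := by
    intro i hi j hj hne
    have hi' := Finset.mem_range.1 hi
    have hj' := Finset.mem_range.1 hj
    rcases lt_or_gt_of_ne hne with h | h
    · exact hij i j h hj'
    · exact (hij j i h hi').symm
  have hprod : ∏ i ∈ Finset.range m, p.map (σ i) ∣ f.map (algebraMap F E) := by
    refine Finset.prod_dvd_of_coprime hpair fun i _ => ?_
    have h1 := Polynomial.map_dvd (σ i) hdvd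
    rw [Polynomial.map_map] at h1
    have : (σ i).comp (algebraMap F E) = algebraMap F E :=
      (FiniteField.frobeniusAlgHom F E ^ i).comp_algebraMap
    rwa [this] at h1
  have hf' : f.map (algebraMap F E) ≠ 0 := Polynomial.map_ne_zero hf
  have hp0 : p ≠ 0 := by
    rintro rfl
    exact hf' (zero_dvd_iff.1 hdvd)
  have := natDegree_le_of_dvd hprod hf'
  rw [natDegree_prod _ _ fun i _ => Polynomial.map_ne_zero hp0, natDegree_map] at this
  simpa using this

end Frobenius

section Centralizer

open Polynomial
open scoped Matrix

variable {F E : Type} [Field F] [Field E] [Algebra F E] {ι : Type} [Fintype ι] [DecidableEq ι]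
  {r : ℕ}

/-- A matrix over an extension field acting on the underlying vector space over the base field,
extended by a given endomorphism of a complement. -/
def blockEnd (F : Type) {E : Type} [Field F] [Field E] [Algebra F E] {ι : Type} [Fintype ι]
    {r : ℕ} (M : Matrix ι ι E) (S : Module.End F (Fin r → F)) :
    Module.End F ((ι → E) × (Fin r → F)) :=
  (M.mulVecLin.restrictScalars F).prodMap S

lemma blockEnd_apply (M : Matrix ι ι E) (S : Module.End F (Fin r → F))
    (x : (ι → E) × (Fin r → F)) : blockEnd F M S x = (M *ᵥ x.1, S x.2) := rfl

lemma blockEnd_mul (M M' : Matrix ι ι E) (S S' : Module.End F (Fin r → F)) :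
    blockEnd F (M * M') (S * S') = blockEnd F M S * blockEnd F M' S' := by
  refine LinearMap.ext fun x => ?_
  rw [Module.End.mul_apply, blockEnd_apply, blockEnd_apply, blockEnd_apply, Matrix.mulVec_mulVec]
  rfl

lemma blockEnd_one : blockEnd F (1 : Matrix ι ι E) (1 : Module.End F (Fin r → F)) = 1 := by
  refine LinearMap.ext fun x => ?_
  rw [blockEnd_apply, Matrix.one_mulVec]
  rfl

lemma blockEnd_sub_one (M : Matrix ι ι E) :
    blockEnd F M (1 : Module.End F (Fin r → F)) - 1 = blockEnd F (M - 1) 0 := by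
  refine LinearMap.ext fun x => ?_
  rw [LinearMap.sub_apply, blockEnd_apply, blockEnd_apply, Matrix.sub_mulVec, Matrix.one_mulVec]
  refine Prod.ext ?_ ?_
  · rfl
  · simp

/-- The embedding of a general linear group over an extension field into that over the base. -/
def blockHom (F E : Type) [Field F] [Field E] [Algebra F E] (ι : Type) [Fintype ι] [DecidableEq ι]
    (r : ℕ) : GL ι E →* (Module.End F ((ι → E) × (Fin r → F)))ˣ :=
  Units.map
    { toFun := fun M => blockEnd F M 1
      map_one' := blockEnd_one
      map_mul' := fun M M' => blockEnd_mul M M' 1 1 }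

lemma coe_blockHom (g : GL ι E) : (blockHom F E ι r g).1 = blockEnd F g.1 1 := rfl

lemma aeval_blockEnd (N : Matrix ι ι E) (f : F[X]) (u : ι → E) :
    aeval (blockEnd F N (0 : Module.End F (Fin r → F))) f (u, 0) =
      (aeval N (f.map (algebraMap F E)) *ᵥ u, 0) := by
  rw [aeval_map_algebraMap]
  induction f using Polynomial.induction_on' with
  | add p q hp hq =>
    rw [map_add, map_add, LinearMap.add_apply, hp, hq, Matrix.add_mulVec]
    simp
  | monomial n a =>
    rw [← C_mul_X_pow_eq_monomial, map_mul, map_mul, map_pow, map_pow, aeval_X, aeval_X,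
      aeval_C, aeval_C, Algebra.algebraMap_eq_smul_one, Algebra.algebraMap_eq_smul_one,
      smul_mul_assoc, smul_mul_assoc, one_mul, one_mul, LinearMap.smul_apply, Matrix.smul_mulVec]
    have : ∀ n, (blockEnd F N (0 : Module.End F (Fin r → F)) ^ n) (u, 0) = (N ^ n *ᵥ u, 0) := by
      intro n
      induction n with
      | zero => simp
      | succ n ih =>
        rw [pow_succ', Module.End.mul_apply, ih, blockEnd_apply, pow_succ', Matrix.mulVec_mulVec]
        simp
    rw [this]
    simp

variable [Fintype F] [Fintype E]

/-- The charpoly has degree the size, vanishes nowhere at the origin, is separable, and is coprime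
to its Frobenius twists. -/
structure IsGenericShift (F : Type) {E : Type} [Field F] [Field E] [Algebra F E] [Fintype F]
    [Fintype E] {ι : Type} [Fintype ι] [DecidableEq ι] (N : Matrix ι ι E) (m : ℕ) : Prop where
  separable : N.charpoly.Separable
  coeff_zero : N.charpoly.coeff 0 ≠ 0
  isCoprime : ∀ i, 0 < i → 2 * i ≤ m →
      IsCoprime N.charpoly (N.charpoly.map (FiniteField.frobeniusAlgHom F E ^ i).toRingHom)

lemma IsGenericShift.exists_cyclic {m : ℕ} (hc : Fintype.card E = Fintype.card F ^ m)
    {N : Matrix ι ι E} (hN : IsGenericShift F N m) :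
    ∃ v : ι → E, (∀ f : E[X], aeval N f *ᵥ v = 0 → N.charpoly ∣ f) ∧
      ∀ u : ι → E, ∃ f : F[X], aeval N (f.map (algebraMap F E)) *ᵥ v = u := by
  obtain ⟨v, hv⟩ := N.exists_cyclic_of_separable hN.separable
  refine ⟨v, hv, ?_⟩
  let φ : F[X] →ₗ[F] (ι → E) :=
    { toFun := fun f => aeval N (f.map (algebraMap F E)) *ᵥ v
      map_add' := fun f g => by rw [Polynomial.map_add, map_add, Matrix.add_mulVec]
      map_smul' := fun a f => by
        rw [aeval_map_algebraMap, aeval_map_algebraMap, map_smul, Matrix.smul_mulVec]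
        rfl }
  let ψ := φ ∘ₗ (degreeLT F (m * Fintype.card ι)).subtype
  have hinj : Function.Injective ψ := by
    rw [← LinearMap.ker_eq_bot, LinearMap.ker_eq_bot']
    intro f hf
    by_contra hne
    have h0 : f.1 ≠ 0 := fun h => hne (Subtype.ext h)
    have h1 := natDegree_le_of_coprime_frobenius hc hN.isCoprime h0 (hv _ hf)
    rw [Matrix.charpoly_natDegree_eq_dim] at h1
    have h2 := mem_degreeLT.1 f.2
    rw [degree_eq_natDegree h0, Nat.cast_lt] at h2
    omega
  have hfin : Module.finrank F (degreeLT F (m * Fintype.card ι)) = Module.finrank F (ι → E) := by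
    rw [(degreeLTEquiv F _).finrank_eq, Module.finrank_fin_fun, Module.finrank_pi_fintype]
    have : Module.finrank F E = m := by
      have := Module.card_eq_pow_finrank (K := F) (V := E)
      rw [hc] at this
      exact (Nat.pow_right_injective Fintype.one_lt_card this).symm
    simp [this, mul_comm]
  have : FiniteDimensional F (degreeLT F (m * Fintype.card ι)) :=
    (degreeLTEquiv F _).symm.finiteDimensional
  have hsurj := (LinearMap.injective_iff_surjective_of_finrank_eq_finrank hfin).1 hinj
  intro u
  obtain ⟨f, hf⟩ := hsurj u
  exact ⟨f.1, hf⟩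

lemma IsGenericShift.card_centralizer_le {m : ℕ} (hc : Fintype.card E = Fintype.card F ^ m)
    {N : Matrix ι ι E} (hN : IsGenericShift F N m) :
    Nat.card {X : Module.End F ((ι → E) × (Fin r → F)) // Commute X (blockEnd F N 0)} ≤
      Fintype.card F ^ (m * Fintype.card ι + r + r * r) := by
  obtain ⟨v, -, hv⟩ := hN.exists_cyclic hc
  let Φ : {X : Module.End F ((ι → E) × (Fin r → F)) // Commute X (blockEnd F N 0)} →
      ((ι → E) × (Fin r → F)) × (Fin r → Fin r → F) :=
    fun X => (X.1 (v, 0), fun i => (X.1 (0, Pi.single i 1)).2)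
  have hdet : N.det ≠ 0 := by
    have := N.det_eq_sign_charpoly_coeff
    rw [this]
    exact mul_ne_zero (pow_ne_zero _ (neg_ne_zero.2 one_ne_zero)) hN.coeff_zero
  have hker : ∀ (X : Module.End F ((ι → E) × (Fin r → F))), Commute X (blockEnd F N 0) →
      ∀ y, (X (0, y)).1 = 0 := by
    intro X hX y
    have h1 := LinearMap.congr_fun hX.eq (0, y)
    rw [Module.End.mul_apply, Module.End.mul_apply, blockEnd_apply, blockEnd_apply] at h1
    simp only [Matrix.mulVec_zero, LinearMap.zero_apply] at h1
    have h2 := congrArg Prod.fst h1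
    rw [show ((0 : ι → E), (0 : Fin r → F)) = 0 from rfl, map_zero] at h2
    exact Matrix.eq_zero_of_mulVec_eq_zero hdet h2.symm
  have hΦ : Function.Injective Φ := by
    intro X Y h
    have h1 : X.1 (v, 0) = Y.1 (v, 0) := congrArg Prod.fst h
    have h2 : ∀ i, (X.1 (0, Pi.single i 1)).2 = (Y.1 (0, Pi.single i 1)).2 :=
      fun i => congrFun (congrArg Prod.snd h) i
    apply Subtype.ext
    apply LinearMap.prod_ext
    · refine LinearMap.ext fun u => ?_
      obtain ⟨f, rfl⟩ := hv u
      have hcom : ∀ Z : Module.End F ((ι → E) × (Fin r → F)), Commute Z (blockEnd F N 0) →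
          Z (aeval N (f.map (algebraMap F E)) *ᵥ v, 0) = aeval (blockEnd F N 0) f (Z (v, 0)) := by
        intro Z hZ
        rw [← aeval_blockEnd (r := r), ← Module.End.mul_apply, ← Module.End.mul_apply]
        refine LinearMap.congr_fun (Commute.eq ?_) _
        rw [aeval_eq_sum_range]
        exact Commute.sum_right _ _ _ fun i _ => (hZ.pow_right i).smul_right _
      exact (hcom _ X.2).trans ((congrArg _ h1).trans (hcom _ Y.2).symm)
    · refine LinearMap.pi_ext' fun i => LinearMap.ext_ring ?_
      change X.1 (0, Pi.single i 1) = Y.1 (0, Pi.single i 1)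
      exact Prod.ext ((hker _ X.2 _).trans (hker _ Y.2 _).symm) (h2 i)
  refine (Nat.card_le_card_of_injective Φ hΦ).trans ?_
  rw [Nat.card_eq_fintype_card]
  simp only [Fintype.card_prod, Fintype.card_pi, Finset.prod_const, Finset.card_univ,
    Fintype.card_fin, hc]
  rw [pow_add, pow_add, pow_mul, pow_mul]

end Centralizer

section DoubleCounting

open Polynomial

lemma card_monic_dvd_le {E : Type} [Field E] {P : E[X]} (hP : P ≠ 0) (l : ℕ) :
    Finite {f : E[X] // f.Monic ∧ f.natDegree = l ∧ f ∣ P} ∧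
    Nat.card {f : E[X] // f.Monic ∧ f.natDegree = l ∧ f ∣ P} ≤ P.natDegree ^ l := by
  classical
  let φ := algebraMap E (AlgebraicClosure E)
  let R := (P.map φ).roots
  have hroot : ∀ f : {f : E[X] // f.Monic ∧ f.natDegree = l ∧ f ∣ P},
      (f.1.map φ).roots ∈ (R.powersetCard l).toFinset := by
    intro ⟨f, hm, hd, hdvd⟩
    rw [Multiset.mem_toFinset, Multiset.mem_powersetCard]
    refine ⟨roots.le_of_dvd (map_ne_zero hP) (map_dvd φ hdvd), ?_⟩
    rw [← (IsAlgClosed.splits _).natDegree_eq_card_roots, natDegree_map, hd]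
  let Φ : {f : E[X] // f.Monic ∧ f.natDegree = l ∧ f ∣ P} → (R.powersetCard l).toFinset :=
    fun f => ⟨(f.1.map φ).roots, hroot f⟩
  have hΦ : Function.Injective Φ := by
    intro f g h
    have h1 : (f.1.map φ).roots = (g.1.map φ).roots := congrArg Subtype.val h
    apply Subtype.ext
    apply map_injective φ φ.injective
    rw [(IsAlgClosed.splits _).eq_prod_roots_of_monic (f.2.1.map φ), h1,
      ← (IsAlgClosed.splits _).eq_prod_roots_of_monic (g.2.1.map φ)]
  refine ⟨Finite.of_injective Φ hΦ, (Nat.card_le_card_of_injective Φ hΦ).trans ?_⟩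
  rw [Nat.card_eq_fintype_card, Fintype.card_coe]
  refine (Multiset.toFinset_card_le _).trans ?_
  rw [Multiset.card_powersetCard]
  have : Multiset.card R ≤ P.natDegree := (card_roots' _).trans (natDegree_map _).le
  exact (Nat.choose_le_choose l this).trans (Nat.choose_le_pow _ _)

lemma card_mul_card_le_of_conj {S G : Type} [Finite S] [Group G] [Finite G] (h : S → G)
    (Y : Set G) (hY : ∀ c x, x * h c * x⁻¹ ∈ Y) (a b : ℕ)
    (ha : ∀ y, Nat.card {c : S // IsConj (h c) y} ≤ a)
    (hb : ∀ c, Nat.card {x : G // Commute x (h c)} ≤ b) :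
    Nat.card S * Nat.card G ≤ Nat.card Y * (a * b) := by
  classical
  have := Fintype.ofFinite S
  have := Fintype.ofFinite G
  have := Fintype.ofFinite Y
  simp only [Nat.card_eq_fintype_card] at *
  rw [← Fintype.card_prod, ← Finset.card_univ, ← Set.toFinset_card Y, mul_comm]
  refine Finset.card_le_mul_card_image_of_maps_to (f := fun p : S × G => p.2 * h p.1 * p.2⁻¹)
    (fun p _ => Set.mem_toFinset.2 (hY _ _)) _ fun y _ => ?_
  have h1 : (Finset.univ.filter fun p : S × G => p.2 * h p.1 * p.2⁻¹ = y) ⊆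
      ((Finset.univ.filter fun c : S => IsConj (h c) y).sigma
        (fun c => Finset.univ.filter fun x : G => x * h c * x⁻¹ = y)).map
        (Equiv.sigmaEquivProd S G).toEmbedding := by
    intro p hp
    rw [Finset.mem_filter] at hp
    rw [Finset.mem_map]
    refine ⟨⟨p.1, p.2⟩, ?_, rfl⟩
    simp only [Finset.mem_sigma, Finset.mem_filter, Finset.mem_univ, true_and]
    exact ⟨isConj_iff.2 ⟨p.2, hp.2⟩, hp.2⟩
  refine (Finset.card_le_card h1).trans ?_
  rw [Finset.card_map, Finset.card_sigma]
  refine (Finset.sum_le_card_nsmul _ _ b ?_).trans ?_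
  · intro c _
    rcases (Finset.univ.filter fun x : G => x * h c * x⁻¹ = y).eq_empty_or_nonempty with he | ⟨z, hz⟩
    · simp [he]
    · rw [Finset.mem_filter] at hz
      refine le_trans ?_ (hb c)
      rw [Fintype.card_subtype]
      refine Finset.card_le_card_of_injOn (fun x => z⁻¹ * x) ?_ ?_
      · intro x hx
        have hx' : x * h c * x⁻¹ = y := by simpa using hx
        simp only [Finset.coe_filter, Finset.mem_univ, true_and, Set.mem_ofPred_eq]
        have h2 : x * h c * x⁻¹ = z * h c * z⁻¹ := hx'.trans hz.2.symm
        change z⁻¹ * x * h c = h c * (z⁻¹ * x)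
        calc z⁻¹ * x * h c = z⁻¹ * (x * h c * x⁻¹) * x := by group
          _ = h c * (z⁻¹ * x) := by rw [h2]; group
      · intro x _ x' _ hxx
        exact mul_left_cancel hxx
  · rw [smul_eq_mul]
    refine Nat.mul_le_mul_right _ ?_
    rw [← Fintype.card_subtype]
    exact ha y

lemma SemiconjBy.aeval_right {R A : Type*} [CommRing R] [Ring A] [Algebra R A] {x a b : A}
    (h : SemiconjBy x a b) (f : R[X]) : SemiconjBy x (aeval a f) (aeval b f) := by
  induction f using Polynomial.induction_on' with
  | add p q hp hq => rw [map_add, map_add]; exact hp.add_right hq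
  | monomial n c =>
    rw [aeval_monomial, aeval_monomial]
    exact SemiconjBy.mul_right (Algebra.commutes c x).symm (h.pow_right n)

end DoubleCounting

section ClassCount

open Polynomial
open scoped Matrix

variable {d : ℕ} (w : FreeGroup (Fin d)) {k m r : ℕ}

lemma commWord_of_comm {G : Type*} [CommGroup G] (A : Fin d × Bool → G) : commWord w A = 1 := by
  rw [commWord]
  have : (fun i => ⁅A (i, true), A (i, false)⁆) = fun _ : Fin d => (1 : G) := by
    funext i
    rw [commutatorElement_eq_one_iff_mul_comm, mul_comm]
  rw [this]
  have h2 : FreeGroup.lift (fun _ : Fin d => (1 : G)) = 1 := by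
    ext i
    simp
  rw [h2, MonoidHom.one_apply]

lemma det_commWord {ι K : Type*} [Fintype ι] [DecidableEq ι] [CommRing K]
    (A : Fin d × Bool → GL ι K) : (commWord w A).1.det = 1 := by
  have h := map_commWord w Matrix.GeneralLinearGroup.det A
  rw [commWord_of_comm] at h
  exact congrArg Units.val h

lemma charpoly_commWord_sub_one {K : Type} [CommRing K] [Nontrivial K]
    (A : Fin d × Bool → GL (Fin (k + 1)) K) :
    ((commWord w A).1 - 1).charpoly = wordPoly (wordCoeff w A) :=
  charpoly_sub_one_eq_wordPoly _ (det_commWord w A)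

lemma conj_commWord {G : Type*} [Group G] (A : Fin d × Bool → G) (x : G) :
    x * commWord w A * x⁻¹ = commWord w fun l => x * A l * x⁻¹ :=
  map_commWord w (MulAut.conj x).toMonoidHom A

lemma frobeniusAlgHom_pow_apply (F : Type*) {E : Type*} [Field F] [Field E] [Algebra F E]
    [Fintype F] (i : ℕ) (x : E) :
    (FiniteField.frobeniusAlgHom F E ^ i) x = x ^ Fintype.card F ^ i := by
  induction i generalizing x with
  | zero => simp
  | succ i ih =>
    rw [pow_succ, AlgHom.mul_apply, ih, pow_succ', pow_mul]
    rfl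

variable {F E : Type} [Field F] [Field E] [Algebra F E] [Fintype F] [Fintype E]

lemma isGenericShift_of_wordPoly (hk : 0 < k) {N : Matrix (Fin (k + 1)) (Fin (k + 1)) E}
    {c : Fin k → E} (hN : N.charpoly = wordPoly c) (h0 : c ⟨0, hk⟩ ≠ 0)
    (hs : (wordPoly c).Separable)
    (hf : ∀ i, 0 < i → 2 * i ≤ m →
      IsCoprime (wordPoly c) (wordPoly fun j => c j ^ Fintype.card F ^ i)) :
    IsGenericShift F N m where
  separable := hN ▸ hs
  coeff_zero := by
    rw [hN]
    have := coeff_wordPoly c ⟨0, hk⟩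
    exact fun h => h0 (this.symm.trans h)
  isCoprime := by
    intro i hi him
    rw [hN, wordPoly_map]
    have : (fun j => (FiniteField.frobeniusAlgHom F E ^ i).toRingHom (c j)) =
        fun j => c j ^ Fintype.card F ^ i := funext fun j => frobeniusAlgHom_pow_apply F i (c j)
    rw [this]
    exact hf i hi him

lemma wordPoly_injective : Function.Injective (wordPoly : (Fin k → E) → E[X]) := by
  intro c c' h
  funext j
  rw [← coeff_wordPoly c, h, coeff_wordPoly]

lemma card_mul_card_units_le (hk : 0 < k) (hc : Fintype.card E = Fintype.card F ^ m)
    (S : Set (Fin k → E))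
    (hS : ∀ c ∈ S, c ⟨0, hk⟩ ≠ 0 ∧ (wordPoly c).Separable ∧ ∀ i, 0 < i → 2 * i ≤ m →
      IsCoprime (wordPoly c) (wordPoly fun j => c j ^ Fintype.card F ^ i))
    (hA : ∀ c ∈ S, ∃ A : Fin d × Bool → GL (Fin (k + 1)) E, wordCoeff w A = c) :
    Nat.card S * Nat.card (Module.End F ((Fin (k + 1) → E) × (Fin r → F)))ˣ ≤
      Nat.card (Set.range fun A : Fin d × Bool →
        (Module.End F ((Fin (k + 1) → E) × (Fin r → F)))ˣ => commWord w A) *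
      ((m * (k + 1) + r) ^ (k + 1) * Fintype.card F ^ (m * (k + 1) + r + r * r)) := by
  choose! A hA using hA
  let V := (Fin (k + 1) → E) × (Fin r → F)
  have : Finite (Module.End F V) := Module.finite_of_finite F
  have hfin : Module.finrank F V = m * (k + 1) + r := by
    have h1 : Module.finrank F E = m := by
      have := Module.card_eq_pow_finrank (K := F) (V := E)
      rw [hc] at this
      exact (Nat.pow_right_injective Fintype.one_lt_card this).symm
    change Module.finrank F ((Fin (k + 1) → E) × (Fin r → F)) = _
    rw [Module.finrank_prod, Module.finrank_pi_fintype, Module.finrank_fin_fun]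
    simp [h1, mul_comm]
  let h : S → (Module.End F V)ˣ := fun c => blockHom F E (Fin (k + 1)) r (commWord w (A c))
  have hgen : ∀ c : S, ((commWord w (A c)).1 - 1).charpoly = wordPoly c.1 ∧
      IsGenericShift F ((commWord w (A c)).1 - 1) m := by
    intro c
    have h1 : ((commWord w (A c)).1 - 1).charpoly = wordPoly c.1 := by
      rw [charpoly_commWord_sub_one, hA c.1 c.2]
    obtain ⟨h2, h3, h4⟩ := hS c.1 c.2
    exact ⟨h1, isGenericShift_of_wordPoly hk h1 h2 h3 h4⟩
  refine card_mul_card_le_of_conj h _ ?_ _ _ ?_ ?_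
  · intro c x
    have h1 := map_commWord w (blockHom F E (Fin (k + 1)) r) (A c)
    refine ⟨fun l => x * blockHom F E (Fin (k + 1)) r (A c l) * x⁻¹, ?_⟩
    change commWord w _ = _
    rw [← conj_commWord]
    congr 2
    exact h1.symm
  · intro y
    let χ : F[X] := LinearMap.charpoly (y.1 - 1)
    have hχ0 : χ ≠ 0 := (LinearMap.charpoly_monic _).ne_zero
    have hP0 : χ.map (algebraMap F E) ≠ 0 := map_ne_zero hχ0
    have hdeg : (χ.map (algebraMap F E)).natDegree = m * (k + 1) + r := by
      rw [natDegree_map, ← hfin]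
      exact LinearMap.charpoly_natDegree _
    obtain ⟨hfinite, hcard⟩ := card_monic_dvd_le hP0 (k + 1)
    rw [hdeg] at hcard
    refine le_trans ?_ hcard
    have key : ∀ c : {c : S // IsConj (h c) y}, wordPoly c.1.1 ∣ χ.map (algebraMap F E) := by
      intro c
      obtain ⟨x, hx⟩ := isConj_iff.1 c.2
      obtain ⟨hp, hg⟩ := hgen c.1
      have h1 : SemiconjBy x.1 ((h c.1).1 - 1) (y.1 - 1) := by
        have h2 : SemiconjBy x (h c.1) y := by
          exact (mul_inv_eq_iff_eq_mul.1 hx)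
        have h3 : SemiconjBy x.1 (h c.1).1 y.1 := congrArg Units.val h2
        exact h3.sub_right (SemiconjBy.one_right _)
      have h2 := h1.aeval_right χ
      have h3 : aeval (y.1 - 1) χ = 0 := LinearMap.aeval_self_charpoly _
      rw [h3, SemiconjBy, zero_mul] at h2
      have h4 : aeval ((h c.1).1 - 1) χ = 0 := x.isUnit.mul_right_eq_zero.1 h2
      rw [coe_blockHom, blockEnd_sub_one] at h4
      obtain ⟨v, hv, -⟩ := hg.exists_cyclic hc
      rw [← hp]
      apply hv
      have h5 := aeval_blockEnd (r := r) ((commWord w (A c.1)).1 - 1) χ v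
      rw [h4] at h5
      exact (congrArg Prod.fst h5).symm
    refine Nat.card_le_card_of_injective
      (fun c => ⟨wordPoly c.1.1, wordPoly_monic _, natDegree_wordPoly _, key c⟩) ?_
    intro c c' hcc
    exact Subtype.ext (Subtype.ext (wordPoly_injective (congrArg Subtype.val hcc)))
  · intro c
    have h1 := (hgen c).2.card_centralizer_le (r := r) hc
    rw [Fintype.card_fin] at h1
    have hcomm : ∀ x : {x // Commute x (h c)},
        Commute x.1.1 (blockEnd F ((commWord w (A c)).1 - 1) 0) := by
      intro x
      have h2 : Commute x.1.1 (h c).1 := congrArg Units.val x.2.eq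
      rw [← blockEnd_sub_one]
      exact h2.sub_right (Commute.one_right _)
    refine le_trans (Nat.card_le_card_of_injective (fun x => ⟨x.1.1, hcomm x⟩) ?_) h1
    intro x x' hxx
    exact Subtype.ext (Units.ext (congrArg Subtype.val hxx))

end ClassCount

section ClassCountFinal

open Polynomial

variable {d : ℕ} {w : FreeGroup (Fin d)} {k : ℕ}

lemma card_range_commWord_congr (w : FreeGroup (Fin d)) {G H : Type*} [Group G] [Group H]
    (e : G ≃* H) :
    Nat.card (Set.range fun A : Fin d × Bool → G => commWord w A) =
      Nat.card (Set.range fun A : Fin d × Bool → H => commWord w A) := by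
  have : (Set.range fun A : Fin d × Bool → H => commWord w A) =
      e '' Set.range fun A : Fin d × Bool → G => commWord w A := by
    ext y
    constructor
    · rintro ⟨A, rfl⟩
      refine ⟨commWord w fun l => e.symm (A l), ⟨_, rfl⟩, ?_⟩
      have := map_commWord w e.toMonoidHom fun l => e.symm (A l)
      simpa using this
    · rintro ⟨_, ⟨A, rfl⟩, rfl⟩
      exact ⟨fun l => e (A l), (map_commWord w e.toMonoidHom A).symm⟩
  rw [this]
  exact (Nat.card_image_of_injective e.injective _).symm

/-- Word values of products of commutators make up a large proportion of a general linear group. -/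
theorem exists_card_le_card_commWord (hw : w ≠ 1) (hk : 0 < k) :
    ∃ C : ℕ, 0 < C ∧ ∀ (F : Type) [Field F] [Fintype F] (m r n : ℕ), 0 < m →
      n = m * (k + 1) + r → C ≤ Fintype.card F ^ m →
      Fintype.card F ^ (m * k) * Nat.card (GL (Fin n) F) ≤
        C * (n ^ (k + 1) * Fintype.card F ^ (n + r * r)) *
          Nat.card (Set.range fun A : Fin d × Bool → GL (Fin n) F => commWord w A) := by
  obtain ⟨e, he⟩ := exists_pow_le_card_wordCoeff hw k
  set a := (6 * k + 8) * e with ha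
  set l := 4 * k * e + 4 with hl
  refine ⟨l ^ k + 4 * (a + 1) ^ 2, by positivity, fun F _ _ m r n hm hn hC => ?_⟩
  set q := Fintype.card F with hq
  have hq2 : 2 ≤ q := Fintype.one_lt_card
  obtain ⟨p, hp⟩ := CharP.exists F
  have : Fact p.Prime := ⟨CharP.char_is_prime F p⟩
  have : NeZero m := ⟨hm.ne'⟩
  let E := FiniteField.Extension F p m
  have : Finite E := Module.finite_of_finite F
  let _ : Fintype E := Fintype.ofFinite E
  have hcE : Fintype.card E = q ^ m := by
    rw [← Nat.card_eq_fintype_card, FiniteField.natCard_extension, Nat.card_eq_fintype_card]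
  obtain ⟨H, hH0, hdeg, hH⟩ := exists_generic_wordPoly (E := E) hk q m hq2
  set s := q ^ (m / 2) with hs
  set Q := q ^ m with hQ
  have hs1 : 1 ≤ s := Nat.one_le_pow _ _ (by omega)
  have hsQ : s * s ≤ Q := by
    rw [hs, hQ, ← pow_add]
    exact Nat.pow_le_pow_right (by omega) (by omega)
  have hQa : 4 * (a + 1) ^ 2 ≤ Q := le_trans (Nat.le_add_left _ _) hC
  have hsa : 2 * (a * s) ≤ Q := by
    have h1 : (2 * (a * s)) ^ 2 ≤ Q ^ 2 := by nlinarith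
    exact (Nat.pow_le_pow_iff_left two_ne_zero).1 h1
  have hb : (k * (Q / l) + H.totalDegree) * e + e < Fintype.card E := by
    rw [hcE]
    have h1 : Q / l * l ≤ Q := Nat.div_mul_le_self _ _
    have h2 : H.totalDegree * e + e ≤ a * s := by
      have : (H.totalDegree + 1) ≤ (6 * k + 8) * s := by nlinarith
      calc H.totalDegree * e + e = (H.totalDegree + 1) * e := by ring
        _ ≤ ((6 * k + 8) * s) * e := Nat.mul_le_mul_right _ this
        _ = a * s := by rw [ha]; ring
    have h3 : 4 * (k * (Q / l) * e) ≤ Q := by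
      refine le_trans ?_ h1
      rw [hl]; ring_nf; omega
    have hQ0 : 0 < Q := by positivity
    have h4 : (k * (Q / l) + H.totalDegree) * e + e =
      k * (Q / l) * e + (H.totalDegree * e + e) := by ring
    rw [h4]; omega
  have hcount := he E H hH0 (Q / l) hb
  set S : Set (Fin k → E) := {c | MvPolynomial.aeval c H ≠ 0 ∧
    ∃ A : Fin d × Bool → GL (Fin (k + 1)) E, wordCoeff w A = c} with hS
  have hmain := card_mul_card_units_le (r := r) w hk hcE S (fun c hc => hH c hc.1)
    fun c hc => hc.2
  let V := (Fin (k + 1) → E) × (Fin r → F)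
  have hfin : Module.finrank F V = n := by
    change Module.finrank F ((Fin (k + 1) → E) × (Fin r → F)) = _
    rw [Module.finrank_prod, Module.finrank_pi_fintype, Module.finrank_fin_fun]
    have : Module.finrank F E = m := FiniteField.finrank_extension F p m
    simp [this, hn, mul_comm]
  let ε : (Module.End F V)ˣ ≃* GL (Fin n) F :=
    Units.mapEquiv (LinearMap.toMatrixAlgEquiv (Module.finBasisOfFinrankEq F V hfin)).toMulEquiv
  rw [card_range_commWord_congr w ε, Nat.card_congr ε.toEquiv, ← hn] at hmain
  have hQl : Q ≤ l * (Q / l + 1) := by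
    have := Nat.lt_div_mul_add (a := Q) (b := l) (by omega)
    nlinarith
  have hQS : Q ^ k ≤ l ^ k * Nat.card S :=
    calc Q ^ k ≤ (l * (Q / l + 1)) ^ k := Nat.pow_le_pow_left hQl k
      _ = l ^ k * (Q / l + 1) ^ k := mul_pow _ _ _
      _ ≤ l ^ k * Nat.card S := Nat.mul_le_mul_left _ hcount
  rw [pow_mul]
  calc Q ^ k * Nat.card (GL (Fin n) F) ≤ l ^ k * Nat.card S * Nat.card (GL (Fin n) F) :=
        Nat.mul_le_mul_right _ hQS
    _ = l ^ k * (Nat.card S * Nat.card (GL (Fin n) F)) := by ring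
    _ ≤ (l ^ k + 4 * (a + 1) ^ 2) * _ := Nat.mul_le_mul (Nat.le_add_right _ _) hmain
    _ = _ := by ring

end ClassCountFinal

section ProjectiveSpecialLinear

open Matrix

variable {n : ℕ} {F : Type} [Field F] [Fintype F]

lemma card_sub_one_mul_card_specialLinearGroup_le (hn : 0 < n) :
    (Fintype.card F - 1) * Nat.card (SpecialLinearGroup (Fin n) F) ≤ Nat.card (GL (Fin n) F) := by
  classical
  have hdet : ∀ u : Fˣ, ∃ g : GL (Fin n) F, g.det = u := fun u => by
    have h : (diagonal (Function.update 1 ⟨0, hn⟩ u.1) : Matrix (Fin n) (Fin n) F).det = u := by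
      rw [det_diagonal, Finset.prod_update_of_mem (Finset.mem_univ _)]
      simp
    exact ⟨GeneralLinearGroup.mkOfDetNeZero _ (h.trans_ne u.ne_zero), Units.ext h⟩
  choose D hD using hdet
  have hinj : Function.Injective fun x : Fˣ × SpecialLinearGroup (Fin n) F =>
      D x.1 * SpecialLinearGroup.toGL x.2 := by
    rintro ⟨u, g⟩ ⟨v, h⟩ he
    have h1 : ∀ g : SpecialLinearGroup (Fin n) F, (SpecialLinearGroup.toGL g).det = 1 := fun g =>
      Units.ext g.2
    have h2 := congrArg GeneralLinearGroup.det he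
    simp only [map_mul, hD, h1, mul_one] at h2
    subst h2
    have h3 := (SpecialLinearGroup.toGL_inj _ _).1 (mul_left_cancel he)
    exact Prod.ext rfl h3
  have := Nat.card_le_card_of_injective _ hinj
  rwa [Nat.card_prod, Nat.card_eq_fintype_card (α := Fˣ), Fintype.card_units] at this

lemma card_range_commWord_mul_le {d : ℕ} (w : FreeGroup (Fin d)) :
    Nat.card (Set.range fun A : Fin d × Bool → GL (Fin n) F => commWord w A) *
        Nat.card (ProjectiveSpecialLinearGroup (Fin n) F) ≤
      Nat.card (Set.range fun f : Fin d → ProjectiveSpecialLinearGroup (Fin n) F =>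
        FreeGroup.lift f w) * Nat.card (SpecialLinearGroup (Fin n) F) := by
  set R := Set.range fun f : Fin d → ProjectiveSpecialLinearGroup (Fin n) F => FreeGroup.lift f w
  let Z := Subgroup.center (SpecialLinearGroup (Fin n) F)
  have hsub : (Set.range fun A : Fin d × Bool → GL (Fin n) F => commWord w A) ⊆
      SpecialLinearGroup.toGL '' (QuotientGroup.mk (s := Z) ⁻¹' R) := by
    rintro _ ⟨A, rfl⟩
    have hf : ∀ i, ∃ g : SpecialLinearGroup (Fin n) F,
        SpecialLinearGroup.toGL g = ⁅A (i, true), A (i, false)⁆ := fun i => by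
      have h : (⁅A (i, true), A (i, false)⁆ : GL (Fin n) F).det = 1 := by
        rw [map_commutatorElement, commutatorElement_eq_one_iff_mul_comm, mul_comm]
      exact ⟨⟨_, congrArg Units.val h⟩, Units.ext rfl⟩
    choose f hf using hf
    refine ⟨FreeGroup.lift f w, ⟨fun i => QuotientGroup.mk' Z (f i), ?_⟩, ?_⟩
    · have : (QuotientGroup.mk' Z).comp (FreeGroup.lift f) =
          FreeGroup.lift fun i => QuotientGroup.mk' Z (f i) := by ext; simp
      exact (DFunLike.congr_fun this w).symm
    · have : SpecialLinearGroup.toGL.comp (FreeGroup.lift f) =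
          FreeGroup.lift fun i => ⁅A (i, true), A (i, false)⁆ := by ext1 i; simp [hf]
      exact DFunLike.congr_fun this w
  have h1 := (Nat.card_mono (Set.toFinite _) hsub).trans (Nat.card_image_le (Set.toFinite _))
  rw [Nat.card_congr (QuotientGroup.preimageMkEquivSubgroupProdSet Z R), Nat.card_prod] at h1
  rw [Subgroup.card_eq_card_quotient_mul_card_subgroup Z]
  calc _ ≤ Nat.card Z * Nat.card R * Nat.card (ProjectiveSpecialLinearGroup (Fin n) F) :=
        Nat.mul_le_mul_right _ h1
    _ = _ := by ring

lemma card_projectiveSpecialLinearGroup_le :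
    Nat.card (ProjectiveSpecialLinearGroup (Fin n) F) ≤ Fintype.card F ^ (n * n) := by
  classical
  calc Nat.card (ProjectiveSpecialLinearGroup (Fin n) F)
      ≤ Nat.card (SpecialLinearGroup (Fin n) F) :=
        Nat.card_le_card_of_surjective _ Quotient.mk_surjective
    _ ≤ Nat.card (Matrix (Fin n) (Fin n) F) :=
        Nat.card_le_card_of_injective _ Subtype.val_injective
    _ = Fintype.card F ^ (n * n) := by
        simp [Matrix, pow_mul]

lemma exists_card_mul_le_card_range {d : ℕ} {w : FreeGroup (Fin d)} {k : ℕ} (hw : w ≠ 1)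
    (hk : 0 < k) : ∃ C : ℕ, 0 < C ∧ ∀ (F : Type) [Field F] [Fintype F] (m r n : ℕ), 0 < m →
      n = m * (k + 1) + r → C ≤ Fintype.card F ^ m →
      Fintype.card F ^ (m * k) * (Fintype.card F - 1) *
          Nat.card (ProjectiveSpecialLinearGroup (Fin n) F) ≤
        C * (n ^ (k + 1) * Fintype.card F ^ (n + r * r)) *
          Nat.card (Set.range fun f : Fin d → ProjectiveSpecialLinearGroup (Fin n) F =>
            FreeGroup.lift f w) := by
  obtain ⟨C, hC0, hC⟩ := exists_card_le_card_commWord hw hk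
  refine ⟨C, hC0, fun F _ _ m r n hm hn hCq => ?_⟩
  have h1 := hC F m r n hm hn hCq
  have h2 := card_sub_one_mul_card_specialLinearGroup_le (n := n) (F := F) (by rw [hn]; positivity)
  have h3 := card_range_commWord_mul_le (n := n) (F := F) w
  refine Nat.le_of_mul_le_mul_right ?_
    (Nat.card_pos (α := SpecialLinearGroup (Fin n) F))
  set q := Fintype.card F
  set P := Nat.card (ProjectiveSpecialLinearGroup (Fin n) F)
  set S := Nat.card (SpecialLinearGroup (Fin n) F)
  calc q ^ (m * k) * (q - 1) * P * S = q ^ (m * k) * ((q - 1) * S) * P := by ring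
    _ ≤ q ^ (m * k) * Nat.card (GL (Fin n) F) * P := by gcongr
    _ ≤ _ := Nat.mul_le_mul_right _ h1
    _ = C * (n ^ (k + 1) * q ^ (n + r * r)) * (_ * P) := by rw [mul_assoc]
    _ ≤ C * (n ^ (k + 1) * q ^ (n + r * r)) * (_ * S) := Nat.mul_le_mul_left _ h3
    _ = _ := by ring

lemma mul_mul_eq_univ_of_card_lt {D : ℝ} (hD0 : 0 < D)
    (hD : D ≤ (Fintype.card F : ℝ) ^ (n - 2) ∨ D ≤ ((Fintype.card F : ℝ) - 1) / 2)
    (W : Set (ProjectiveSpecialLinearGroup (Fin n) F))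
    (hW : (Nat.card (ProjectiveSpecialLinearGroup (Fin n) F) : ℝ) ^ 3 <
      D * (Nat.card W : ℝ) ^ 3) : W * W * W = Set.univ := by
  classical
  let _ := Fintype.ofFinite (ProjectiveSpecialLinearGroup (Fin n) F)
  refine Set.eq_univ_of_forall fun x => ?_
  have hcard : (Nat.card W : ℝ) = W.toFinset.card := by
    rw [Set.toFinset_card, Nat.card_eq_fintype_card]
  rw [hcard, Nat.card_eq_fintype_card, pow_succ (W.toFinset.card : ℝ), sq] at hW
  have hrep : ∀ (V : Type) [AddCommGroup V] [Module ℂ V] [FiniteDimensional ℂ V]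
      (ρ : Representation ℂ (ProjectiveSpecialLinearGroup (Fin n) F) V),
      (∀ v, (∀ g, ρ g v = v) → v = 0) → Nontrivial V → D ≤ Module.finrank ℂ V := by
    intro V _ _ _ ρ hρ _
    let π := QuotientGroup.mk' (Subgroup.center (SpecialLinearGroup (Fin n) F))
    have hπ : ∀ v, (∀ g, (ρ.comp π) g v = v) → v = 0 := fun v hv => hρ v fun g => by
      obtain ⟨s, rfl⟩ := QuotientGroup.mk'_surjective _ g
      exact hv s
    rcases hD with h | h
    · refine h.trans ?_
      exact_mod_cast pow_card_le_finrank_of_specialLinearGroup (ρ.comp π) hπ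
    · have h1 := card_le_two_mul_finrank_of_specialLinearGroup (ρ.comp π) hπ
      have h2 : (Fintype.card F : ℝ) ≤ 2 * (Module.finrank ℂ V : ℝ) + 1 := by
        exact_mod_cast Nat.sub_le_iff_le_add.1 h1
      linarith
  obtain ⟨a, ha, b, hb, c, hc, rfl⟩ :=
    exists_mul_mul_eq_of_quasirandom hD0 hrep W.toFinset W.toFinset W.toFinset hW x
  exact Set.mul_mem_mul (Set.mul_mem_mul (Set.mem_toFinset.1 ha) (Set.mem_toFinset.1 hb))
    (Set.mem_toFinset.1 hc)

end ProjectiveSpecialLinear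

section SparseWaring

open Matrix

variable {n : ℕ} {F : Type} [Field F] [Fintype F]

lemma mul_mul_eq_univ_of_card_le {D K e R s : ℝ} (hK : 0 < K)
    (hD : D ≤ (Fintype.card F : ℝ) ^ (n - 2) ∨ D ≤ ((Fintype.card F : ℝ) - 1) / 2)
    (hR : Nat.card (ProjectiveSpecialLinearGroup (Fin n) F) ≤ K * (Fintype.card F : ℝ) ^ e * R)
    (hKD : K ^ 3 * (Fintype.card F : ℝ) ^ (3 * (e + s)) < D)
    (W : Set (ProjectiveSpecialLinearGroup (Fin n) F))
    (hW : R / (Fintype.card F : ℝ) ^ s ≤ Nat.card W) : W * W * W = Set.univ := by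
  set q : ℝ := (Fintype.card F : ℝ)
  have hq : 0 < q := Nat.cast_pos.2 Fintype.card_pos
  have hX : (0 : ℝ) < Nat.card (ProjectiveSpecialLinearGroup (Fin n) F) :=
    Nat.cast_pos.2 Nat.card_pos
  have h1 : (Nat.card (ProjectiveSpecialLinearGroup (Fin n) F) : ℝ) ≤
      K * q ^ (e + s) * Nat.card W := by
    rw [Real.rpow_add hq]
    calc _ ≤ K * q ^ e * R := hR
      _ ≤ K * q ^ e * (Nat.card W * q ^ s) := by
        gcongr
        exact (div_le_iff₀ (by positivity)).1 hW
      _ = _ := by ring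
  have hW0 : (0 : ℝ) < Nat.card W := by
    by_contra! h
    have : K * q ^ (e + s) * Nat.card W ≤ 0 := mul_nonpos_of_nonneg_of_nonpos (by positivity) h
    linarith
  refine mul_mul_eq_univ_of_card_lt (lt_trans (by positivity) hKD) hD W ?_
  calc _ ≤ (K * q ^ (e + s) * Nat.card W) ^ 3 := by gcongr
    _ = K ^ 3 * q ^ (3 * (e + s)) * (Nat.card W : ℝ) ^ 3 := by
      rw [mul_pow, mul_pow, ← Real.rpow_natCast (q ^ (e + s)) 3, ← Real.rpow_mul hq.le]
      norm_num [mul_comm]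
    _ < _ := by gcongr

lemma card_le_mul_rpow_mul_of_le {C k m r X R : ℕ} {e : ℝ}
    (he : (n : ℝ) + r * r ≤ m * k + 1 + e)
    (h : Fintype.card F ^ (m * k) * (Fintype.card F - 1) * X ≤
      C * (n ^ (k + 1) * Fintype.card F ^ (n + r * r)) * R) :
    (X : ℝ) ≤ 2 * C * (n : ℝ) ^ (k + 1) * (Fintype.card F : ℝ) ^ e * R := by
  have hq2 : 2 ≤ Fintype.card F := Fintype.one_lt_card
  have h1 : Fintype.card F ≤ 2 * (Fintype.card F - 1) := by omega
  set q := Fintype.card F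
  have hq1 : (1 : ℝ) ≤ q := by exact_mod_cast (by omega : 1 ≤ q)
  have hq : (0 : ℝ) < q := by linarith
  have h2 : q ^ (m * k + 1) * X ≤ 2 * C * n ^ (k + 1) * q ^ (n + r * r) * R :=
    calc q ^ (m * k + 1) * X = q ^ (m * k) * q * X := by ring
      _ ≤ q ^ (m * k) * (2 * (q - 1)) * X := by gcongr
      _ = 2 * (q ^ (m * k) * (q - 1) * X) := by ring
      _ ≤ 2 * _ := Nat.mul_le_mul_left _ h
      _ = _ := by ring
  have h3 : (q : ℝ) ^ (m * k + 1) * X ≤ 2 * C * (n : ℝ) ^ (k + 1) * (q : ℝ) ^ (n + r * r) * R := by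
    exact_mod_cast h2
  have h4 : (q : ℝ) ^ (n + r * r) ≤ (q : ℝ) ^ (m * k + 1) * (q : ℝ) ^ e := by
    rw [← Real.rpow_natCast, ← Real.rpow_natCast, ← Real.rpow_add hq]
    refine Real.rpow_le_rpow_of_exponent_le hq1 ?_
    push_cast
    exact he
  refine le_of_mul_le_mul_left ?_ (pow_pos hq (m * k + 1))
  calc _ ≤ _ := h3
    _ ≤ 2 * C * (n : ℝ) ^ (k + 1) * ((q : ℝ) ^ (m * k + 1) * (q : ℝ) ^ e) * R := by gcongr
    _ = _ := by ring

lemma exists_mul_mul_eq_univ_of_lt_card {d : ℕ} {w : FreeGroup (Fin d)} (hw : w ≠ 1)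
    (hn : 2 ≤ n) : ∃ Q : ℕ, ∀ (F : Type) [Field F] [Fintype F], Q < Fintype.card F →
      ∀ W : Set (ProjectiveSpecialLinearGroup (Fin n) F),
        (Nat.card (Set.range fun f : Fin d → ProjectiveSpecialLinearGroup (Fin n) F =>
          FreeGroup.lift f w) : ℝ) / (Fintype.card F : ℝ) ^ (((n : ℝ) - 1) / 13) ≤ Nat.card W →
        W * W * W = Set.univ := by
  obtain ⟨k, rfl⟩ : ∃ k, n = k + 1 := ⟨n - 1, by omega⟩
  obtain ⟨C, hC0, hC⟩ := exists_card_mul_le_card_range hw (k := k) (by omega)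
  refine ⟨C + (4 * (2 * C * (k + 1) ^ (k + 1)) ^ 3) ^ 2, fun F _ _ hF W hW => ?_⟩
  have h1 := hC F 1 0 (k + 1) one_pos (by ring) (by rw [pow_one]; omega)
  have h2 := card_le_mul_rpow_mul_of_le (e := 0) (by push_cast; linarith) h1
  set q := Fintype.card F with hqdef
  set K : ℝ := 2 * C * ((k + 1 : ℕ) : ℝ) ^ (k + 1) with hK
  have hK0 : 0 < K := by positivity
  have hqK : (4 * K ^ 3) ^ 2 < q := by
    have : (4 * (2 * C * (k + 1) ^ (k + 1)) ^ 3) ^ 2 < q := by omega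
    rw [hK]
    exact_mod_cast this
  have hq2 : (2 : ℝ) ≤ q := by exact_mod_cast Fintype.one_lt_card (α := F)
  have hq1 : (1 : ℝ) ≤ q := by linarith
  have hq : (0 : ℝ) < q := by linarith
  have hsqrt : 4 * K ^ 3 < (q : ℝ) ^ (1 / 2 : ℝ) := by
    rw [← Real.sqrt_eq_rpow]
    exact Real.lt_sqrt_of_sq_lt hqK
  have hlt : K ^ 3 * (q : ℝ) ^ (3 * (0 + (((k + 1 : ℕ) : ℝ) - 1) / 13)) <
      (q : ℝ) ^ ((1 / 2 : ℝ) + 3 * (0 + (((k + 1 : ℕ) : ℝ) - 1) / 13)) / 4 := by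
    rw [Real.rpow_add hq]
    have : (0 : ℝ) < (q : ℝ) ^ (3 * (0 + (((k + 1 : ℕ) : ℝ) - 1) / 13)) := by positivity
    nlinarith
  refine mul_mul_eq_univ_of_card_le hK0 ?_ h2 hlt W hW
  rw [← hqdef]
  rcases eq_or_lt_of_le hn with h | h
  · right
    have hk : k = 1 := by omega
    subst hk
    have : (q : ℝ) ^ ((1 / 2 : ℝ) + 3 * (0 + (((1 + 1 : ℕ) : ℝ) - 1) / 13)) ≤ (q : ℝ) ^ (1 : ℝ) :=
      Real.rpow_le_rpow_of_exponent_le hq1 (by norm_num)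
    rw [Real.rpow_one] at this
    linarith
  · left
    have hk : (2 : ℝ) ≤ k := by exact_mod_cast (by omega : 2 ≤ k)
    have : (q : ℝ) ^ ((1 / 2 : ℝ) + 3 * (0 + (((k + 1 : ℕ) : ℝ) - 1) / 13)) ≤
        (q : ℝ) ^ ((k + 1 - 2 : ℕ) : ℝ) := by
      refine Real.rpow_le_rpow_of_exponent_le hq1 ?_
      rw [show k + 1 - 2 = k - 1 by omega, Nat.cast_sub (by omega)]
      push_cast
      linarith
    rw [Real.rpow_natCast] at this
    have : (0 : ℝ) < (q : ℝ) ^ (k + 1 - 2) := by positivity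
    linarith

lemma eventually_const_mul_pow_lt_two_rpow (A : ℝ) (k : ℕ) {c : ℝ} (hc : 0 < c) :
    ∀ᶠ n : ℕ in Filter.atTop, A * (n : ℝ) ^ k < (2 : ℝ) ^ (c * n) := by
  have h := (tendsto_pow_const_div_const_pow_of_one_lt k
    (Real.one_lt_rpow one_lt_two hc)).const_mul A
  rw [mul_zero] at h
  filter_upwards [h.eventually_lt_const one_pos] with n hn
  rw [← mul_div_assoc, div_lt_one (by positivity)] at hn
  rwa [Real.rpow_mul two_pos.le, Real.rpow_natCast]

lemma exists_mul_mul_eq_univ_of_le_rank {d : ℕ} {w : FreeGroup (Fin d)} (hw : w ≠ 1) :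
    ∃ n₀ : ℕ, ∀ n ≥ n₀, ∀ (F : Type) [Field F] [Fintype F]
      (W : Set (ProjectiveSpecialLinearGroup (Fin n) F)),
        (Nat.card (Set.range fun f : Fin d → ProjectiveSpecialLinearGroup (Fin n) F =>
          FreeGroup.lift f w) : ℝ) / (Fintype.card F : ℝ) ^ (((n : ℝ) - 1) / 13) ≤ Nat.card W →
        W * W * W = Set.univ := by
  obtain ⟨C, hC0, hC⟩ := exists_card_mul_le_card_range hw (k := 4) (by omega)
  refine Filter.eventually_atTop.1 ?_
  filter_upwards [eventually_const_mul_pow_lt_two_rpow (2 ^ 59 * (2 * C) ^ 3) 15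
    (c := 1 / 6) (by norm_num), Filter.eventually_ge_atTop 354,
    Filter.eventually_ge_atTop (5 * C + 5)] with n hn hn1 hn2 F _ _ W hW
  have hmod := Nat.div_add_mod' n 5
  have hr : n % 5 < 5 := Nat.mod_lt _ (by norm_num)
  have hq2' : 2 ≤ Fintype.card F := Fintype.one_lt_card
  have hCq : C ≤ Fintype.card F ^ (n / 5) :=
    calc C ≤ n / 5 := by omega
      _ ≤ 2 ^ (n / 5) := Nat.lt_two_pow_self.le
      _ ≤ _ := Nat.pow_le_pow_left hq2' _
  have h1 := hC F (n / 5) (n % 5) n (by omega) (by omega) hCq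
  set m := n / 5
  set r := n % 5
  have hr2 : r + r * r ≤ 20 := by nlinarith
  have he : (n : ℝ) + r * r ≤ m * (4 : ℕ) + 1 + (m + 19) := by
    have : n + r * r ≤ m * 4 + 1 + (m + 19) := by omega
    exact_mod_cast this
  have h2 := card_le_mul_rpow_mul_of_le he h1
  set q := Fintype.card F with hqdef
  have hq2 : (2 : ℝ) ≤ q := by exact_mod_cast hq2'
  have hq1 : (1 : ℝ) ≤ q := by linarith
  have hq : (0 : ℝ) < q := by linarith
  have hn0 : (354 : ℝ) ≤ n := by exact_mod_cast hn1
  refine mul_mul_eq_univ_of_card_le (by positivity) (Or.inl le_rfl) h2 ?_ W hW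
  rw [← hqdef]
  have h3 : (2 * C * (n : ℝ) ^ (4 + 1)) ^ 3 < (2 : ℝ) ^ (1 / 6 * (n : ℝ) - 59) := by
    rw [Real.rpow_sub two_pos, lt_div_iff₀ (by positivity)]
    calc _ = 2 ^ 59 * (2 * (C : ℝ)) ^ 3 * (n : ℝ) ^ 15 := by
          rw [show (59 : ℝ) = ((59 : ℕ) : ℝ) by norm_num, Real.rpow_natCast]; ring
      _ < _ := hn
  have h4 : (2 : ℝ) ^ (1 / 6 * (n : ℝ) - 59) ≤ (q : ℝ) ^ (1 / 6 * (n : ℝ) - 59) :=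
    Real.rpow_le_rpow two_pos.le hq2 (by linarith)
  have h5 : (m : ℝ) * 5 ≤ n := by exact_mod_cast (by omega : m * 5 ≤ n)
  calc _ < (q : ℝ) ^ (1 / 6 * (n : ℝ) - 59) * (q : ℝ) ^ (3 * ((m : ℝ) + 19 + (n - 1) / 13)) := by
        gcongr
        exact h3.trans_le h4
    _ = (q : ℝ) ^ (1 / 6 * (n : ℝ) - 59 + 3 * ((m : ℝ) + 19 + (n - 1) / 13)) :=
        (Real.rpow_add hq _ _).symm
    _ ≤ (q : ℝ) ^ ((n - 2 : ℕ) : ℝ) := by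
        refine Real.rpow_le_rpow_of_exponent_le hq1 ?_
        rw [Nat.cast_sub (by omega)]
        push_cast
        linarith
    _ = _ := Real.rpow_natCast _ _

end SparseWaring

/-- **Sparse Waring-type theorem** for the groups `PSL(n,q)`: let `w` be a
nontrivial element of the free group of rank `d`. There is `N = N(w) > 0` such
that for all `n ≥ 2` and all finite fields `F` of order `q`, with `L = PSL(n,q)`
and `w(L)` the image of the word map induced by `w`: if `|L| > N` and
`W ⊆ w(L)` satisfies `|W| ≥ |w(L)| / q^((n-1)/13)`, then `W³ = L`. -/
theorem sparse_waring_PSL (d : ℕ) (w : FreeGroup (Fin d)) (hw : w ≠ 1) :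
    ∃ N : ℕ, 0 < N ∧
      ∀ (n : ℕ), 2 ≤ n →
        ∀ (F : Type) [Field F] [Fintype F],
          N < Nat.card (Matrix.ProjectiveSpecialLinearGroup (Fin n) F) →
          ∀ W : Set (Matrix.ProjectiveSpecialLinearGroup (Fin n) F),
            W ⊆ Set.range
              (fun f : Fin d → Matrix.ProjectiveSpecialLinearGroup (Fin n) F =>
                FreeGroup.lift f w) →
            (Nat.card ↥(Set.range
                (fun f : Fin d → Matrix.ProjectiveSpecialLinearGroup (Fin n) F =>
                  FreeGroup.lift f w)) : ℝ) /
              (Fintype.card F : ℝ) ^ (((n : ℝ) - 1) / 13) ≤ (Nat.card ↥W : ℝ) →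
            W * W * W = Set.univ := by
  obtain ⟨n₀, hn₀⟩ := exists_mul_mul_eq_univ_of_le_rank hw
  choose! Q hQ using fun n (hn : 2 ≤ n) => exists_mul_mul_eq_univ_of_lt_card (n := n) hw hn
  set M := ∑ n ∈ Finset.range n₀, Q n + 1
  refine ⟨M ^ (n₀ * n₀), by positivity, fun n hn F _ _ hN W _ hW => ?_⟩
  rcases le_or_gt n₀ n with h | h
  · exact hn₀ n h F W hW
  · refine hQ n hn F ?_ W hW
    have hM : Q n < M := Nat.lt_succ_of_le
      (Finset.single_le_sum (f := Q) (fun _ _ => Nat.zero_le _) (Finset.mem_range.2 h))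
    refine hM.trans_le ?_
    by_contra! hlt
    refine hN.not_ge ?_
    calc _ ≤ Fintype.card F ^ (n * n) := card_projectiveSpecialLinearGroup_le
      _ ≤ M ^ (n * n) := Nat.pow_le_pow_left hlt.le _
      _ ≤ M ^ (n₀ * n₀) :=
        Nat.pow_le_pow_right (Nat.succ_pos _) (Nat.mul_le_mul h.le h.le)
end

section
/- For all integers n ≥ 2 and all powers q of a prime p, the group L = PSL(n,q) is the setwise product of 5 of its Sylow p-subgroups: there exist Sylow p-subgroups P₁, …, P₅ of L such that every element of L is a product u₁u₂u₃u₄u₅ with uᵢ ∈ Pᵢ. -/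
namespace Matrix

section Unitriangular

variable {m R : Type*} [LinearOrder m]

/-- An upper triangular matrix with ones on the diagonal. -/
def IsUpperUnitriangular [Zero R] [One R] (M : Matrix m m R) : Prop :=
  M.IsUpperTriangular ∧ ∀ i, M i i = 1

lemma IsUpperTriangular.mul_apply_self [Fintype m] [NonUnitalNonAssocSemiring R]
    {M N : Matrix m m R} (hM : M.IsUpperTriangular) (hN : N.IsUpperTriangular) (i : m) :
    (M * N) i i = M i i * N i i := by
  rw [mul_apply, Finset.sum_eq_single i]
  · intro j _ hj
    rcases lt_or_gt_of_ne hj with h | h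
    · rw [hM h, zero_mul]
    · rw [hN h, mul_zero]
  · simp

lemma IsUpperUnitriangular.mul [Fintype m] [NonAssocSemiring R] {M N : Matrix m m R}
    (hM : M.IsUpperUnitriangular) (hN : N.IsUpperUnitriangular) :
    (M * N).IsUpperUnitriangular :=
  ⟨BlockTriangular.mul hM.1 hN.1, fun i => by
    rw [IsUpperTriangular.mul_apply_self hM.1 hN.1, hM.2, hN.2, one_mul]⟩

lemma isUpperUnitriangular_one [NonAssocSemiring R] :
    (1 : Matrix m m R).IsUpperUnitriangular :=
  ⟨blockTriangular_one, one_apply_eq⟩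

variable [Fintype m]

lemma IsUpperUnitriangular.det_eq_one [CommRing R] {M : Matrix m m R}
    (hM : M.IsUpperUnitriangular) : M.det = 1 := by
  simp [det_of_isUpperTriangular hM.1, hM.2]

lemma IsUpperUnitriangular.adjugate [CommRing R] {M : Matrix m m R}
    (hM : M.IsUpperUnitriangular) : M.adjugate.IsUpperUnitriangular := by
  have hmul : M * M.adjugate = 1 := by rw [mul_adjugate, hM.det_eq_one, one_smul]
  have : Invertible M := invertibleOfRightInverse _ _ hmul
  have hT : M.adjugate.IsUpperTriangular := by
    rw [← inv_eq_right_inv hmul]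
    exact blockTriangular_inv_of_blockTriangular hM.1
  refine ⟨hT, fun i => ?_⟩
  have h := IsUpperTriangular.mul_apply_self hM.1 hT i
  rwa [hmul, one_apply_eq, hM.2, one_mul, eq_comm] at h

lemma IsUpperUnitriangular.sub_one_pow_card [CommRing R] {M : Matrix m m R}
    (hM : M.IsUpperUnitriangular) : (M - 1) ^ Fintype.card m = 0 := by
  have h := aeval_self_charpoly M
  rw [charpoly_of_isUpperTriangular M hM.1] at h
  simpa [hM.2] using h

lemma IsUpperUnitriangular.pow_char_pow_card [CommRing R] (p : ℕ) [Fact p.Prime] [CharP R p]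
    {M : Matrix m m R} (hM : M.IsUpperUnitriangular) : M ^ p ^ Fintype.card m = 1 := by
  cases isEmpty_or_nonempty m
  · exact Subsingleton.elim _ _
  have h : (M - 1) ^ p ^ Fintype.card m = 0 :=
    pow_eq_zero_of_le (Nat.lt_pow_self (Fact.out : p.Prime).one_lt).le hM.sub_one_pow_card
  rwa [sub_pow_char_pow_of_commute _ _ (Commute.one_right M), one_pow, sub_eq_zero] at h

variable (m R) in
/-- The subgroup of upper unitriangular matrices in the special linear group. -/
def SpecialLinearGroup.upperUnitriangular [CommRing R] :
    Subgroup (SpecialLinearGroup m R) where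
  carrier := {g | g.1.IsUpperUnitriangular}
  one_mem' := isUpperUnitriangular_one
  mul_mem' hg hh := IsUpperUnitriangular.mul hg hh
  inv_mem' hg := IsUpperUnitriangular.adjugate hg

variable (m R) in
/-- The subgroup of lower unitriangular matrices in the special linear group. -/
def SpecialLinearGroup.lowerUnitriangular [CommRing R] :
    Subgroup (SpecialLinearGroup m R) where
  carrier := {g | g.1ᵀ.IsUpperUnitriangular}
  one_mem' := by simpa using isUpperUnitriangular_one
  mul_mem' {g h} hg hh := by
    simpa [transpose_mul] using IsUpperUnitriangular.mul hh hg
  inv_mem' {g} hg := by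
    simpa [SpecialLinearGroup.coe_inv, adjugate_transpose] using IsUpperUnitriangular.adjugate hg

lemma SpecialLinearGroup.isPGroup_upperUnitriangular [CommRing R] (p : ℕ) [Fact p.Prime]
    [CharP R p] : IsPGroup p (upperUnitriangular m R) := fun g =>
  ⟨Fintype.card m, Subtype.ext <| Subtype.ext <| by
    simpa using IsUpperUnitriangular.pow_char_pow_card p g.2⟩

lemma SpecialLinearGroup.isPGroup_lowerUnitriangular [CommRing R] (p : ℕ) [Fact p.Prime]
    [CharP R p] : IsPGroup p (lowerUnitriangular m R) := fun g =>
  ⟨Fintype.card m, Subtype.ext <| Subtype.ext <| transpose_injective <| by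
    simpa [transpose_pow] using IsUpperUnitriangular.pow_char_pow_card p g.2⟩

end Unitriangular

section ConsBlock

variable {R : Type*} {n : ℕ}

/-- The matrix with top-left entry `a`, remaining first row `b`, remaining first column `c`
and remaining block `D`. -/
def consBlock (a : R) (b c : Fin n → R) (D : Matrix (Fin n) (Fin n) R) :
    Matrix (Fin (n + 1)) (Fin (n + 1)) R :=
  of (vecCons (vecCons a b) fun i => vecCons (c i) (D i))

lemma exists_eq_consBlock (M : Matrix (Fin (n + 1)) (Fin (n + 1)) R) :
    ∃ a b c D, M = consBlock a b c D :=
  ⟨M 0 0, fun j => M 0 j.succ, fun i => M i.succ 0, fun i j => M i.succ j.succ, by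
    ext i j
    cases i using Fin.cases <;> cases j using Fin.cases <;> simp [consBlock]⟩

lemma consBlock_mul [CommRing R] (a a' : R) (b c b' c' : Fin n → R)
    (D D' : Matrix (Fin n) (Fin n) R) :
    consBlock a b c D * consBlock a' b' c' D' =
      consBlock (a * a' + b ⬝ᵥ c') (a • b' + b ᵥ* D') (a' • c + D *ᵥ c')
        (vecMulVec c b' + D * D') := by
  ext i j
  cases i using Fin.cases <;> cases j using Fin.cases <;>
    simp [consBlock, mul_apply, Fin.sum_univ_succ, dotProduct, vecMul, mulVec, vecMulVec_apply,
      mul_comm]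

lemma consBlock_one [CommRing R] : consBlock (1 : R) (0 : Fin n → R) 0 1 = 1 := by
  ext i j
  cases i using Fin.cases <;> cases j using Fin.cases <;>
    simp [consBlock, one_apply, Fin.succ_ne_zero, Ne.symm (Fin.succ_ne_zero _)]

lemma consBlock_upper_mul [CommRing R] (z w : Fin n → R) :
    consBlock 1 z 0 1 * consBlock 1 w 0 1 = consBlock 1 (z + w) 0 1 := by
  simp [consBlock_mul, add_comm]

lemma consBlock_lower_mul [CommRing R] (z w : Fin n → R) :
    consBlock 1 0 z 1 * consBlock 1 0 w 1 = consBlock 1 0 (z + w) 1 := by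
  simp [consBlock_mul]

lemma det_consBlock_zero_right [CommRing R] (a : R) (c : Fin n → R)
    (D : Matrix (Fin n) (Fin n) R) : (consBlock a 0 c D).det = a * D.det := by
  rw [det_succ_row_zero, Fin.sum_univ_succ]
  have : (consBlock a 0 c D).submatrix Fin.succ (Fin.succAbove 0) = D := by
    ext i j
    simp [consBlock]
  rw [this]
  simp [consBlock]

lemma transpose_consBlock (a : R) (b c : Fin n → R) (D : Matrix (Fin n) (Fin n) R) :
    (consBlock a b c D)ᵀ = consBlock a c b Dᵀ := by
  ext i j
  cases i using Fin.cases <;> cases j using Fin.cases <;> simp [consBlock]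

lemma IsUpperUnitriangular.consBlock [Zero R] [One R] {D : Matrix (Fin n) (Fin n) R}
    (hD : D.IsUpperUnitriangular) (b : Fin n → R) :
    (consBlock 1 b 0 D).IsUpperUnitriangular := by
  constructor
  · intro i j hij
    cases i using Fin.cases with
    | zero => simp at hij
    | succ i =>
      cases j using Fin.cases with
      | zero => simp [Matrix.consBlock]
      | succ j => simpa [Matrix.consBlock] using hD.1 (by simpa using hij)
  · intro i
    cases i using Fin.cases <;> simp [Matrix.consBlock, hD.2]

lemma det_consBlock_upper [CommRing R] (b : Fin n → R) :
    (consBlock 1 b 0 1).det = 1 := (isUpperUnitriangular_one.consBlock b).det_eq_one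

lemma det_consBlock_lower [CommRing R] (c : Fin n → R) :
    (consBlock 1 0 c 1).det = 1 := by rw [det_consBlock_zero_right, det_one, one_mul]

/-- Over a field, four elementary block operations on the right reduce a matrix of
determinant one to a block diagonal matrix with top-left entry one. -/
lemma exists_eq_consBlock_mul {F : Type*} [Field F] (hn : 0 < n)
    (M : Matrix (Fin (n + 1)) (Fin (n + 1)) F) (hM : M.det = 1) :
    ∃ (D : Matrix (Fin n) (Fin n) F) (c₁ b₁ c₂ b₂ : Fin n → F), D.det = 1 ∧
      M = consBlock 1 0 0 D * consBlock 1 0 c₁ 1 * consBlock 1 b₁ 0 1 *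
        consBlock 1 0 c₂ 1 * consBlock 1 b₂ 0 1 := by
  obtain ⟨a, b, c, D, rfl⟩ := exists_eq_consBlock M
  obtain ⟨x, hx⟩ : ∃ x : Fin n → F, a • x + b ≠ 0 := by
    by_cases hb : b = 0
    · subst hb
      have ha : a ≠ 0 := by
        rintro rfl
        simp [det_consBlock_zero_right] at hM
      refine ⟨Pi.single ⟨0, hn⟩ 1, fun h => ha ?_⟩
      simpa using congrFun h ⟨0, hn⟩
    · exact ⟨0, by simpa using hb⟩
  obtain ⟨i, hi⟩ := Function.ne_iff.1 hx
  set b' := a • x + b with hb'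
  set y : Fin n → F := Pi.single i ((b' i)⁻¹ * (1 - a)) with hy
  have hy1 : a + b' ⬝ᵥ y = 1 := by
    rw [hy, dotProduct_single, mul_inv_cancel_left₀ hi]; ring
  set D' := vecMulVec c x + D with hD'
  set c' := c + D' *ᵥ y with hc'
  set E := D' - vecMulVec c' b' with hE
  have h1 : consBlock a b c D * consBlock 1 x 0 1 * consBlock 1 0 y 1 * consBlock 1 (-b') 0 1 =
      consBlock 1 0 c' E := by
    simp only [consBlock_mul]
    simp [hy1, ← hb', ← hD', ← hc', hE, vecMulVec_neg, sub_eq_neg_add]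
  have hEdet : E.det = 1 := by
    have := congrArg det h1
    simpa [det_consBlock_zero_right, det_consBlock_upper, det_consBlock_lower, hM] using this.symm
  have hEu : IsUnit E.det := by simp [hEdet]
  refine ⟨E, E⁻¹ *ᵥ c', b', -y, -x, hEdet, ?_⟩
  have h2 : consBlock 1 0 0 E * consBlock 1 0 (E⁻¹ *ᵥ c') 1 = consBlock 1 0 c' E := by
    simp [consBlock_mul, mul_nonsing_inv _ hEu]
  have hu (z w : Fin n → F) (h : z + w = 0) :
      consBlock (1 : F) z 0 1 * consBlock 1 w 0 1 = 1 := by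
    rw [consBlock_upper_mul, h, consBlock_one]
  have hl (z w : Fin n → F) (h : z + w = 0) :
      consBlock (1 : F) 0 z 1 * consBlock 1 0 w 1 = 1 := by
    rw [consBlock_lower_mul, h, consBlock_one]
  rw [h2, ← h1]
  simp only [Matrix.mul_assoc]
  rw [← Matrix.mul_assoc (consBlock 1 (-b') 0 1), hu _ _ (neg_add_cancel b'), Matrix.one_mul,
    ← Matrix.mul_assoc (consBlock 1 0 y 1), hl _ _ (add_neg_cancel y), Matrix.one_mul,
    hu _ _ (add_neg_cancel x), Matrix.mul_one]

/-- Every matrix of determinant one over a field is a product `L₁ * U₁ * L₂ * U₂` with `L₁`, `L₂`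
lower unitriangular and `U₁`, `U₂` upper unitriangular. -/
theorem exists_lower_upper_lower_upper {F : Type*} [Field F] (n : ℕ)
    (M : Matrix (Fin n) (Fin n) F) (hM : M.det = 1) :
    ∃ L₁ U₁ L₂ U₂ : Matrix (Fin n) (Fin n) F,
      L₁ᵀ.IsUpperUnitriangular ∧ U₁.IsUpperUnitriangular ∧
      L₂ᵀ.IsUpperUnitriangular ∧ U₂.IsUpperUnitriangular ∧ M = L₁ * U₁ * L₂ * U₂ := by
  induction n with
  | zero =>
    have h := isUpperUnitriangular_one (m := Fin 0) (R := F)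
    exact ⟨1, 1, 1, 1, by simpa, h, by simpa, h, Subsingleton.elim _ _⟩
  | succ n ih =>
    rcases n.eq_zero_or_pos with rfl | hn
    · have h := isUpperUnitriangular_one (m := Fin 1) (R := F)
      refine ⟨1, 1, 1, 1, by simpa, h, by simpa, h, ?_⟩
      ext i j
      fin_cases i; fin_cases j
      simpa using hM
    obtain ⟨D, c₁, b₁, c₂, b₂, hD, rfl⟩ := exists_eq_consBlock_mul hn M hM
    obtain ⟨L₁, U₁, L₂, U₂, hL₁, hU₁, hL₂, hU₂, rfl⟩ := ih D hD
    have hdet : IsUnit (L₂ * U₂).det := by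
      rw [det_mul, ← det_transpose, hL₂.det_eq_one, hU₂.det_eq_one, one_mul]
      exact isUnit_one
    refine ⟨consBlock 1 0 ((L₁ * U₁ * L₂ * U₂) *ᵥ c₁) L₁,
      consBlock 1 (b₁ ᵥ* (L₂ * U₂)⁻¹) 0 U₁,
      consBlock 1 0 ((L₂ * U₂) *ᵥ c₂) L₂, consBlock 1 b₂ 0 U₂, ?_, hU₁.consBlock _, ?_,
      hU₂.consBlock _, ?_⟩
    · rw [transpose_consBlock]; exact hL₁.consBlock _
    · rw [transpose_consBlock]; exact hL₂.consBlock _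
    · have hQ : (L₂ * U₂)⁻¹ * (L₂ * U₂) = 1 := nonsing_inv_mul _ hdet
      rw [Matrix.mul_assoc (consBlock 1 0 _ L₁ * _), Matrix.mul_assoc (L₁ * U₁)]
      simp only [consBlock_mul]
      generalize L₂ * U₂ = Q at *
      generalize L₁ * U₁ = P at *
      simp [hQ, dotProduct_mulVec, vecMul_vecMul, Matrix.add_mul, vecMulVec_mul, mul_vecMulVec,
        vecMul_add, vecMul_vecMulVec, add_mulVec, add_vecMulVec, vecMulVec_mulVec,
        Matrix.mul_add, add_smul]
      congr 1 <;> abel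

end ConsBlock

end Matrix

open scoped MatrixGroups Pointwise

/-- `L = PSL(n,q)` (with `q` a power of the prime `p`, i.e. `F` a finite field of
characteristic `p` and order `q`) is a product of 5 of its Sylow `p`-subgroups:
there are Sylow `p`-subgroups `P 0, …, P 4` such that every element of `L` is a
product `u 0 * u 1 * u 2 * u 3 * u 4` with `u i ∈ P i`. -/
theorem PSL_product_of_five_sylow (n : ℕ) (hn : 2 ≤ n) (p : ℕ) (hp : p.Prime)
    (F : Type) [Field F] [Fintype F] [CharP F p] :
    ∃ P : Fin 5 → Sylow p (Matrix.ProjectiveSpecialLinearGroup (Fin n) F),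
      ∀ x : Matrix.ProjectiveSpecialLinearGroup (Fin n) F,
        ∃ u : Fin 5 → Matrix.ProjectiveSpecialLinearGroup (Fin n) F,
          (∀ i, u i ∈ (P i : Subgroup (Matrix.ProjectiveSpecialLinearGroup (Fin n) F))) ∧
          x = u 0 * u 1 * u 2 * u 3 * u 4 := by
  have : Fact p.Prime := ⟨hp⟩
  let π := QuotientGroup.mk' (Subgroup.center (Matrix.SpecialLinearGroup (Fin n) F))
  obtain ⟨Q, hQ⟩ :=
    ((Matrix.SpecialLinearGroup.isPGroup_lowerUnitriangular (m := Fin n) (R := F) p).map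
      π).exists_le_sylow
  obtain ⟨S, hS⟩ :=
    ((Matrix.SpecialLinearGroup.isPGroup_upperUnitriangular (m := Fin n) (R := F) p).map
      π).exists_le_sylow
  refine ⟨![Q, S, Q, S, Q], fun x => ?_⟩
  obtain ⟨g, rfl⟩ := QuotientGroup.mk'_surjective _ x
  obtain ⟨L₁, U₁, L₂, U₂, hL₁, hU₁, hL₂, hU₂, hg⟩ :=
    Matrix.exists_lower_upper_lower_upper n g.1 g.2
  let l₁ : Matrix.SpecialLinearGroup (Fin n) F := ⟨L₁, L₁.det_transpose ▸ hL₁.det_eq_one⟩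
  let u₁ : Matrix.SpecialLinearGroup (Fin n) F := ⟨U₁, hU₁.det_eq_one⟩
  let l₂ : Matrix.SpecialLinearGroup (Fin n) F := ⟨L₂, L₂.det_transpose ▸ hL₂.det_eq_one⟩
  let u₂ : Matrix.SpecialLinearGroup (Fin n) F := ⟨U₂, hU₂.det_eq_one⟩
  have hgl : g = l₁ * u₁ * l₂ * u₂ := Subtype.ext hg
  refine ⟨![π l₁, π u₁, π l₂, π u₂, 1], fun i => ?_, ?_⟩
  · fin_cases i
    · exact hQ (Subgroup.mem_map_of_mem π hL₁)
    · exact hS (Subgroup.mem_map_of_mem π hU₁)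
    · exact hQ (Subgroup.mem_map_of_mem π hL₂)
    · exact hS (Subgroup.mem_map_of_mem π hU₂)
    · exact one_mem _
  · change π g = π l₁ * π u₁ * π l₂ * π u₂ * 1
    rw [hgl, map_mul, map_mul, map_mul, mul_one]
end
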